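/- Let n ≥ 1, s > 0, θ > 1/2, 0 < a < min(2s, 1), and let p, q satisfy aq < 2, max(1/2 + a − 2s, a/2) < 1/q < 1/2, and 1 − 2/q + a − 2s ≤ 1/p < 1/2 − 1/q. Then there exist ε₀ > 0 and C such that: if A_0, f, φ are Schwartz M_n(ℂ)-valued functions on ℝ^{1+2} satisfying △A_0 = −∂_1[A_0,∂_2 f] + ∂_2[A_0,∂_1 f] + ∂_1[∂_1 f,φ] + ∂_2[∂_2 f,φ] pointwise and ‖∇f‖_{H^{s,θ}} ≤ ε₀, then ‖A_0‖_{L^p_t W^{a,q}_x} ≤ C·‖φ‖_{H^{s,θ}}·‖∇f‖_{H^{s,θ}}. -/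

import Mathlib

noncomputable section

open MeasureTheory Real
open scoped ENNReal RealInnerProductSpace

/-- The spatial domain `ℝ²`. -/
abbrev V2 : Type := EuclideanSpace ℝ (Fin 2)

/-- Space-time Fourier transform on `ℝ^{1+2}`, convention `e^{-i(tτ + x·ξ)}`. -/
def ftST (u : ℝ × V2 → ℂ) (τ : ℝ) (ξ : V2) : ℂ :=
  ∫ p : ℝ × V2, Complex.exp (-Complex.I * ((p.1 * τ + ⟪p.2, ξ⟫ : ℝ) : ℂ)) * u p

/-- The weight `(1+|ξ|²)^{s/2} (1+||τ|-|ξ||)^θ`. -/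
def wgt (s θ τ : ℝ) (ξ : V2) : ℝ :=
  (1 + ‖ξ‖ ^ 2) ^ (s / 2) * (1 + |(|τ| - ‖ξ‖)|) ^ θ

/-- The Wave–Sobolev norm `H^{s,θ}` on `ℝ^{1+2}`. -/
def HN (s θ : ℝ) (u : ℝ × V2 → ℂ) : ℝ≥0∞ :=
  (∫⁻ q : ℝ × V2, (ENNReal.ofReal (wgt s θ q.1 q.2) * (‖ftST u q.1 q.2‖₊ : ℝ≥0∞)) ^ (2 : ℕ)) ^
    ((1 : ℝ) / 2)

/-- Time derivative `∂ₜ u`. -/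
def dtime (u : ℝ × V2 → ℂ) : ℝ × V2 → ℂ :=
  fun p => fderiv ℝ u p ((1 : ℝ), (0 : V2))

/-- The norm of `𝓗^{s,θ}`: `‖u‖_{H^{s,θ}} + ‖∂ₜu‖_{H^{s-1,θ}}`. -/
def HHN (s θ : ℝ) (u : ℝ × V2 → ℂ) : ℝ≥0∞ :=
  HN s θ u + HN (s - 1) θ (dtime u)

/-- Spatial partial derivative `∂ⱼ u`, `j = 0, 1`. -/
def pdx (j : Fin 2) (u : ℝ × V2 → ℂ) : ℝ × V2 → ℂ :=
  fun p => fderiv ℝ u p ((0 : ℝ), EuclideanSpace.single j 1)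

/-- Inverse space-time Fourier transform. -/
def iftST (F : ℝ → V2 → ℂ) (t : ℝ) (x : V2) : ℂ :=
  ((((2 * π) ^ 3)⁻¹ : ℝ) : ℂ) *
    ∫ q : ℝ × V2, Complex.exp (Complex.I * ((t * q.1 + ⟪x, q.2⟫ : ℝ) : ℂ)) * F q.1 q.2

/-- The space-time Fourier multiplier with symbol `m`. -/
def mult (m : ℝ → V2 → ℂ) (u : ℝ × V2 → ℂ) : ℝ × V2 → ℂ :=
  fun p => iftST (fun τ ξ => m τ ξ * ftST u τ ξ) p.1 p.2

/-- Spatial Fourier transform on `ℝ²`, convention `e^{-i x·ξ}`. -/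
def ft2 (g : V2 → ℂ) (ξ : V2) : ℂ :=
  ∫ x : V2, Complex.exp (-Complex.I * ((⟪x, ξ⟫ : ℝ) : ℂ)) * g x

/-- Inverse spatial Fourier transform on `ℝ²`. -/
def ift2 (G : V2 → ℂ) (x : V2) : ℂ :=
  ((((2 * π) ^ 2)⁻¹ : ℝ) : ℂ) *
    ∫ ξ : V2, Complex.exp (Complex.I * ((⟪x, ξ⟫ : ℝ) : ℂ)) * G ξ

/-- The spatial Fourier multiplier `D_x^a` with symbol `|ξ|^a`, acting on functions
on space-time for each fixed time. -/
def DxA (a : ℝ) (u : ℝ × V2 → ℂ) : ℝ × V2 → ℂ :=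
  fun p => ift2 (fun ξ => ((‖ξ‖ ^ a : ℝ) : ℂ) * ft2 (fun y => u (p.1, y)) ξ) p.2

/-- Entrywise coercion of a Schwartz matrix-valued function to a matrix of functions. -/
def cF {n : ℕ} (A : Fin n → Fin n → SchwartzMap (ℝ × V2) ℂ) :
    Fin n → Fin n → (ℝ × V2 → ℂ) :=
  fun i k => ⇑(A i k)

/-- Entrywise commutator `[U,V] = UV - VU` of matrix-valued functions. -/
def mcomm {n : ℕ} (U V : Fin n → Fin n → (ℝ × V2 → ℂ)) (i k : Fin n) :
    ℝ × V2 → ℂ :=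
  fun p => (∑ l, U i l p * V l k p) - ∑ l, V i l p * U l k p

/-- The matrix `∂ⱼ f` of spatial partial derivatives of a Schwartz matrix-valued map. -/
def pdf {n : ℕ} (j : Fin 2) (f : Fin n → Fin n → SchwartzMap (ℝ × V2) ℂ) :
    Fin n → Fin n → (ℝ × V2 → ℂ) :=
  fun i k => pdx j ⇑(f i k)

/-- `H^{s,θ}` norm of a matrix-valued function, applied entrywise and summed. -/
def HNM {n : ℕ} (s θ : ℝ) (U : Fin n → Fin n → (ℝ × V2 → ℂ)) : ℝ≥0∞ :=
  ∑ i, ∑ k, HN s θ (U i k)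

/-- `‖∇f‖_{H^{s,θ}} = (‖∂₁f‖² + ‖∂₂f‖²)^{1/2}`. -/
def gradN {n : ℕ} (s θ : ℝ) (f : Fin n → Fin n → SchwartzMap (ℝ × V2) ℂ) : ℝ≥0∞ :=
  (HNM s θ (pdf 0 f) ^ (2 : ℕ) + HNM s θ (pdf 1 f) ^ (2 : ℕ)) ^ ((1 : ℝ) / 2)

/-- The elliptic equation
`△A₀ = -∂₁[A₀,∂₂f] + ∂₂[A₀,∂₁f] + ∂₁[∂₁f,φ] + ∂₂[∂₂f,φ]`, holding pointwise. -/
def EllipticEq {n : ℕ} (A0 f φ : Fin n → Fin n → SchwartzMap (ℝ × V2) ℂ) : Prop :=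
  ∀ (i k : Fin n) (p : ℝ × V2),
    pdx 0 (pdx 0 ⇑(A0 i k)) p + pdx 1 (pdx 1 ⇑(A0 i k)) p =
      -pdx 0 (mcomm (cF A0) (pdf 1 f) i k) p + pdx 1 (mcomm (cF A0) (pdf 0 f) i k) p +
        pdx 0 (mcomm (pdf 0 f) (cF φ) i k) p + pdx 1 (mcomm (pdf 1 f) (cF φ) i k) p

/-- Pointwise norm of a matrix of functions (entrywise and summed). -/
def mE {n : ℕ} (U : Fin n → Fin n → (ℝ × V2 → ℂ)) (p : ℝ × V2) : ℝ≥0∞ :=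
  ∑ i, ∑ k, (‖U i k p‖₊ : ℝ≥0∞)

/-- Entrywise application of the multiplier `D_x^a` to a matrix of functions. -/
def DxU {n : ℕ} (a : ℝ) (U : Fin n → Fin n → (ℝ × V2 → ℂ)) :
    Fin n → Fin n → (ℝ × V2 → ℂ) :=
  fun i k => DxA a (U i k)

/-- Spatial `L^q` norm of a matrix-valued function at fixed time `t`. -/
def LqAt {n : ℕ} (q : ℝ) (U : Fin n → Fin n → (ℝ × V2 → ℂ)) (t : ℝ) : ℝ≥0∞ :=
  (∫⁻ x : V2, mE U (t, x) ^ q) ^ q⁻¹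

/-- `L^p` norm in time, written in terms of `rp = 1/p ∈ [0,1]`; `rp = 0` is `L^∞`. -/
def LtR (rp : ℝ) (F : ℝ → ℝ≥0∞) : ℝ≥0∞ :=
  if rp = 0 then essSup F volume else (∫⁻ t : ℝ, F t ^ rp⁻¹) ^ rp

/-- `L^p` norm in time, `p` finite. -/
def Ltp (p : ℝ) (F : ℝ → ℝ≥0∞) : ℝ≥0∞ :=
  (∫⁻ t : ℝ, F t ^ p) ^ p⁻¹

open ENNReal (ofReal ofReal_mul mul_rpow_of_nonneg ofReal_le_ofReal ofReal_ne_top rpow_ne_top_of_nonneg)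
open Complex (I norm_real norm_exp_ofReal_mul_I)
open Set (Ioi univ Icc Ioc Ioo indicator_of_mem indicator_of_notMem)
open Filter.Eventually (of_forall)

abbrev SST := SchwartzMap (ℝ × V2) ℂ

lemma erm (x : ℝ≥0∞) (y z : ℝ) : x ^ (y * z) = (x ^ y) ^ z := ENNReal.rpow_mul x y z

lemma erl {x y : ℝ≥0∞} {z : ℝ} (h : x ≤ y) (hz : 0 ≤ z) : x ^ z ≤ y ^ z := ENNReal.rpow_le_rpow h hz

lemma dual_Lp {α : Type*} [MeasurableSpace α] (μ : Measure α) [SigmaFinite μ] {p p' : ℝ}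
    (hpp : p.HolderConjugate p') {Φ : α → ℝ≥0∞} (hΦ : Measurable Φ) {M : ℝ≥0∞}
    (h : ∀ g : α → ℝ≥0∞, Measurable g → ∫⁻ x, Φ x * g x ∂μ ≤ M * (∫⁻ x, g x ^ p' ∂μ) ^ (1 / p')) :
    (∫⁻ x, Φ x ^ p ∂μ) ^ (1 / p) ≤ M := by
  have hp0 : 0 < p := hpp.pos
  have hp1 : 1 < p := hpp.lt
  set Φn : ℕ → α → ℝ≥0∞ := fun n => (spanningSets μ n).indicator (fun x => min (Φ x) n) with hΦn
  have hmeas : ∀ n, Measurable (Φn n) := fun n =>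
    (hΦ.min measurable_const).indicator (measurableSet_spanningSets μ n)
  have hle : ∀ n x, Φn n x ≤ Φ x := by
    intro n x
    simp only [hΦn, Set.indicator]
    split_ifs
    · exact min_le_left _ _
    · exact zero_le
  have hmono : Monotone Φn := by
    intro n m hnm x
    simp only [hΦn, Set.indicator]
    split_ifs with h1 h2
    · exact min_le_min le_rfl (by exact_mod_cast hnm)
    · exact absurd (monotone_spanningSets μ hnm h1) h2
    · exact zero_le
    · exact le_rfl
  have hsup : ∀ x, ⨆ n, Φn n x = Φ x := by
    intro x
    apply le_antisymm (iSup_le fun n => hle n x)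
    apply le_of_forall_lt
    intro c hc
    obtain ⟨k, hk⟩ : ∃ k : ℕ, c < k := ENNReal.exists_nat_gt (ne_top_of_lt hc)
    have hx : x ∈ spanningSets μ (spanningSetsIndex μ x) := mem_spanningSetsIndex μ x
    set m := max k (spanningSetsIndex μ x)
    refine lt_of_lt_of_le ?_ (le_iSup _ m)
    have hx' : x ∈ spanningSets μ m := monotone_spanningSets μ (le_max_right _ _) hx
    simp only [hΦn, Set.indicator, hx', if_true]
    refine lt_min hc (hk.trans_le ?_)
    exact_mod_cast le_max_left _ _
  have key : ∀ n, ∫⁻ x, Φn n x ^ p ∂μ ≤ M ^ p := by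
    intro n
    set I := ∫⁻ x, Φn n x ^ p ∂μ with hI
    have hfin : I ≠ ∞ := by
      have : I ≤ ∫⁻ x, (spanningSets μ n).indicator (fun _ => (n : ℝ≥0∞) ^ p) x ∂μ := by
        apply lintegral_mono
        intro x
        simp only [hΦn, Set.indicator]
        split_ifs
        · exact erl (min_le_right _ _) hp0.le
        · simp [hp0]
      refine ne_top_of_le_ne_top ?_ this
      rw [lintegral_indicator (measurableSet_spanningSets μ n), lintegral_const,
        Measure.restrict_apply_univ]
      refine ENNReal.mul_ne_top ?_ (measure_spanningSets_lt_top μ n).ne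
      exact rpow_ne_top_of_nonneg hp0.le (ENNReal.natCast_ne_top n)
    have h1 : I ≤ M * I ^ (1 / p') := by
      have := h (fun x => Φn n x ^ (p - 1)) ((hmeas n).pow_const _)
      have e2 : ∀ x, (Φn n x ^ (p - 1)) ^ p' = Φn n x ^ p := by
        intro x
        rw [← erm, hpp.sub_one_mul_conj]
      simp only [e2] at this
      refine le_trans ?_ this
      apply lintegral_mono
      intro x
      calc Φn n x ^ p = Φn n x ^ (1 + (p - 1)) := by congr 1; ring
        _ = Φn n x * Φn n x ^ (p - 1) := by
            rw [ENNReal.rpow_add_of_nonneg _ _ zero_le_one (by linarith), ENNReal.rpow_one]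
        _ ≤ _ := mul_le_mul_left (hle n x) _
    by_cases h0 : I = 0
    · rw [h0]; exact zero_le
    have h2 : I ^ (1 / p) * I ^ (1 / p') ≤ M * I ^ (1 / p') := by
      rw [← ENNReal.rpow_add_of_nonneg _ _ (by positivity) (by have := hpp.symm.pos; positivity)]
      have : 1 / p + 1 / p' = 1 := by
        rw [one_div, one_div]; exact hpp.inv_add_inv_eq_one
      rw [this, ENNReal.rpow_one]; exact h1
    have h3 : I ^ (1 / p) ≤ M := by
      refine (ENNReal.mul_le_mul_iff_left ?_ ?_).1 h2
      · simp [h0, hfin]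
      · exact rpow_ne_top_of_nonneg (by have := hpp.symm.pos; positivity) hfin
    calc I = (I ^ (1 / p)) ^ p := by
            rw [← erm, one_div, inv_mul_cancel₀ hp0.ne', ENNReal.rpow_one]
      _ ≤ _ := erl h3 hp0.le
  have hlim : ∫⁻ x, Φ x ^ p ∂μ = ⨆ n, ∫⁻ x, Φn n x ^ p ∂μ := by
    rw [← lintegral_iSup (fun n => (hmeas n).pow_const p)
      (fun n m hnm x => erl (hmono hnm x) hp0.le)]
    congr 1
    ext x
    rw [← hsup x]
    exact (ENNReal.orderIsoRpow p hp0).map_iSup _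
  have : ∫⁻ x, Φ x ^ p ∂μ ≤ M ^ p := by rw [hlim]; exact iSup_le key
  calc _ ≤ (M ^ p) ^ (1 / p) := erl this (by positivity)
    _ = M := by rw [← erm, one_div, mul_inv_cancel₀ hp0.ne', ENNReal.rpow_one]

lemma mink {α β : Type*} [MeasurableSpace α] [MeasurableSpace β] (μ : Measure α) (ν : Measure β)
    [SigmaFinite μ] [SFinite ν] {p : ℝ} (hp : 1 ≤ p) {F : α → β → ℝ≥0∞}
    (hF : Measurable (Function.uncurry F)) :
    (∫⁻ x, (∫⁻ y, F x y ∂ν) ^ p ∂μ) ^ (1 / p) ≤ ∫⁻ y, (∫⁻ x, F x y ^ p ∂μ) ^ (1 / p) ∂ν := by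
  rcases hp.eq_or_lt with rfl | hp
  · simp only [ENNReal.rpow_one, div_one]
    rw [lintegral_lintegral_swap hF.aemeasurable]
  have hpp := Real.HolderConjugate.conjExponent hp
  refine dual_Lp μ hpp hF.lintegral_prod_right' ?_
  intro g hg
  have e1 : ∀ x, (∫⁻ y, F x y ∂ν) * g x = ∫⁻ y, F x y * g x ∂ν := fun x =>
    (lintegral_mul_const _ (hF.comp measurable_prodMk_left)).symm
  simp only [Function.uncurry]
  simp_rw [e1]
  rw [lintegral_lintegral_swap (by
    apply Measurable.aemeasurable
    exact hF.mul (hg.comp measurable_fst))]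
  rw [← lintegral_mul_const _ (by
    apply Measurable.pow_const
    exact Measurable.lintegral_prod_left' (f := fun z : α × β => F z.1 z.2 ^ p) (hF.pow_const p))]
  apply lintegral_mono
  intro y
  exact ENNReal.lintegral_mul_le_Lp_mul_Lq μ hpp
    (hF.comp measurable_prodMk_right).aemeasurable hg.aemeasurable

lemma lint_Ioi_rpow {l r : ℝ} (hl : 0 < l) (hr : 0 < r) :
    ∫⁻ c in Ioi r, ofReal (c ^ (-l - 1)) = ofReal (r ^ (-l) / l) := by
  have h1 : -l - 1 < -1 := by linarith
  rw [← ofReal_integral_eq_lintegral_ofReal (integrableOn_Ioi_rpow_of_lt h1 hr)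
    ((ae_restrict_mem measurableSet_Ioi).mono fun c hc => (rpow_pos_of_pos (hr.trans hc) _).le),
    integral_Ioi_rpow_of_lt h1 hr]
  congr 1
  rw [show -l - 1 + 1 = -l by ring, neg_div_neg_eq]

lemma lint_Ioc_rpow {l r : ℝ} (hl : 0 < l) (hr : 0 ≤ r) :
    ∫⁻ c in Ioc 0 r, ofReal (c ^ (l - 1)) = ofReal (r ^ l / l) := by
  have h1 : -1 < l - 1 := by linarith
  have hi : IntervalIntegrable (fun c : ℝ => c ^ (l - 1)) volume 0 r :=
    intervalIntegral.intervalIntegrable_rpow' h1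
  rw [← ofReal_integral_eq_lintegral_ofReal ((intervalIntegrable_iff_integrableOn_Ioc_of_le hr).1 hi)
    ((ae_restrict_mem measurableSet_Ioc).mono fun c hc => (rpow_pos_of_pos hc.1 _).le),
    ← intervalIntegral.integral_of_le hr, integral_rpow (Or.inl h1)]
  congr 1
  rw [show l - 1 + 1 = l by ring, zero_rpow hl.ne', sub_zero]

lemma ker_le {l r : ℝ} (hl : 0 < l) (hr : 0 ≤ r) :
    ofReal (r ^ (-l)) ≤ ofReal l *
      ∫⁻ c in Ioi (0 : ℝ), ofReal (c ^ (-l - 1)) * (if r < c then 1 else 0) := by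
  rcases hr.eq_or_lt with rfl | hr
  · rw [zero_rpow (by linarith)]; simp
  have : ∫⁻ c in Ioi r, ofReal (c ^ (-l - 1)) ≤
      ∫⁻ c in Ioi (0 : ℝ), ofReal (c ^ (-l - 1)) * (if r < c then 1 else 0) := by
    calc _ = ∫⁻ c in Ioi r, ofReal (c ^ (-l - 1)) * (if r < c then 1 else 0) := by
          apply setLIntegral_congr_fun measurableSet_Ioi
          intro c hc
          simp only [Set.mem_Ioi] at hc
          simp [hc]
      _ ≤ _ := lintegral_mono_set (Set.Ioi_subset_Ioi hr.le)
  rw [lint_Ioi_rpow hl hr] at this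
  calc ofReal (r ^ (-l)) = ofReal l * ofReal (r ^ (-l) / l) := by
        rw [← ofReal_mul hl.le]; congr 1; field_simp
    _ ≤ _ := by gcongr

lemma layer (y : ℝ≥0∞) : ∫⁻ a in Ioi (0 : ℝ), (if ofReal a < y then 1 else 0) = y := by
  have : ∀ a : ℝ, (if ofReal a < y then (1 : ℝ≥0∞) else 0) =
      ({a : ℝ | ofReal a < y}).indicator 1 a := by
    intro a; simp [Set.indicator]
  simp_rw [this]
  rw [lintegral_indicator_one (measurableSet_lt ENNReal.measurable_ofReal measurable_const),
    Measure.restrict_apply (measurableSet_lt ENNReal.measurable_ofReal measurable_const)]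
  rcases eq_or_ne y ∞ with rfl | hy
  · simp
  have : {a : ℝ | ofReal a < y} ∩ Ioi 0 = Ioo 0 y.toReal := by
    ext a
    simp only [Set.mem_inter_iff, Set.mem_ofPred_eq, Set.mem_Ioi, Set.mem_Ioo]
    constructor
    · rintro ⟨h1, h2⟩; exact ⟨h2, (ENNReal.ofReal_lt_iff_lt_toReal h2.le hy).1 h1⟩
    · rintro ⟨h1, h2⟩; exact ⟨(ENNReal.ofReal_lt_iff_lt_toReal h1.le hy).2 h2, h1⟩
  rw [this, Real.volume_Ioo, sub_zero, ENNReal.ofReal_toReal hy]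

section HLS

variable {E : Type*} [NormedAddCommGroup E] [NormedSpace ℝ E] [FiniteDimensional ℝ E]
  [Nontrivial E]
  [MeasurableSpace E] [BorelSpace E] (μ : Measure E) [μ.IsAddHaarMeasure]

lemma bathtub {κ : ℝ} (hκ0 : 0 < κ) (hκ1 : κ < 1) :
    ∃ C : ℝ≥0∞, C ≠ ∞ ∧ C ≠ 0 ∧ ∀ (x : E) (T : Set E), MeasurableSet T →
      ∫⁻ y in T, ofReal (‖x - y‖ ^ (-(κ * Module.finrank ℝ E))) ∂μ ≤
        C * μ T ^ (1 - κ) := by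
  set d : ℝ := ((Module.finrank ℝ E : ℕ) : ℝ) with hd
  have hd0 : 0 < d := by rw [hd]; exact_mod_cast Module.finrank_pos
  set l := κ * d with hl
  have hl0 : 0 < l := by positivity
  have hdl : 0 < d - l := by rw [hl]; nlinarith
  set B := μ (Metric.ball 0 1) with hB
  have hBfin : B ≠ ∞ := measure_ball_lt_top.ne
  set C : ℝ≥0∞ := ofReal l * (B * ofReal (1 / (d - l)) + ofReal (1 / l)) with hC
  have hCpos : C ≠ 0 := by
    have h1 : ofReal l ≠ 0 := by simpa using hl0
    have h2 : ofReal (1 / l) ≠ 0 := by simpa using hl0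
    rw [hC]
    refine mul_ne_zero h1 ?_
    intro h; exact h2 (add_eq_zero.1 h).2
  refine ⟨C, ?_, hCpos, ?_⟩
  · exact ENNReal.mul_ne_top ofReal_ne_top (ENNReal.add_ne_top.2
      ⟨ENNReal.mul_ne_top hBfin ofReal_ne_top, ofReal_ne_top⟩)
  intro x T hT
  rcases eq_or_ne (μ T) 0 with h0 | h0
  · rw [setLIntegral_measure_zero T _ h0]; exact zero_le
  rcases eq_or_ne (μ T) ∞ with h1 | h1
  · rw [h1, ENNReal.top_rpow_of_pos (by linarith), ENNReal.mul_top hCpos]; exact le_top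
  set m := (μ T).toReal with hm
  have hm0 : 0 < m := ENNReal.toReal_pos h0 h1
  have hmT : μ T = ofReal m := (ENNReal.ofReal_toReal h1).symm
  set ρ := m ^ (1 / d) with hρ
  have hρ0 : 0 < ρ := rpow_pos_of_pos hm0 _
  calc ∫⁻ y in T, ofReal (‖x - y‖ ^ (-l)) ∂μ
      ≤ ∫⁻ y in T, (ofReal l *
        ∫⁻ c in Ioi (0 : ℝ), ofReal (c ^ (-l - 1)) *
          (if ‖x - y‖ < c then 1 else 0)) ∂μ :=
        lintegral_mono fun y => ker_le hl0 (norm_nonneg _)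
    _ = ofReal l * ∫⁻ c in Ioi (0 : ℝ), ∫⁻ y in T, ofReal (c ^ (-l - 1)) *
          (if ‖x - y‖ < c then 1 else 0) ∂μ := by
        rw [lintegral_const_mul' _ _ ofReal_ne_top, lintegral_lintegral_swap]
        apply Measurable.aemeasurable
        apply Measurable.mul
        · fun_prop
        · apply Measurable.ite _ measurable_const measurable_const
          exact measurableSet_lt (by fun_prop) measurable_snd
    _ ≤ ofReal l * ∫⁻ c in Ioi (0 : ℝ), ofReal (c ^ (-l - 1)) *
          min (μ T) (ofReal (c ^ d) * B) := by
        gcongr with c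
        rw [lintegral_const_mul' _ _ ofReal_ne_top]
        gcongr
        refine le_min ?_ ?_
        · calc _ ≤ ∫⁻ y in T, 1 ∂μ := lintegral_mono fun y => by split_ifs <;> simp
            _ = μ T := by simp
        · calc _ ≤ ∫⁻ y, (Metric.ball x c).indicator 1 y ∂μ := by
                refine (setLIntegral_le_lintegral _ _).trans (lintegral_mono fun y => ?_)
                simp only [Set.indicator, Metric.mem_ball, dist_comm y x, dist_eq_norm]
                rfl
            _ = μ (Metric.ball x c) := lintegral_indicator_one measurableSet_ball
            _ ≤ _ := by
                rcases le_or_gt c 0 with hc | hc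
                · rw [Metric.ball_eq_empty.2 hc]; simp
                rw [Measure.addHaar_ball_of_pos μ x hc, hd, rpow_natCast]
    _ ≤ ofReal l * ((∫⁻ c in Ioc (0 : ℝ) ρ, ofReal (c ^ (d - l - 1)) * B) +
          ∫⁻ c in Ioi ρ, ofReal (c ^ (-l - 1)) * μ T) := by
        refine mul_le_mul_right ?_ _
        rw [← Set.Ioc_union_Ioi_eq_Ioi hρ0.le]
        refine (lintegral_union_le _ _ _).trans ?_
        gcongr ?_ + ?_
        · apply setLIntegral_mono' measurableSet_Ioc
          intro c hc
          refine (mul_le_mul_right (min_le_right _ _) _).trans_eq ?_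
          rw [← mul_assoc, ← ofReal_mul (rpow_nonneg hc.1.le _), ← rpow_add hc.1]
          congr 3; ring
        · gcongr; exact min_le_left _ _
    _ = C * μ T ^ (1 - κ) := by
        rw [lintegral_mul_const' _ _ hBfin, lintegral_mul_const' _ _ h1, lint_Ioi_rpow hl0 hρ0,
          lint_Ioc_rpow hdl hρ0.le, hC, mul_assoc]
        congr 1
        have e1 : ρ ^ (d - l) = m ^ (1 - κ) := by
          rw [hρ, ← rpow_mul hm0.le]; congr 1; rw [hl]; field_simp
        have e2 : ρ ^ (-l) * m = m ^ (1 - κ) := by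
          rw [hρ, ← rpow_mul hm0.le]
          nth_rewrite 2 [← rpow_one m]
          rw [← rpow_add hm0]; congr 1; rw [hl]; field_simp; ring
        rw [add_mul, hmT, ENNReal.ofReal_rpow_of_pos hm0]
        congr 1
        · rw [e1, mul_comm, mul_assoc, ← ofReal_mul (by positivity)]
          congr 2; ring
        · rw [← ofReal_mul (by positivity), ← ofReal_mul (by positivity), ← e2]
          congr 1; ring

end HLS

lemma layer_int {α : Type*} [MeasurableSpace α] (μ : Measure α) [SFinite μ] {f g : α → ℝ≥0∞}
    (hf : Measurable f) (hg : Measurable g) :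
    ∫⁻ x, f x * g x ∂μ = ∫⁻ a in Ioi (0 : ℝ), ∫⁻ x in {x | ofReal a < f x}, g x ∂μ := by
  have h1 : ∀ x, f x * g x =
      ∫⁻ a in Ioi (0 : ℝ), (if ofReal a < f x then 1 else 0) * g x := by
    intro x
    rw [lintegral_mul_const, layer]
    exact Measurable.ite (measurableSet_lt ENNReal.measurable_ofReal measurable_const)
      measurable_const measurable_const
  simp_rw [h1]
  rw [lintegral_lintegral_swap]
  · apply lintegral_congr
    intro a
    rw [← lintegral_indicator (measurableSet_lt measurable_const hf)]
    apply lintegral_congr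
    intro x
    simp [Set.indicator]
  · apply Measurable.aemeasurable
    apply Measurable.mul
    · refine Measurable.ite (measurableSet_lt ?_ ?_) measurable_const measurable_const
      · exact ENNReal.measurable_ofReal.comp measurable_snd
      · exact hf.comp measurable_fst
    · exact hg.comp measurable_fst

lemma layer_pow {α : Type*} [MeasurableSpace α] (μ : Measure α) [SFinite μ] {f : α → ℝ≥0∞}
    (hf : Measurable f) {p : ℝ} (hp : 1 < p) :
    ∫⁻ a in Ioi (0 : ℝ), μ {x | ofReal a < f x} * ofReal (a ^ (p - 1)) ≤
      ∫⁻ x, f x ^ p ∂μ := by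
  have h1 : ∀ a : ℝ, μ {x | ofReal a < f x} * ofReal (a ^ (p - 1)) =
      ∫⁻ x in {x | ofReal a < f x}, ofReal (a ^ (p - 1)) ∂μ := by
    intro a; rw [setLIntegral_const, mul_comm]
  have h2 : ∫⁻ x, f x ^ p ∂μ = ∫⁻ x, f x * f x ^ (p - 1) ∂μ := by
    apply lintegral_congr; intro x
    have := ENNReal.rpow_add_of_nonneg (x := f x) 1 (p - 1) zero_le_one (by linarith)
    rw [ENNReal.rpow_one] at this
    rw [← this]; congr 1; ring
  rw [h2, layer_int μ hf (hf.pow_const _)]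
  simp_rw [h1]
  apply setLIntegral_mono' measurableSet_Ioi
  intro a ha
  apply setLIntegral_mono' (measurableSet_lt measurable_const hf)
  intro x hx
  have hx' : ofReal a < f x := hx
  rw [← ENNReal.ofReal_rpow_of_pos ha]
  exact erl hx'.le (by linarith)

lemma hls_half {κ p r : ℝ} (hκ0 : 0 < κ) (hκ1 : κ < 1) (hp : 1 < p) (hr : 1 < r)
    (h : 1 / p + 1 / r + κ = 2) :
    ∃ C : ℝ≥0∞, C ≠ ∞ ∧ ∀ v w : ℝ → ℝ≥0∞, Measurable v → Measurable w →
      ∫⁻ a in Ioi (0 : ℝ), v a * ofReal (a ^ (p - 1)) ≤ 1 →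
      ∫⁻ b in Ioi (0 : ℝ), w b * ofReal (b ^ (r - 1)) ≤ 1 →
      ∫⁻ a in Ioi (0 : ℝ), ∫⁻ b in Ioi (0 : ℝ),
        (if b ≤ a ^ (p / r) then v a * w b ^ (1 - κ) else 0) ≤ C := by
  set β := (r - 1) * (1 - κ) / κ with hβ
  have hr0 : 0 < r := by linarith
  have hp0 : 0 < p := by linarith
  have hp' : 1 / p < 1 := by rw [div_lt_one hp0]; exact hp
  have hβ1 : 0 < 1 - β := by
    rw [hβ, sub_pos, div_lt_one hκ0]
    have : 1 - κ < 1 / r := by linarith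
    have : r * (1 - κ) < 1 := by rw [lt_div_iff₀ hr0] at this; linarith
    nlinarith
  refine ⟨ofReal (1 / (1 - β)) ^ κ, by finiteness, ?_⟩
  intro v w hv hw hv1 hw1
  have key : ∀ a ∈ Ioi (0 : ℝ), ∫⁻ b in Ioi (0 : ℝ),
        (if b ≤ a ^ (p / r) then v a * w b ^ (1 - κ) else 0) ≤
        (v a * ofReal (a ^ (p - 1))) * ofReal (1 / (1 - β)) ^ κ := by
    intro a ha
    have ha0 : 0 < a := ha
    set X := a ^ (p / r) with hX
    have hX0 : 0 < X := rpow_pos_of_pos ha0 _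
    calc _ = ∫⁻ b in Ioc 0 X, v a * w b ^ (1 - κ) := by
          rw [← Set.Ioi_inter_Iic, Set.inter_comm, ← setLIntegral_indicator measurableSet_Iic]
          apply lintegral_congr; intro b
          simp [Set.indicator]
      _ = v a * ∫⁻ b in Ioc 0 X, w b ^ (1 - κ) := by
          rw [lintegral_const_mul _ (hw.pow_const _)]
      _ ≤ v a * ((∫⁻ b in Ioc 0 X, w b * ofReal (b ^ (r - 1))) ^ (1 - κ) *
            (∫⁻ b in Ioc 0 X, ofReal (b ^ ((1 - β) - 1))) ^ κ) := by
          refine mul_le_mul_right ?_ _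
          have hc : (1 / (1 - κ)).HolderConjugate (1 / κ) := by
            rw [Real.holderConjugate_iff]
            refine ⟨?_, ?_⟩
            · rw [lt_div_iff₀ (by linarith)]; linarith
            · simp
          have := ENNReal.lintegral_mul_le_Lp_mul_Lq (volume.restrict (Ioc 0 X)) hc
            (f := fun b => (w b * ofReal (b ^ (r - 1))) ^ (1 - κ))
            (g := fun b => (ofReal (b ^ ((1 - β) - 1))) ^ κ)
            (by fun_prop) (by fun_prop)
          simp only [one_div_one_div, ← erm] at this
          rw [mul_one_div_cancel (by linarith : 1 - κ ≠ 0), mul_one_div_cancel hκ0.ne'] at this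
          simp only [ENNReal.rpow_one] at this
          refine le_trans ?_ this
          apply setLIntegral_mono' measurableSet_Ioc
          intro b hb
          simp only [Pi.mul_apply]
          rw [mul_rpow_of_nonneg _ _ (by linarith), mul_assoc,
            ENNReal.ofReal_rpow_of_pos (rpow_pos_of_pos hb.1 _),
            ENNReal.ofReal_rpow_of_pos (rpow_pos_of_pos hb.1 _),
            ← ofReal_mul (by have := hb.1; positivity), ← rpow_mul hb.1.le, ← rpow_mul hb.1.le,
            ← rpow_add hb.1, show (r - 1) * (1 - κ) + (1 - β - 1) * κ = 0 by
              rw [hβ]; field_simp; ring]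
          simp
      _ ≤ v a * (1 ^ (1 - κ) * (ofReal (X ^ (1 - β) / (1 - β))) ^ κ) := by
          rw [lint_Ioc_rpow hβ1 hX0.le]
          gcongr
          exact (lintegral_mono_set Set.Ioc_subset_Ioi_self).trans hw1
      _ = _ := by
          rw [ENNReal.one_rpow, one_mul, mul_assoc]
          congr 1
          rw [div_eq_mul_one_div, ofReal_mul (by positivity),
            mul_rpow_of_nonneg _ _ hκ0.le]
          congr 1
          rw [ENNReal.ofReal_rpow_of_pos (by positivity), hX, ← rpow_mul ha0.le, ← rpow_mul ha0.le]
          congr 2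
          have : κ = 2 - 1 / p - 1 / r := by linarith
          have e : (1 - β) * κ = 1 - r * (1 - κ) := by rw [hβ]; field_simp; ring
          rw [mul_assoc, e, this]; field_simp; ring
  calc _ ≤ ∫⁻ a in Ioi (0 : ℝ),
        (v a * ofReal (a ^ (p - 1))) * ofReal (1 / (1 - β)) ^ κ :=
        setLIntegral_mono' measurableSet_Ioi key
    _ ≤ _ := by
        rw [lintegral_mul_const' _ _ (by finiteness)]
        exact (mul_le_mul_left hv1 _).trans_eq (one_mul _)

section HLS

variable {E : Type*} [NormedAddCommGroup E] [NormedSpace ℝ E] [FiniteDimensional ℝ E]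
  [Nontrivial E]
  [MeasurableSpace E] [BorelSpace E] (μ : Measure E) [μ.IsAddHaarMeasure]

lemma hls {κ p r : ℝ} (hκ0 : 0 < κ) (hκ1 : κ < 1) (hp : 1 < p) (hr : 1 < r)
    (hpr : 1 / p + 1 / r + κ = 2) :
    ∃ C : ℝ≥0∞, C ≠ ∞ ∧ C ≠ 0 ∧ ∀ f h : E → ℝ≥0∞, Measurable f → Measurable h →
      ∫⁻ x, f x * ∫⁻ y, h y * ofReal (‖x - y‖ ^ (-(κ * Module.finrank ℝ E))) ∂μ ∂μ ≤
        C * ((∫⁻ x, f x ^ p ∂μ) ^ (1 / p) * (∫⁻ x, h x ^ r ∂μ) ^ (1 / r)) := by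
  have hp0 : 0 < p := by linarith
  have hr0 : 0 < r := by linarith
  obtain ⟨B, hBt, hB0, hB⟩ := bathtub μ hκ0 hκ1
  obtain ⟨C1, hC1, H1⟩ := hls_half hκ0 hκ1 hp hr hpr
  obtain ⟨C2, hC2, H2⟩ := hls_half hκ0 hκ1 hr hp (by linarith)
  set k : E → E → ℝ≥0∞ := fun x y => ofReal (‖x - y‖ ^ (-(κ * Module.finrank ℝ E))) with hk
  have hkm : Measurable (Function.uncurry k) := by
    simp only [hk, Function.uncurry_def]; fun_prop
  have hks : ∀ x y, k x y = k y x := fun x y => by simp only [hk, norm_sub_rev]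
  have hB' : ∀ (x : E) (T : Set E), MeasurableSet T → ∫⁻ y in T, k x y ∂μ ≤ B * μ T ^ (1 - κ) := hB
  have bil1 : ∀ S T : Set E, MeasurableSet S → MeasurableSet T →
      ∫⁻ x in S, ∫⁻ y in T, k x y ∂μ ∂μ ≤ B * (μ S * μ T ^ (1 - κ)) := by
    intro S T hS hT
    calc _ ≤ ∫⁻ x in S, B * μ T ^ (1 - κ) ∂μ := lintegral_mono fun x => hB' x T hT
      _ = _ := by rw [setLIntegral_const]; ring
  have bil2 : ∀ S T : Set E, MeasurableSet S → MeasurableSet T →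
      ∫⁻ x in S, ∫⁻ y in T, k x y ∂μ ∂μ ≤ B * (μ T * μ S ^ (1 - κ)) := by
    intro S T hS hT
    rw [lintegral_lintegral_swap hkm.aemeasurable]
    simp_rw [hks]
    exact bil1 T S hT hS
  -- normalised case
  have norm1 : ∀ f h : E → ℝ≥0∞, Measurable f → Measurable h → ∫⁻ x, f x ^ p ∂μ ≤ 1 →
      ∫⁻ x, h x ^ r ∂μ ≤ 1 → ∫⁻ x, f x * ∫⁻ y, h y * k x y ∂μ ∂μ ≤ B * (C1 + C2) := by
    intro f h hf hh hf1 hh1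
    set v : ℝ → ℝ≥0∞ := fun a => μ {x | ofReal a < f x} with hv
    set w : ℝ → ℝ≥0∞ := fun a => μ {x | ofReal a < h x} with hw
    have hvm : Measurable v := by
      apply Antitone.measurable
      intro a b hab
      exact measure_mono fun x hx => (ofReal_le_ofReal hab).trans_lt hx
    have hwm : Measurable w := by
      apply Antitone.measurable
      intro a b hab
      exact measure_mono fun x hx => (ofReal_le_ofReal hab).trans_lt hx
    have hv1 := (layer_pow μ hf hp).trans hf1
    have hw1 := (layer_pow μ hh hr).trans hh1
    have G1 := H1 v w hvm hwm hv1 hw1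
    have G2 := H2 w v hwm hvm hw1 hv1
    have e1 : ∀ x, ∫⁻ y, h y * k x y ∂μ =
        ∫⁻ b in Ioi (0 : ℝ), ∫⁻ y in {y | ofReal b < h y}, k x y ∂μ := fun x =>
      layer_int μ hh (hkm.of_uncurry_left)
    have m1 : Measurable fun x => ∫⁻ y, h y * k x y ∂μ := by
      apply Measurable.lintegral_prod_right
      exact (hh.comp measurable_snd).mul hkm
    rw [layer_int μ hf m1]
    have mset : MeasurableSet {q : (E × ℝ) × E | ofReal q.1.2 < h q.2} :=
      measurableSet_lt (by fun_prop) (by fun_prop)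
    have mh : Measurable fun q : E × ℝ => ∫⁻ y in {y | ofReal q.2 < h y}, k q.1 y ∂μ := by
      have : ∀ q : E × ℝ, ∫⁻ y in {y | ofReal q.2 < h y}, k q.1 y ∂μ =
          ∫⁻ y, (if ofReal q.2 < h y then k q.1 y else 0) ∂μ := by
        intro q
        rw [← lintegral_indicator (measurableSet_lt measurable_const hh)]
        apply lintegral_congr; intro y; simp [Set.indicator]
      simp_rw [this]
      apply Measurable.lintegral_prod_right
      refine Measurable.ite mset ?_ measurable_const
      exact hkm.comp ((measurable_fst.comp measurable_fst).prodMk measurable_snd)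
    calc _ = ∫⁻ a in Ioi (0 : ℝ), ∫⁻ b in Ioi (0 : ℝ),
          ∫⁻ x in {x | ofReal a < f x}, ∫⁻ y in {y | ofReal b < h y}, k x y ∂μ ∂μ := by
          apply lintegral_congr; intro a
          simp_rw [e1]
          rw [lintegral_lintegral_swap]
          exact mh.aemeasurable
      _ ≤ ∫⁻ a in Ioi (0 : ℝ), ∫⁻ b in Ioi (0 : ℝ), B *
            ((if b ≤ a ^ (p / r) then v a * w b ^ (1 - κ) else 0) +
             (if a ≤ b ^ (r / p) then w b * v a ^ (1 - κ) else 0)) := by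
          apply setLIntegral_mono' measurableSet_Ioi; intro a ha
          apply setLIntegral_mono' measurableSet_Ioi; intro b hb
          have ha0 : 0 < a := ha
          have hb0 : 0 < b := hb
          by_cases hab : b ≤ a ^ (p / r)
          · rw [if_pos hab]
            refine (bil1 _ _ (measurableSet_lt measurable_const hf)
              (measurableSet_lt measurable_const hh)).trans ?_
            exact mul_le_mul_right le_self_add _
          · have : a ≤ b ^ (r / p) := by
              have := rpow_le_rpow (by positivity) (not_le.1 hab).le (by positivity : 0 ≤ r / p)
              rw [← rpow_mul ha0.le] at this
              rw [show p / r * (r / p) = 1 by field_simp, rpow_one] at this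
              exact this
            rw [if_pos this]
            refine (bil2 _ _ (measurableSet_lt measurable_const hf)
              (measurableSet_lt measurable_const hh)).trans ?_
            exact mul_le_mul_right le_add_self _
      _ = B * ((∫⁻ a in Ioi (0 : ℝ), ∫⁻ b in Ioi (0 : ℝ),
            (if b ≤ a ^ (p / r) then v a * w b ^ (1 - κ) else 0)) +
            ∫⁻ b in Ioi (0 : ℝ), ∫⁻ a in Ioi (0 : ℝ),
            (if a ≤ b ^ (r / p) then w b * v a ^ (1 - κ) else 0)) := by
          have mm1 : Measurable fun z : ℝ × ℝ =>
              (if z.2 ≤ z.1 ^ (p / r) then v z.1 * w z.2 ^ (1 - κ) else 0) :=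
            Measurable.ite (measurableSet_le (by fun_prop) (by fun_prop)) (by fun_prop) measurable_const
          have mm2 : Measurable fun z : ℝ × ℝ =>
              (if z.1 ≤ z.2 ^ (r / p) then w z.2 * v z.1 ^ (1 - κ) else 0) :=
            Measurable.ite (measurableSet_le (by fun_prop) (by fun_prop)) (by fun_prop) measurable_const
          simp_rw [lintegral_const_mul' _ _ hBt]
          congr 1
          rw [lintegral_lintegral_swap (f := fun b a =>
            (if a ≤ b ^ (r / p) then w b * v a ^ (1 - κ) else 0))
              (mm2.comp measurable_swap).aemeasurable, ← lintegral_add_left]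
          · apply lintegral_congr; intro a
            rw [lintegral_add_left]
            exact mm1.comp (measurable_const.prodMk measurable_id)
          · exact Measurable.lintegral_prod_right mm1
      _ ≤ B * (C1 + C2) := by gcongr
  set C := B * (C1 + C2) + 1 with hC
  have hCt : C ≠ ∞ := by rw [hC]; finiteness
  have hC0 : C ≠ 0 := by rw [hC]; simp
  refine ⟨C, hCt, hC0, ?_⟩
  intro f h hf hh
  set F := (∫⁻ x, f x ^ p ∂μ) with hF
  set H := (∫⁻ x, h x ^ r ∂μ) with hH
  have hip : 0 < 1 / p := by positivity
  have hir : 0 < 1 / r := by positivity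
  rcases eq_or_ne F 0 with h0 | hF0
  · rw [hF, lintegral_eq_zero_iff (hf.pow_const _)] at h0
    have : ∫⁻ x, f x * ∫⁻ y, h y * k x y ∂μ ∂μ = 0 := by
      rw [← lintegral_zero (μ := μ)]
      apply lintegral_congr_ae
      filter_upwards [h0] with x hx
      have : f x = 0 := by
        simpa [ENNReal.rpow_eq_zero_iff, hp0, hp0.le, not_lt.2 hp0.le] using hx
      simp [this]
    exact this.le.trans zero_le
  rcases eq_or_ne H 0 with h0 | hH0
  · rw [hH, lintegral_eq_zero_iff (hh.pow_const _)] at h0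
    have : ∀ x, ∫⁻ y, h y * k x y ∂μ = 0 := by
      intro x
      rw [← lintegral_zero (μ := μ)]
      apply lintegral_congr_ae
      filter_upwards [h0] with x hx
      have : h x = 0 := by
        simpa [ENNReal.rpow_eq_zero_iff, hr0, hr0.le, not_lt.2 hr0.le] using hx
      simp [this]
    have : ∫⁻ x, f x * ∫⁻ y, h y * k x y ∂μ ∂μ = 0 := by simp [this]
    exact this.le.trans zero_le
  have hF0' : F ^ (1 / p) ≠ 0 := by simp [ENNReal.rpow_eq_zero_iff, hF0, hp0.le]
  have hH0' : H ^ (1 / r) ≠ 0 := by simp [ENNReal.rpow_eq_zero_iff, hH0, hr0.le]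
  rcases eq_or_ne F ∞ with h1 | hFt
  · rw [h1, ENNReal.top_rpow_of_pos hip, ENNReal.top_mul hH0', ENNReal.mul_top hC0]; exact le_top
  rcases eq_or_ne H ∞ with h1 | hHt
  · rw [h1, ENNReal.top_rpow_of_pos hir, ENNReal.mul_top hF0', ENNReal.mul_top hC0]; exact le_top
  have hFt' : F ^ (1 / p) ≠ ∞ := by finiteness
  have hHt' : H ^ (1 / r) ≠ ∞ := by finiteness
  set cf := (F ^ (1 / p))⁻¹ with hcf
  set ch := (H ^ (1 / r))⁻¹ with hch
  have hcft : cf ≠ ∞ := ENNReal.inv_ne_top.2 hF0'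
  have hcht : ch ≠ ∞ := ENNReal.inv_ne_top.2 hH0'
  have := norm1 (fun x => cf * f x) (fun x => ch * h x) (hf.const_mul _) (hh.const_mul _) (by
      simp_rw [mul_rpow_of_nonneg _ _ hp0.le]
      rw [lintegral_const_mul _ (hf.pow_const _), hcf, ← ENNReal.inv_rpow, ← erm,
        one_div_mul_cancel hp0.ne', ENNReal.rpow_one, ← hF, ENNReal.inv_mul_cancel hF0 hFt]) (by
      simp_rw [mul_rpow_of_nonneg _ _ hr0.le]
      rw [lintegral_const_mul _ (hh.pow_const _), hch, ← ENNReal.inv_rpow, ← erm,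
        one_div_mul_cancel hr0.ne', ENNReal.rpow_one, ← hH, ENNReal.inv_mul_cancel hH0 hHt])
  have e : ∫⁻ x, cf * f x * ∫⁻ y, ch * h y * k x y ∂μ ∂μ =
      cf * ch * ∫⁻ x, f x * ∫⁻ y, h y * k x y ∂μ ∂μ := by
    rw [← lintegral_const_mul' _ _ (by finiteness)]
    apply lintegral_congr; intro x
    have : ∀ y, ch * h y * k x y = ch * (h y * k x y) := fun y => by ring
    simp_rw [this]
    rw [lintegral_const_mul' _ _ hcht]; ring
  rw [e] at this
  set J := ∫⁻ x, f x * ∫⁻ y, h y * k x y ∂μ ∂μ with hJ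
  calc J = (F ^ (1 / p) * cf) * (H ^ (1 / r) * ch) * J := by
        rw [hcf, hch, ENNReal.mul_inv_cancel hF0' hFt', ENNReal.mul_inv_cancel hH0' hHt']; simp
    _ = (F ^ (1 / p) * H ^ (1 / r)) * (cf * ch * J) := by ring
    _ ≤ (F ^ (1 / p) * H ^ (1 / r)) * C := mul_le_mul_right (this.trans le_self_add) _
    _ = _ := mul_comm _ _

end HLS

lemma hls1 : ∃ C : ℝ≥0∞, C ≠ ∞ ∧ ∀ f : ℝ → ℝ≥0∞, Measurable f →
    ∫⁻ t, f t * ∫⁻ s, f s * ofReal (|t - s| ^ (-(1 / 2) : ℝ)) ≤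
      C * (∫⁻ t, f t ^ (4 / 3 : ℝ)) ^ (3 / 2 : ℝ) := by
  obtain ⟨C, hC, -, H⟩ := hls (E := ℝ) volume (κ := 1 / 2) (p := 4 / 3) (r := 4 / 3)
    (by norm_num) (by norm_num) (by norm_num) (by norm_num) (by norm_num)
  refine ⟨C, hC, fun f hf => ?_⟩
  have := H f f hf hf
  rw [← ENNReal.rpow_add_of_nonneg _ _ (by norm_num) (by norm_num)] at this
  simp only [Module.finrank_self, Nat.cast_one, mul_one, Real.norm_eq_abs] at this
  refine this.trans_eq ?_
  norm_num

lemma frac {α Q M : ℝ} (hα0 : 0 ≤ α) (hα1 : α < 1) (hQ : 2 < Q) (hM : 2 < M)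
    (h : 1 / Q = 1 / M + α / 2) :
    ∃ C : ℝ≥0∞, C ≠ ∞ ∧ ∀ A v : V2 → ℝ≥0∞, Measurable A → Measurable v →
      (∫⁻ x, (∫⁻ y, A y * v y * ofReal (‖x - y‖ ^ (-(1 + α)))) ^ Q) ^ (1 / Q) ≤
        C * ((∫⁻ x, A x ^ M) ^ (1 / M) * (∫⁻ x, v x ^ (2 : ℝ)) ^ (1 / 2 : ℝ)) := by
  set r := (1 / M + 1 / 2)⁻¹ with hr
  have hM0 : 0 < M := by linarith
  have hM1 : 1 / M < 1 / 2 := one_div_lt_one_div_of_lt (by norm_num) hM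
  have hM2 : 0 < 1 / M := by positivity
  have hr1 : 1 < r := by
    rw [hr]; apply (one_lt_inv₀ (by positivity)).2; linarith
  have hr2 : 1 / r = 1 / M + 1 / 2 := by rw [hr]; simp
  have hQ0 : 0 < Q := by linarith
  have hQ1 : 1 / Q < 1 / 2 := one_div_lt_one_div_of_lt (by norm_num) hQ
  have hc : Q.HolderConjugate (Q / (Q - 1)) := Real.HolderConjugate.conjExponent (by linarith)
  have hQ' : 1 / (Q / (Q - 1)) = 1 - 1 / Q := by field_simp
  obtain ⟨C, hC, -, H⟩ := hls (E := V2) volume (κ := (1 + α) / 2) (p := Q / (Q - 1)) (r := r)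
    (by linarith) (by linarith) hc.symm.lt hr1 (by rw [hQ', hr2]; linarith)
  refine ⟨C, hC, fun A v hA hv => ?_⟩
  have hfr : (1 + α) / 2 * ((Module.finrank ℝ V2 : ℕ) : ℝ) = 1 + α := by
    rw [finrank_euclideanSpace_fin]; push_cast; ring
  rw [hfr] at H
  have hrb : (∫⁻ x, (A x * v x) ^ r) ^ (1 / r) ≤
      (∫⁻ x, A x ^ M) ^ (1 / M) * (∫⁻ x, v x ^ (2 : ℝ)) ^ (1 / 2 : ℝ) := by
    have := ENNReal.lintegral_Lp_mul_le_Lq_mul_Lr (p := r) (q := M) (r := 2) (by linarith)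
      (by
        have : 1 / M < 1 / r := by rw [hr2]; linarith
        exact (one_div_lt_one_div hM0 (by linarith)).1 this) hr2 (volume : Measure V2)
      hA.aemeasurable hv.aemeasurable
    exact this
  refine (dual_Lp volume hc ?_ (M := C * (∫⁻ x, (A x * v x) ^ r) ^ (1 / r)) ?_).trans
    (mul_le_mul_right hrb _)
  · apply Measurable.lintegral_prod_right
    fun_prop
  · intro g hg
    have := H g (fun y => A y * v y) hg (hA.mul hv)
    refine le_trans (lintegral_mono fun x => (mul_comm _ _).le) (this.trans_eq ?_)
    ring

lemma vdc1 {φ ψ ω : ℝ → ℝ} (hφ : ∀ u, HasDerivAt φ (ψ u) u) (hψ : ∀ u, HasDerivAt ψ (ω u) u)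
    (hω : Continuous ω) {a b δ : ℝ} (hab : a ≤ b) (hδ : 0 < δ) (hω0 : ∀ u ∈ Icc a b, 0 ≤ ω u)
    (hlow : ∀ u ∈ Icc a b, δ ≤ |ψ u|) :
    ‖∫ u in a..b, Complex.exp (I * (φ u : ℂ))‖ ≤ 4 / δ := by
  have hφc : Continuous φ := continuous_iff_continuousAt.2 fun u => (hφ u).continuousAt
  have hψc : Continuous ψ := continuous_iff_continuousAt.2 fun u => (hψ u).continuousAt
  have hne : ∀ u ∈ Icc a b, ψ u ≠ 0 := fun u hu h => by
    have := hlow u hu; rw [h, abs_zero] at this; linarith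
  have huIcc : Set.uIcc a b = Icc a b := Set.uIcc_of_le hab
  set e : ℝ → ℂ := fun u => Complex.exp (I * (φ u : ℂ)) with he
  have hec : Continuous e := by rw [he]; fun_prop
  have hen : ∀ u, ‖e u‖ = 1 := fun u => by
    rw [he]; simp only; rw [mul_comm, norm_exp_ofReal_mul_I]
  have hed : ∀ u, HasDerivAt e (I * (ψ u : ℂ) * e u) u := by
    intro u
    have := ((hφ u).ofReal_comp.const_mul I).cexp
    rw [mul_comm] at this
    exact this
  set g : ℝ → ℂ := fun u => ((-I) * ((ψ u)⁻¹ : ℝ)) with hg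
  set g' : ℝ → ℂ := fun u => ((-I) * ((-ω u / ψ u ^ 2 : ℝ) : ℂ)) with hg'
  have hgd : ∀ u ∈ Set.uIcc a b, HasDerivAt g (g' u) u := by
    intro u hu
    rw [huIcc] at hu
    exact ((hψ u).inv (hne u hu)).ofReal_comp.const_mul (-I)
  have hqc : ContinuousOn (fun u => -ω u / ψ u ^ 2) (Icc a b) := by
    apply ContinuousOn.div (by fun_prop) (by fun_prop)
    intro u hu; exact pow_ne_zero _ (hne u hu)
  have hg'c : ContinuousOn g' (Icc a b) := by
    apply ContinuousOn.mul continuousOn_const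
    exact Complex.continuous_ofReal.comp_continuousOn hqc
  have hg'i : IntervalIntegrable g' volume a b := by
    apply ContinuousOn.intervalIntegrable; rwa [huIcc]
  have hqi : IntervalIntegrable (fun u => -ω u / ψ u ^ 2) volume a b := by
    apply ContinuousOn.intervalIntegrable; rwa [huIcc]
  have ibp := intervalIntegral.integral_mul_deriv_eq_deriv_mul (u := g) (v := e) (u' := g')
    (v' := fun u => I * (ψ u : ℂ) * e u) hgd (fun u _ => hed u) hg'i
    (Continuous.intervalIntegrable (by fun_prop) _ _)
  have e1 : ∫ u in a..b, e u = ∫ u in a..b, g u * (I * (ψ u : ℂ) * e u) := by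
    apply intervalIntegral.integral_congr
    intro u hu
    rw [huIcc] at hu
    have h1 : (ψ u : ℂ) ≠ 0 := by exact_mod_cast hne u hu
    simp only [hg]; push_cast
    field_simp
    rw [Complex.I_sq]; ring
  have hgn : ∀ u ∈ Icc a b, ‖g u‖ ≤ 1 / δ := by
    intro u hu
    simp only [hg, norm_mul, norm_neg, Complex.norm_I, one_mul, norm_real, norm_inv,
      Real.norm_eq_abs]
    rw [one_div]
    exact inv_anti₀ hδ (hlow u hu)
  have hgin : ∀ u ∈ Icc a b, |(ψ u)⁻¹| ≤ 1 / δ := by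
    intro u hu
    rw [abs_inv, one_div]
    exact inv_anti₀ hδ (hlow u hu)
  have e2 : ‖∫ u in a..b, g' u * e u‖ ≤ 2 / δ := by
    calc _ ≤ ∫ u in a..b, -(-ω u / ψ u ^ 2) := by
          apply intervalIntegral.norm_integral_le_of_norm_le hab
          · refine of_forall fun u hu => ?_
            have h0 := hω0 u (Set.Ioc_subset_Icc_self hu)
            simp only [hg', norm_mul, norm_neg, Complex.norm_I, one_mul, hen, mul_one, norm_real]
            rw [Real.norm_eq_abs, abs_div, abs_neg, abs_of_nonneg h0, abs_of_nonneg (sq_nonneg _)]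
            rw [neg_div, neg_neg]
          · exact hqi.neg
      _ = -((ψ b)⁻¹ - (ψ a)⁻¹) := by
          rw [intervalIntegral.integral_neg]
          congr 1
          apply intervalIntegral.integral_eq_sub_of_hasDerivAt (f := fun u => (ψ u)⁻¹) _ hqi
          intro u hu
          rw [huIcc] at hu
          exact (hψ u).inv (hne u hu)
      _ ≤ 2 / δ := by
          have h1 := abs_le.1 (hgin a ⟨le_rfl, hab⟩)
          have h2 := abs_le.1 (hgin b ⟨hab, le_rfl⟩)
          have : 2 / δ = 1 / δ + 1 / δ := by ring
          rw [this]; linarith [h1.2, h2.1]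
  change ‖∫ u in a..b, e u‖ ≤ _
  rw [e1, ibp]
  have := norm_sub_le (g b * e b - g a * e a) (∫ u in a..b, g' u * e u)
  have h3 := norm_sub_le (g b * e b) (g a * e a)
  rw [norm_mul (g b), norm_mul (g a), hen, hen, mul_one, mul_one] at h3
  have h1 := hgn a ⟨le_rfl, hab⟩
  have h2 := hgn b ⟨hab, le_rfl⟩
  have : 4 / δ = 1 / δ + 1 / δ + 2 / δ := by ring
  linarith

lemma ivt_split {ψ : ℝ → ℝ} (hψ : Continuous ψ) {a b : ℝ} (hab : a ≤ b)
    (hm : MonotoneOn ψ (Icc a b)) (L : ℝ) :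
    ∃ c ∈ Icc a b, (c = a ∨ ∀ u ∈ Icc a c, ψ u ≤ L) ∧ (c = b ∨ ∀ u ∈ Icc c b, L ≤ ψ u) := by
  rcases le_total L (ψ a) with h | h
  · refine ⟨a, ⟨le_rfl, hab⟩, Or.inl rfl, Or.inr fun u hu => h.trans (hm ⟨le_rfl, hab⟩ hu hu.1)⟩
  rcases le_total (ψ b) L with h' | h'
  · refine ⟨b, ⟨hab, le_rfl⟩, Or.inr fun u hu => (hm hu ⟨hab, le_rfl⟩ hu.2).trans h', Or.inl rfl⟩
  obtain ⟨c, hc, rfl⟩ := intermediate_value_Icc hab hψ.continuousOn ⟨h, h'⟩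
  refine ⟨c, hc, Or.inr fun u hu => hm ⟨hu.1, hu.2.trans hc.2⟩ hc hu.2,
    Or.inr fun u hu => hm hc ⟨hc.1.trans hu.1, hu.2⟩ hu.1⟩

lemma vdc2 {φ ψ ω : ℝ → ℝ} (hφ : ∀ u, HasDerivAt φ (ψ u) u) (hψ : ∀ u, HasDerivAt ψ (ω u) u)
    (hω : Continuous ω) {a b ρ : ℝ} (hab : a ≤ b) (hρ : 0 < ρ) (hω0 : ∀ u ∈ Icc a b, ρ ≤ ω u) :
    ‖∫ u in a..b, Complex.exp (I * (φ u : ℂ))‖ ≤ 10 / √ρ := by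
  have hφc : Continuous φ := continuous_iff_continuousAt.2 fun u => (hφ u).continuousAt
  have hψc : Continuous ψ := continuous_iff_continuousAt.2 fun u => (hψ u).continuousAt
  set δ := √ρ with hδ
  have hδ0 : 0 < δ := sqrt_pos.2 hρ
  have hδ2 : δ * δ = ρ := mul_self_sqrt hρ.le
  have growth : ∀ u v, a ≤ u → u ≤ v → v ≤ b → ρ * (v - u) ≤ ψ v - ψ u := by
    intro u v hu huv hv
    apply (convex_Icc a b).mul_sub_le_image_sub_of_le_deriv hψc.continuousOn
      (fun x _ => (hψ x).differentiableAt.differentiableWithinAt) _ u ⟨hu, huv.trans hv⟩ v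
      ⟨hu.trans huv, hv⟩ huv
    intro x hx
    rw [(hψ x).deriv]
    exact hω0 x (interior_subset hx)
  have hm : MonotoneOn ψ (Icc a b) := by
    intro u hu v hv huv
    have := growth u v hu.1 huv hv.2
    have : 0 ≤ ρ * (v - u) := mul_nonneg hρ.le (by linarith)
    linarith
  obtain ⟨c1, hc1, h1, h1'⟩ := ivt_split hψc hab hm (-δ)
  obtain ⟨c2, hc2, h2, h2'⟩ := ivt_split hψc hc1.2
    (hm.mono (Set.Icc_subset_Icc_left hc1.1)) δ
  set e : ℝ → ℂ := fun u => Complex.exp (I * (φ u : ℂ)) with he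
  have hec : Continuous e := by rw [he]; fun_prop
  have hen : ∀ u, ‖e u‖ = 1 := fun u => by
    rw [he]; simp only; rw [mul_comm, norm_exp_ofReal_mul_I]
  have b1 : ‖∫ u in a..c1, e u‖ ≤ 4 / δ := by
    rcases h1 with h | h
    · rw [h]; simp; positivity
    · apply vdc1 hφ hψ hω hc1.1 hδ0
      · intro u hu; exact hρ.le.trans (hω0 u ⟨hu.1, hu.2.trans hc1.2⟩)
      · intro u hu; rw [abs_of_nonpos (by linarith [h u hu])]; linarith [h u hu]
  have b3 : ‖∫ u in c2..b, e u‖ ≤ 4 / δ := by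
    rcases h2' with h | h
    · rw [h]; simp; positivity
    · apply vdc1 hφ hψ hω hc2.2 hδ0
      · intro u hu; exact hρ.le.trans (hω0 u ⟨hc1.1.trans (hc2.1.trans hu.1), hu.2⟩)
      · intro u hu; rw [abs_of_nonneg (by linarith [h u hu])]; exact h u hu
  have b2 : ‖∫ u in c1..c2, e u‖ ≤ 2 / δ := by
    have : ‖∫ u in c1..c2, e u‖ ≤ 1 * |c2 - c1| :=
      intervalIntegral.norm_integral_le_of_norm_le_const fun u _ => (hen u).le
    rw [one_mul, abs_of_nonneg (by linarith [hc2.1])] at this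
    refine this.trans ?_
    rw [le_div_iff₀ hδ0]
    rcases h2 with h | h
    · rw [h]; simp
    rcases h1' with h' | h'
    · have : c2 = c1 := le_antisymm (h' ▸ hc2.2) hc2.1
      rw [this]; simp
    have g := growth c1 c2 hc1.1 hc2.1 hc2.2
    have := h c2 ⟨hc2.1, le_rfl⟩
    have := h' c1 ⟨le_rfl, hc1.2⟩
    have : δ * ((c2 - c1) * δ) ≤ δ * 2 := by
      calc _ = ρ * (c2 - c1) := by rw [← hδ2]; ring
        _ ≤ _ := by linarith
    exact le_of_mul_le_mul_left this hδ0
  have hi : ∀ x y, IntervalIntegrable e volume x y := fun x y => hec.intervalIntegrable _ _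
  change ‖∫ u in a..b, e u‖ ≤ _
  rw [← intervalIntegral.integral_add_adjacent_intervals (hi a c1) (hi c1 b),
    ← intervalIntegral.integral_add_adjacent_intervals (hi c1 c2) (hi c2 b)]
  have := norm_add_le (∫ u in a..c1, e u) ((∫ u in c1..c2, e u) + ∫ u in c2..b, e u)
  have := norm_add_le (∫ u in c1..c2, e u) (∫ u in c2..b, e u)
  have : 10 / δ = 4 / δ + 2 / δ + 4 / δ := by ring
  linarith

lemma vdc_wave_pos {x y t v l a b : ℝ} (ht : 0 < t) (hl : 0 < l) (hv1 : l ≤ |v|) (hv2 : |v| ≤ 2 * l)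
    (hab : a ≤ b) (ha : -|v| ≤ a) (hb : b ≤ |v|) :
    ‖∫ u in a..b, Complex.exp (I * ((x * u + y + t * √(u ^ 2 + v ^ 2) : ℝ) : ℂ))‖ ≤
      10 / √(t / (8 * l)) := by
  have hv0 : v ≠ 0 := fun h => by rw [h, abs_zero] at hv1; linarith
  have hpos : ∀ u : ℝ, 0 < u ^ 2 + v ^ 2 := fun u => by positivity
  have hsd : ∀ u : ℝ, HasDerivAt (fun u : ℝ => √(u ^ 2 + v ^ 2)) (u / √(u ^ 2 + v ^ 2)) u := by
    intro u
    have h1 : HasDerivAt (fun u : ℝ => u ^ 2 + v ^ 2) (2 * u) u := by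
      simpa using (hasDerivAt_pow 2 u).add_const (v ^ 2)
    convert h1.sqrt (hpos u).ne' using 1
    rw [mul_div_mul_left _ _ two_ne_zero]
  apply vdc2 (φ := fun u => x * u + y + t * √(u ^ 2 + v ^ 2))
    (ψ := fun u => x + t * (u / √(u ^ 2 + v ^ 2)))
    (ω := fun u => t * (v ^ 2 / ((u ^ 2 + v ^ 2) * √(u ^ 2 + v ^ 2)))) _ _ _ hab (by positivity)
  · intro u hu
    have huv : |u| ≤ |v| := abs_le.2 ⟨ha.trans hu.1, hu.2.trans hb⟩
    have h2 : u ^ 2 ≤ v ^ 2 := sq_le_sq.2 huv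
    have h3 : √(u ^ 2 + v ^ 2) ≤ 2 * |v| := by
      apply Real.sqrt_le_iff.2
      constructor
      · positivity
      · rw [mul_pow, sq_abs]; nlinarith [sq_nonneg v]
    have hv0' : 0 < |v| := by positivity
    calc t / (8 * l) ≤ t * (v ^ 2 / ((v ^ 2 + v ^ 2) * (2 * |v|))) := by
          have : v ^ 2 / ((v ^ 2 + v ^ 2) * (2 * |v|)) = 1 / (4 * |v|) := by field_simp; norm_num
          rw [this, div_eq_mul_one_div]
          apply mul_le_mul_of_nonneg_left _ ht.le
          apply one_div_le_one_div_of_le (by positivity); linarith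
      _ ≤ _ := by
          have := hpos u
          gcongr
  · intro u
    have h1 := ((hasDerivAt_id u).const_mul x).add_const y
    have := h1.add ((hsd u).const_mul t)
    rw [mul_one] at this
    exact this
  · intro u
    have hs : 0 < √(u ^ 2 + v ^ 2) := sqrt_pos.2 (hpos u)
    have h1 := (((hasDerivAt_id u).div (hsd u) hs.ne').const_mul t).const_add x
    refine HasDerivAt.congr_deriv h1 ?_
    have h4 : √(u ^ 2 + v ^ 2) ^ 2 = u ^ 2 + v ^ 2 := Real.sq_sqrt (hpos u).le
    have h5 := (hpos u).ne'
    refine congrArg (t * ·) ?_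
    rw [h4]
    simp only [id]
    have h6 : 1 * √(u ^ 2 + v ^ 2) - u * (u / √(u ^ 2 + v ^ 2)) = v ^ 2 / √(u ^ 2 + v ^ 2) := by
      field_simp; rw [h4]; ring
    rw [h6, div_div]; ring_nf
  · apply Continuous.mul continuous_const
    apply Continuous.div continuous_const (by fun_prop)
    intro u
    exact (mul_pos (hpos u) (sqrt_pos.2 (hpos u))).ne'

lemma vdc_wave {x y t v l a b : ℝ} (ht : t ≠ 0) (hl : 0 < l) (hv1 : l ≤ |v|) (hv2 : |v| ≤ 2 * l)
    (hab : a ≤ b) (ha : -|v| ≤ a) (hb : b ≤ |v|) :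
    ‖∫ u in a..b, Complex.exp (I * ((x * u + y + t * √(u ^ 2 + v ^ 2) : ℝ) : ℂ))‖ ≤
      10 / √(|t| / (8 * l)) := by
  rcases lt_or_gt_of_ne ht with h | h
  · have := vdc_wave_pos (x := -x) (y := -y) (t := -t) (by linarith) hl hv1 hv2 hab ha hb
    rw [abs_of_neg h]
    refine le_trans (le_of_eq ?_) this
    rw [← Complex.norm_conj, ← intervalIntegral.intervalIntegral_conj]
    congr 1
    apply intervalIntegral.integral_congr
    intro u _
    simp only
    rw [← Complex.exp_conj, map_mul, Complex.conj_I, Complex.conj_ofReal]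
    congr 1; push_cast; ring
  · rw [abs_of_pos h]; exact vdc_wave_pos h hl hv1 hv2 hab ha hb

lemma vdc_set {x y t v l a b : ℝ} (ht : t ≠ 0) (hl : 0 < l) (hv1 : l ≤ |v|) (hv2 : |v| ≤ 2 * l)
    (ha : -|v| ≤ a) (hb : b ≤ |v|) {S : Set ℝ} (h1 : Ioo a b ⊆ S) (h2 : S ⊆ Icc a b) :
    ‖∫ u in S, Complex.exp (I * ((x * u + y + t * √(u ^ 2 + v ^ 2) : ℝ) : ℂ))‖ ≤
      10 / √(|t| / (8 * l)) := by
  rcases lt_or_ge b a with hab | hab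
  · have : S = ∅ := by rw [Set.Icc_eq_empty (not_le.2 hab)] at h2; exact Set.subset_empty_iff.1 h2
    rw [this]; simp; positivity
  have : S =ᵐ[volume] Ioc a b := by
    have e0 : S ≤ᵐ[volume] Icc a b := of_forall h2
    have e0' : Ioo a b ≤ᵐ[volume] S := of_forall h1
    have e1 : S ≤ᵐ[volume] Ioc a b := e0.trans Ioc_ae_eq_Icc.symm.le
    have e2 : Ioc a b ≤ᵐ[volume] S := Ioo_ae_eq_Ioc.symm.le.trans e0'
    exact Filter.EventuallyLE.antisymm e1 e2
  rw [setIntegral_congr_set this, ← intervalIntegral.integral_of_le hab]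
  exact vdc_wave ht hl hv1 hv2 hab ha hb

lemma planar {x y t l L : ℝ} (ht : t ≠ 0) (hl : 0 < l) (hL : 0 ≤ L) {J : Set ℝ} (hJm : MeasurableSet J)
    (hJ : volume J ≤ ofReal L) (hJl : ∀ v ∈ J, l ≤ |v| ∧ |v| ≤ 2 * l)
    {R : Set (ℝ × ℝ)} (hR : MeasurableSet R) (hRJ : ∀ z ∈ R, z.1 ∈ J)
    (hS : ∀ v ∈ J, ∃ a b, -|v| ≤ a ∧ b ≤ |v| ∧ Ioo a b ⊆ {u | (v, u) ∈ R} ∧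
      {u | (v, u) ∈ R} ⊆ Icc a b) :
    ‖∫ z in R, Complex.exp (I * ((x * z.2 + y * z.1 + t * √(z.2 ^ 2 + z.1 ^ 2) : ℝ) : ℂ))‖ ≤
      L * (10 / √(|t| / (8 * l))) := by
  set F : ℝ × ℝ → ℂ := fun z =>
    Complex.exp (I * ((x * z.2 + y * z.1 + t * √(z.2 ^ 2 + z.1 ^ 2) : ℝ) : ℂ)) with hF
  have hFc : Continuous F := by rw [hF]; fun_prop
  have hJt : volume J ≠ ∞ := ne_top_of_le_ne_top ofReal_ne_top hJ
  have hsub : R ⊆ J ×ˢ Icc (-(2 * l)) (2 * l) := by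
    intro z hz
    refine ⟨hRJ z hz, ?_⟩
    obtain ⟨a, b, ha, hb, -, h2⟩ := hS z.1 (hRJ z hz)
    have := h2 (show z.2 ∈ {u | (z.1, u) ∈ R} from hz)
    have h3 := (hJl z.1 (hRJ z hz)).2
    exact ⟨by linarith [this.1], by linarith [this.2]⟩
  have hRt : volume R < ∞ := by
    refine (measure_mono hsub).trans_lt ?_
    rw [Measure.volume_eq_prod, Measure.prod_prod, Real.volume_Icc]
    exact ENNReal.mul_lt_top hJt.lt_top ENNReal.ofReal_lt_top
  have hint : IntegrableOn F R := by
    refine Measure.integrableOn_of_bounded (M := 1) hRt.ne hFc.aestronglyMeasurable ?_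
    refine of_forall fun z => ?_
    rw [hF]; simp only; rw [mul_comm, norm_exp_ofReal_mul_I]
  have hint' : Integrable (R.indicator F) (volume.prod volume) := by
    rw [← Measure.volume_eq_prod]; exact (integrable_indicator_iff hR).2 hint
  rw [← integral_indicator hR, Measure.volume_eq_prod, integral_prod _ hint']
  set D := 10 / √(|t| / (8 * l)) with hD
  have hD0 : 0 ≤ D := by positivity
  have hslice : ∀ v, ‖∫ u, R.indicator F (v, u)‖ ≤ J.indicator (fun _ => D) v := by
    intro v
    by_cases hv : v ∈ J
    · rw [indicator_of_mem hv]
      obtain ⟨a, b, ha, hb, h1, h2⟩ := hS v hv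
      have hm : MeasurableSet {u | (v, u) ∈ R} := measurable_prodMk_left hR
      have : ∫ u, R.indicator F (v, u) = ∫ u in {u | (v, u) ∈ R}, F (v, u) := by
        rw [← integral_indicator hm]; rfl
      rw [this]
      exact vdc_set (x := x) (y := y * v) ht hl (hJl v hv).1 (hJl v hv).2 ha hb h1 h2
    · rw [indicator_of_notMem hv]
      have : ∀ u, R.indicator F (v, u) = 0 := fun u =>
        indicator_of_notMem (fun h => hv (hRJ _ h)) _
      simp [this]
  calc _ ≤ ∫ v, J.indicator (fun _ => D) v := by
        apply norm_integral_le_of_norm_le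
        · exact (integrable_indicator_iff hJm).2 (integrableOn_const hJt)
        · exact of_forall hslice
    _ = (volume J).toReal * D := by
        rw [integral_indicator_const _ hJm]; rfl
    _ ≤ _ := by
        gcongr
        exact ENNReal.toReal_le_of_le_ofReal hL hJ

def ann (l : ℝ) : Set V2 := {ξ | l ≤ max |ξ 0| |ξ 1| ∧ max |ξ 0| |ξ 1| < 2 * l}
def box (ζ : V2) (μ : ℝ) : Set V2 := {ξ | |ξ 0 - ζ 0| < μ ∧ |ξ 1 - ζ 1| < μ}

def eV : V2 ≃ᵐ ℝ × ℝ :=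
  (MeasurableEquiv.toLp 2 (Fin 2 → ℝ)).symm.trans MeasurableEquiv.finTwoArrow

lemma eV_apply (ξ : V2) : eV ξ = (ξ 0, ξ 1) := rfl

lemma eV_mp : MeasurePreserving eV volume volume :=
  (PiLp.volume_preserving_ofLp (Fin 2)).trans (volume_preserving_finTwoArrow ℝ)

def eW : V2 ≃ᵐ ℝ × ℝ := eV.trans MeasurableEquiv.prodComm

lemma eW_apply (ξ : V2) : eW ξ = (ξ 1, ξ 0) := rfl

lemma eW_mp : MeasurePreserving eW volume volume :=
  eV_mp.trans Measure.measurePreserving_swap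

lemma norm_V2 (ξ : V2) : ‖ξ‖ = √(ξ 0 ^ 2 + ξ 1 ^ 2) := by
  rw [EuclideanSpace.norm_eq]; simp

lemma inner_V2 (x ξ : V2) : ⟪x, ξ⟫ = x 0 * ξ 0 + x 1 * ξ 1 := by
  rw [PiLp.inner_apply]; simp [mul_comm]

@[fun_prop] lemma meas_coord (i : Fin 2) : Measurable (fun ξ : V2 => ξ i) := by fun_prop

lemma mand {α : Type*} [MeasurableSpace α] {p q : α → Prop} (hp : MeasurableSet {x | p x})
    (hq : MeasurableSet {x | q x}) : MeasurableSet {x | p x ∧ q x} := hp.inter hq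

lemma meas_ann (l : ℝ) : MeasurableSet (ann l) :=
  mand (measurableSet_le (by fun_prop) (by fun_prop)) (measurableSet_lt (by fun_prop) (by fun_prop))

lemma meas_box (ζ : V2) (μ : ℝ) : MeasurableSet (box ζ μ) :=
  mand (measurableSet_lt (by fun_prop) (by fun_prop)) (measurableSet_lt (by fun_prop) (by fun_prop))

lemma volJ {l μ : ℝ} (hl : 0 < l) (hμ : 0 < μ) (z : ℝ) :
    volume {v : ℝ | l ≤ |v| ∧ |v| < 2 * l ∧ |v - z| < μ} ≤ ofReal (4 * min μ l) := by
  rw [mul_min_of_nonneg _ _ (by norm_num), ENNReal.ofReal_min]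
  refine le_min ?_ ?_
  · calc _ ≤ volume (Metric.ball z μ) := measure_mono fun v hv => by
          rw [Metric.mem_ball, Real.dist_eq]; exact hv.2.2
      _ = ofReal (2 * μ) := Real.volume_ball _ _
      _ ≤ _ := ofReal_le_ofReal (by linarith)
  · calc _ ≤ volume (Metric.ball (0 : ℝ) (2 * l)) := measure_mono fun v hv => by
          rw [Metric.mem_ball, Real.dist_eq, sub_zero]; exact hv.2.1
      _ = ofReal (2 * (2 * l)) := Real.volume_ball _ _
      _ ≤ _ := ofReal_le_ofReal (by linarith)

lemma slice_lt (v z μ : ℝ) (S : Set ℝ) (h1 : ∀ u, |u| < |v| → |u - z| < μ → u ∈ S)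
    (h2 : ∀ u ∈ S, |u| ≤ |v| ∧ |u - z| < μ) :
    ∃ a b, -|v| ≤ a ∧ b ≤ |v| ∧ Ioo a b ⊆ S ∧ S ⊆ Icc a b := by
  refine ⟨max (-|v|) (z - μ), min |v| (z + μ), le_max_left _ _, min_le_left _ _, ?_, ?_⟩
  · intro u hu
    rw [Set.mem_Ioo, max_lt_iff, lt_min_iff] at hu
    refine h1 u (abs_lt.2 ⟨hu.1.1, hu.2.1⟩) (abs_lt.2 ⟨by linarith [hu.1.2], by linarith [hu.2.2]⟩)
  · intro u hu
    obtain ⟨h3, h4⟩ := h2 u hu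
    rw [abs_le] at h3; rw [abs_lt] at h4
    rw [Set.mem_Icc, max_le_iff, le_min_iff]
    exact ⟨⟨h3.1, by linarith [h4.1]⟩, h3.2, by linarith [h4.2]⟩

lemma bdd_ann (l : ℝ) (ξ : V2) (h : ξ ∈ ann l) : ‖ξ‖ ≤ 4 * l := by
  have h0 : |ξ 0| < 2 * l := (le_max_left _ _).trans_lt h.2
  have h1 : |ξ 1| < 2 * l := (le_max_right _ _).trans_lt h.2
  have := abs_nonneg (ξ 0)
  rw [norm_V2]
  apply Real.sqrt_le_iff.2
  refine ⟨by linarith, ?_⟩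
  rw [abs_lt] at h0 h1
  nlinarith [sq_nonneg (ξ 0), sq_nonneg (ξ 1)]

lemma ann_le (l : ℝ) (ξ : V2) (h : ξ ∈ ann l) : l ≤ ‖ξ‖ := by
  refine h.1.trans ?_
  rw [norm_V2]
  refine max_le (Real.abs_le_sqrt ?_) (Real.abs_le_sqrt ?_) <;> nlinarith [sq_nonneg (ξ 0), sq_nonneg (ξ 1)]

lemma vol_ann_lt_top (l : ℝ) : volume (ann l) < ∞ := by
  refine (measure_mono (t := Metric.closedBall 0 (4 * l)) fun ξ h => ?_).trans_lt measure_closedBall_lt_top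
  rw [mem_closedBall_zero_iff]; exact bdd_ann l ξ h

lemma kernel_bound {l μ t : ℝ} (hl : 0 < l) (hμ : 0 < μ) (ht : t ≠ 0) (ζ x : V2) :
    ‖∫ ξ in box ζ μ ∩ ann l, Complex.exp (I * ((⟪x, ξ⟫ + t * ‖ξ‖ : ℝ) : ℂ))‖ ≤
      240 * min μ l * √l * |t| ^ (-(1 / 2) : ℝ) := by
  set G : V2 → ℂ := fun ξ => Complex.exp (I * ((⟪x, ξ⟫ + t * ‖ξ‖ : ℝ) : ℂ)) with hG
  have hGc : Continuous G := by rw [hG]; fun_prop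
  have hm0 : 0 < min μ l := lt_min hμ hl
  set F : ℝ → ℝ → ℝ × ℝ → ℂ := fun X Y z =>
    Complex.exp (I * ((X * z.2 + Y * z.1 + t * √(z.2 ^ 2 + z.1 ^ 2) : ℝ) : ℂ)) with hF
  have G1 : ∀ ξ, G ξ = F (x 0) (x 1) (eW ξ) := by
    intro ξ
    simp only [hG, hF, eW_apply, inner_V2, norm_V2]
  have G2 : ∀ ξ, G ξ = F (x 1) (x 0) (eV ξ) := by
    intro ξ
    simp only [hG, hF, eV_apply, inner_V2, norm_V2]
    congr 3
    rw [add_comm (x 0 * ξ 0), add_comm (ξ 0 ^ 2)]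
  set R1 : Set (ℝ × ℝ) := {z | (l ≤ |z.1| ∧ |z.1| < 2 * l ∧ |z.1 - ζ 1| < μ) ∧ (|z.2| ≤ |z.1| ∧ |z.2 - ζ 0| < μ)} with hR1
  set R2 : Set (ℝ × ℝ) := {z | (l ≤ |z.1| ∧ |z.1| < 2 * l ∧ |z.1 - ζ 0| < μ) ∧ (|z.2| < |z.1| ∧ |z.2 - ζ 1| < μ)} with hR2
  have mR1 : MeasurableSet R1 := by
    refine mand (mand ?_ (mand ?_ ?_)) (mand ?_ ?_)
    · exact measurableSet_le (by fun_prop) (by fun_prop)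
    · exact measurableSet_lt (by fun_prop) (by fun_prop)
    · exact measurableSet_lt (by fun_prop) (by fun_prop)
    · exact measurableSet_le (by fun_prop) (by fun_prop)
    · exact measurableSet_lt (by fun_prop) (by fun_prop)
  have mR2 : MeasurableSet R2 := by
    refine mand (mand ?_ (mand ?_ ?_)) (mand ?_ ?_)
    · exact measurableSet_le (by fun_prop) (by fun_prop)
    · exact measurableSet_lt (by fun_prop) (by fun_prop)
    · exact measurableSet_lt (by fun_prop) (by fun_prop)
    · exact measurableSet_lt (by fun_prop) (by fun_prop)
    · exact measurableSet_lt (by fun_prop) (by fun_prop)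
  have mJ : ∀ z : ℝ, MeasurableSet {v : ℝ | l ≤ |v| ∧ |v| < 2 * l ∧ |v - z| < μ} := fun z =>
    mand (measurableSet_le (by fun_prop) (by fun_prop))
      (mand (measurableSet_lt (by fun_prop) (by fun_prop))
        (measurableSet_lt (by fun_prop) (by fun_prop)))
  have hE : box ζ μ ∩ ann l = eW ⁻¹' R1 ∪ eV ⁻¹' R2 := by
    ext ξ
    simp only [box, ann, hR1, hR2, Set.mem_inter_iff, Set.mem_union, Set.mem_preimage,
      Set.mem_ofPred_eq, eV_apply, eW_apply]
    rcases le_or_gt |ξ 0| |ξ 1| with h | h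
    · rw [max_eq_right h]; have := not_lt.2 h; tauto
    · rw [max_eq_left h.le]; have := not_le.2 h; tauto
  have hdisj : Disjoint (eW ⁻¹' R1) (eV ⁻¹' R2) := by
    rw [Set.disjoint_left]
    rintro ξ h1 h2
    have h3 : |ξ 0| ≤ |ξ 1| := h1.2.1
    have h4 : |ξ 1| < |ξ 0| := h2.2.1
    linarith
  have hint : IntegrableOn G (box ζ μ ∩ ann l) := by
    refine Measure.integrableOn_of_bounded (M := 1)
      ((measure_mono Set.inter_subset_right).trans_lt (vol_ann_lt_top l)).ne hGc.aestronglyMeasurable ?_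
    refine of_forall fun z => ?_
    rw [hG]; simp only; rw [mul_comm, norm_exp_ofReal_mul_I]
  rw [hE] at hint ⊢
  rw [setIntegral_union hdisj (eV.measurable mR2) hint.left_of_union hint.right_of_union]
  have i1 : ∫ ξ in eW ⁻¹' R1, G ξ = ∫ z in R1, F (x 0) (x 1) z := by
    simp_rw [G1]
    exact eW_mp.setIntegral_preimage_emb eW.measurableEmbedding _ _
  have i2 : ∫ ξ in eV ⁻¹' R2, G ξ = ∫ z in R2, F (x 1) (x 0) z := by
    simp_rw [G2]
    exact eV_mp.setIntegral_preimage_emb eV.measurableEmbedding _ _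
  have b1 : ‖∫ z in R1, F (x 0) (x 1) z‖ ≤ 4 * min μ l * (10 / √(|t| / (8 * l))) := by
    refine planar ht hl (by positivity) (mJ (ζ 1)) (volJ hl hμ _) (fun v hv => ⟨hv.1, hv.2.1.le⟩) mR1
      (fun z hz => hz.1) fun v hv => slice_lt v (ζ 0) μ _ (fun u h1 h2 => ⟨hv, h1.le, h2⟩)
      (fun u hu => ⟨hu.2.1, hu.2.2⟩)
  have b2 : ‖∫ z in R2, F (x 1) (x 0) z‖ ≤ 4 * min μ l * (10 / √(|t| / (8 * l))) := by
    refine planar ht hl (by positivity) (mJ (ζ 0)) (volJ hl hμ _) (fun v hv => ⟨hv.1, hv.2.1.le⟩) mR2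
      (fun z hz => hz.1) fun v hv => slice_lt v (ζ 1) μ _ (fun u h1 h2 => ⟨hv, h1, h2⟩)
      (fun u hu => ⟨hu.2.1.le, hu.2.2⟩)
  rw [i1, i2]
  refine (norm_add_le _ _).trans ((add_le_add b1 b2).trans ?_)
  have ht0 : 0 < |t| := abs_pos.2 ht
  have e : 10 / √(|t| / (8 * l)) ≤ 30 * √l * |t| ^ (-(1 / 2) : ℝ) := by
    rw [rpow_neg ht0.le, ← Real.sqrt_eq_rpow, Real.sqrt_div' _ (by positivity), Real.sqrt_mul (by norm_num)]
    have h8 : √8 ≤ 3 := by apply Real.sqrt_le_iff.2; norm_num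
    rw [div_div_eq_mul_div, div_eq_mul_inv]
    apply mul_le_mul_of_nonneg_right _ (by positivity)
    nlinarith [Real.sqrt_nonneg l]
  calc _ = 8 * min μ l * (10 / √(|t| / (8 * l))) := by ring
    _ ≤ 8 * min μ l * (30 * √l * |t| ^ (-(1 / 2) : ℝ)) := by gcongr
    _ = _ := by ring

def ph (σ t : ℝ) (x ξ : V2) : ℂ := Complex.exp (I * ((⟪x, ξ⟫ + σ * t * ‖ξ‖ : ℝ) : ℂ))

def PP (g : V2 → ℂ) (σ : ℝ) (E : Set V2) (t : ℝ) (x : V2) : ℂ := ∫ ξ in E, ph σ t x ξ * g ξ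

lemma ph_norm (σ t : ℝ) (x ξ : V2) : ‖ph σ t x ξ‖ = 1 := by
  rw [ph, mul_comm, norm_exp_ofReal_mul_I]

lemma ph_cont (σ : ℝ) : Continuous fun z : (ℝ × V2) × V2 => ph σ z.1.1 z.1.2 z.2 := by
  unfold ph; fun_prop

lemma ph_conj (σ t s : ℝ) (x y ξ : V2) :
    ph σ t x ξ * (starRingEnd ℂ) (ph σ s y ξ) = ph σ (t - s) (x - y) ξ := by
  unfold ph
  rw [← Complex.exp_conj, ← Complex.exp_add, map_mul, Complex.conj_I, Complex.conj_ofReal]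
  congr 1
  rw [inner_sub_left]; push_cast; ring

lemma PP_zero {g : V2 → ℂ} {σ : ℝ} {E : Set V2} (h : ¬ IntegrableOn g E) (t : ℝ) (x : V2) :
    PP g σ E t x = 0 := by
  apply integral_undef
  intro h'
  apply h
  have hc : Continuous fun ξ => (starRingEnd ℂ) (ph σ t x ξ) :=
    Complex.continuous_conj.comp ((ph_cont σ).comp (by fun_prop : Continuous fun ξ : V2 => (((t, x), ξ) : (ℝ × V2) × V2)))
  have := h'.bdd_mul (c := 1) hc.aestronglyMeasurable (of_forall fun ξ => by simp [ph_norm])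
  refine this.congr (of_forall fun ξ => ?_)
  simp only
  rw [← mul_assoc, ← Complex.normSq_eq_conj_mul_self, Complex.normSq_eq_norm_sq, ph_norm]; simp

lemma PP_int {g : V2 → ℂ} {σ : ℝ} {E : Set V2} (h : IntegrableOn g E) (t : ℝ) (x : V2) :
    IntegrableOn (fun ξ => ph σ t x ξ * g ξ) E := by
  refine Integrable.bdd_mul (c := 1) h ?_ (of_forall fun ξ => by simp [ph_norm])
  exact ((ph_cont σ).comp (by fun_prop : Continuous fun ξ : V2 => (((t, x), ξ) : (ℝ × V2) × V2))).aestronglyMeasurable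

lemma PP_cont (g : V2 → ℂ) (σ : ℝ) (E : Set V2) : Continuous fun z : ℝ × V2 => PP g σ E z.1 z.2 := by
  by_cases h : IntegrableOn g E
  · apply continuous_of_dominated (bound := fun ξ => ‖g ξ‖)
    · intro z; exact (PP_int h z.1 z.2).aestronglyMeasurable
    · intro z; refine of_forall fun ξ => ?_
      rw [norm_mul, ph_norm, one_mul]
    · exact h.norm
    · refine of_forall fun ξ => ?_
      exact ((ph_cont σ).comp (by fun_prop : Continuous fun z : ℝ × V2 => ((z, ξ) : (ℝ × V2) × V2))).mul
        continuous_const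
  · simp_rw [PP_zero h]; exact continuous_const

lemma PP_bound (g : V2 → ℂ) (σ : ℝ) (E : Set V2) (t : ℝ) (x : V2) :
    ‖PP g σ E t x‖ ≤ ∫ ξ in E, ‖g ξ‖ := by
  refine (norm_integral_le_integral_norm _).trans_eq ?_
  simp [ph_norm]

lemma tt_A (σ K : ℝ) (E : Set V2) (hK0 : 0 ≤ K)
    (hEt : volume E ≠ ∞)
    (hK : ∀ (t : ℝ) (x : V2), t ≠ 0 → ‖∫ ξ in E, ph σ t x ξ‖ ≤ K * |t| ^ (-(1 / 2) : ℝ))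
    (X : ℝ → V2) (f : ℝ → ℂ) (hfm : Measurable f) (hfi : Integrable f)
    (e : ℝ → V2 → ℂ) (he : e = fun t ξ => ph σ t (X t) ξ) (hem : Measurable (Function.uncurry e))
    (hen : ∀ t ξ, ‖e t ξ‖ = 1) (Φ : V2 → ℂ) (hΦ : Φ = fun ξ => ∫ t, f t * e t ξ) (hΦm : Measurable Φ)
    (C : ℝ≥0∞) (H : ∀ f : ℝ → ℝ≥0∞, Measurable f → ∫⁻ t, f t * ∫⁻ s, f s * ofReal (|t - s| ^ (-(1 / 2) : ℝ)) ≤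
      C * (∫⁻ t, f t ^ (4 / 3 : ℝ)) ^ (3 / 2 : ℝ)) :
    ∫⁻ ξ in E, ‖Φ ξ‖ₑ ^ 2 ≤ ofReal K * (C * (∫⁻ t, ‖f t‖ₑ ^ (4 / 3 : ℝ)) ^ (3 / 2 : ℝ)) := by
  have hΦb : ∀ ξ, ‖Φ ξ‖ ≤ ∫ t, ‖f t‖ := fun ξ => by
    rw [hΦ]
    refine (norm_integral_le_integral_norm _).trans_eq ?_
    simp [hen]
  set F : V2 → ℝ × ℝ → ℂ := fun ξ z =>
    (f z.1 * e z.1 ξ) * (starRingEnd ℂ) (f z.2 * e z.2 ξ) with hF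
  have hFm : Measurable (Function.uncurry F) := by
    have h1 : Measurable fun w : V2 × (ℝ × ℝ) => f w.2.1 * e w.2.1 w.1 :=
      (hfm.comp (measurable_fst.comp measurable_snd)).mul
        (hem.comp ((measurable_fst.comp measurable_snd).prodMk measurable_fst))
    have h2 : Measurable fun w : V2 × (ℝ × ℝ) => f w.2.2 * e w.2.2 w.1 :=
      (hfm.comp (measurable_snd.comp measurable_snd)).mul
        (hem.comp ((measurable_snd.comp measurable_snd).prodMk measurable_fst))
    exact h1.mul (Complex.continuous_conj.measurable.comp h2)
  have hFi : Integrable (Function.uncurry F) ((volume.restrict E).prod (volume.prod volume)) := by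
    have : IsFiniteMeasure ((volume : Measure V2).restrict E) :=
      ⟨by rw [Measure.restrict_apply_univ]; exact hEt.lt_top⟩
    have h1 : Integrable (fun z : ℝ × ℝ => ‖f z.1‖ * ‖f z.2‖) (volume.prod volume) :=
      hfi.norm.mul_prod hfi.norm
    have h2 := h1.comp_snd (volume.restrict E)
    refine h2.mono' hFm.aestronglyMeasurable (of_forall fun w => ?_)
    simp [Function.uncurry, hF, hen]
  have e1 : ∀ ξ, ((‖Φ ξ‖ ^ 2 : ℝ) : ℂ) = ∫ z, F ξ z ∂(volume.prod volume) := by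
    intro ξ
    rw [hF, hΦ]; simp only
    rw [integral_prod_mul (fun t => f t * e t ξ) (fun t => (starRingEnd ℂ) (f t * e t ξ)), integral_conj]
    rw [← Complex.normSq_eq_norm_sq, Complex.normSq_eq_conj_mul_self, mul_comm]
  have e2 : ((∫ ξ in E, ‖Φ ξ‖ ^ 2 : ℝ) : ℂ) = ∫ z, (∫ ξ in E, F ξ z) ∂(volume.prod volume) := by
    rw [← integral_integral_swap hFi]
    refine (integral_ofReal (𝕜 := ℂ)).symm.trans ?_
    congr 1; ext ξ; rw [← e1]
    rfl
  have e3 : ∀ z : ℝ × ℝ, ∫ ξ in E, F ξ z = f z.1 * (starRingEnd ℂ) (f z.2) *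
      ∫ ξ in E, ph σ (z.1 - z.2) (X z.1 - X z.2) ξ := by
    intro z
    rw [← integral_const_mul]
    congr 1; ext ξ
    rw [← ph_conj, hF]; simp only [he, map_mul]; ring
  have hsqint : ∫⁻ ξ in E, ‖Φ ξ‖ₑ ^ 2 = ‖((∫ ξ in E, ‖Φ ξ‖ ^ 2 : ℝ) : ℂ)‖ₑ := by
    rw [← ofReal_norm, norm_real, Real.norm_of_nonneg (integral_nonneg fun ξ => by positivity),
      ofReal_integral_eq_lintegral_ofReal]
    · apply lintegral_congr; intro ξ
      rw [ENNReal.ofReal_pow (norm_nonneg _), ofReal_norm]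
    · refine Measure.integrableOn_of_bounded (M := (∫ t, ‖f t‖) ^ 2) hEt
        (hΦm.norm.pow_const 2).aestronglyMeasurable (of_forall fun ξ => ?_)
      rw [norm_pow, norm_norm]
      gcongr; exact hΦb ξ
    · exact of_forall fun ξ => by positivity
  rw [hsqint, e2]
  have hk : Measurable fun z : ℝ × ℝ =>
      ‖f z.1‖ₑ * ‖f z.2‖ₑ * ofReal (K * |z.1 - z.2| ^ (-(1 / 2) : ℝ)) := by
    fun_prop
  calc _ ≤ ∫⁻ z, ‖∫ ξ in E, F ξ z‖ₑ ∂(volume.prod volume) := enorm_integral_le_lintegral_enorm _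
    _ ≤ ∫⁻ t, ∫⁻ s, ‖∫ ξ in E, F ξ (t, s)‖ₑ := lintegral_prod_le _
    _ ≤ ∫⁻ t, ∫⁻ s, ‖f t‖ₑ * ‖f s‖ₑ * ofReal (K * |t - s| ^ (-(1 / 2) : ℝ)) := by
        apply lintegral_mono; intro t
        apply lintegral_mono_ae
        have : ∀ᵐ s : ℝ, s ≠ t := by simp [ae_iff]
        filter_upwards [this] with s hs
        rw [e3]; simp only
        rw [enorm_mul, enorm_mul, RCLike.enorm_conj]
        gcongr
        rw [← ofReal_norm]
        exact ofReal_le_ofReal (hK _ _ (sub_ne_zero.2 hs.symm))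
    _ = ofReal K * ∫⁻ t, ‖f t‖ₑ * ∫⁻ s, ‖f s‖ₑ * ofReal (|t - s| ^ (-(1 / 2) : ℝ)) := by
        rw [← lintegral_const_mul' _ _ ofReal_ne_top]
        apply lintegral_congr; intro t
        rw [← mul_assoc, ← lintegral_const_mul' _ _ (by finiteness)]
        apply lintegral_congr; intro s
        rw [ofReal_mul hK0]; ring
    _ ≤ ofReal K * (C * (∫⁻ t, ‖f t‖ₑ ^ (4 / 3 : ℝ)) ^ (3 / 2 : ℝ)) := by
        gcongr; exact H _ hfm.enorm


lemma tt_B (g : V2 → ℂ) (σ K : ℝ) (E : Set V2) (hK0 : 0 ≤ K) (hg : Measurable g)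
    (hEt : volume E ≠ ∞)
    (hK : ∀ (t : ℝ) (x : V2), t ≠ 0 → ‖∫ ξ in E, ph σ t x ξ‖ ≤ K * |t| ^ (-(1 / 2) : ℝ))
    (X : ℝ → V2) (hgi : IntegrableOn g E)
    (I : ℝ → ℂ) (hI : I = fun t => PP g σ E t (X t)) (hIm : Measurable I) (A : ℝ) (hIb : ∀ t, ‖I t‖ ≤ A)
    (e : ℝ → V2 → ℂ) (he : e = fun t ξ => ph σ t (X t) ξ) (hem : Measurable (Function.uncurry e))
    (hen : ∀ t ξ, ‖e t ξ‖ = 1) (B : ℝ≥0∞) (hB : B = ∫⁻ ξ in E, ‖g ξ‖ₑ ^ 2)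
    (C : ℝ≥0∞) (H : ∀ f : ℝ → ℝ≥0∞, Measurable f → ∫⁻ t, f t * ∫⁻ s, f s * ofReal (|t - s| ^ (-(1 / 2) : ℝ)) ≤
      C * (∫⁻ t, f t ^ (4 / 3 : ℝ)) ^ (3 / 2 : ℝ)) (T : ℕ) :
    ∫⁻ t in Icc (-(T : ℝ)) T, ‖I t‖ₑ ^ 4 ≤ (C * ofReal K * B) ^ 2 := by
  obtain ⟨D, hD⟩ : ∃ D, D = Icc (-(T : ℝ)) T := ⟨_, rfl⟩
  rw [← hD]
  have hDm : MeasurableSet D := hD ▸ measurableSet_Icc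
  have hDt : volume D ≠ ∞ := by rw [hD, Real.volume_Icc]; exact ofReal_ne_top
  obtain ⟨Y, hY⟩ : ∃ Y, Y = ∫⁻ t in D, ‖I t‖ₑ ^ 4 := ⟨_, rfl⟩
  rw [← hY]
  have hYt : Y ≠ ∞ := by
    have : Y ≤ ∫⁻ t in D, ofReal A ^ 4 := by
      rw [hY]
      apply lintegral_mono; intro t
      simp only
      gcongr
      rw [← ofReal_norm]; exact ofReal_le_ofReal (hIb t)
    refine ne_top_of_le_ne_top ?_ this
    rw [setLIntegral_const]
    exact ENNReal.mul_ne_top (by finiteness) hDt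
  obtain ⟨f, hf⟩ : ∃ f : ℝ → ℂ, f = D.indicator fun t => (starRingEnd ℂ) (I t) * ((‖I t‖ ^ 2 : ℝ) : ℂ) := ⟨_, rfl⟩
  have hfm : Measurable f := by
    rw [hf]
    apply Measurable.indicator _ hDm
    exact (Complex.continuous_conj.measurable.comp hIm).mul
      (Complex.measurable_ofReal.comp (hIm.norm.pow_const 2))
  have hfn : ∀ t, ‖f t‖ = D.indicator (fun t => ‖I t‖ ^ 3) t := by
    intro t
    rw [hf]
    by_cases h : t ∈ D
    · simp [indicator_of_mem h]; ring
    · simp [indicator_of_notMem h]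
  have hfi : Integrable f := by
    rw [hf, integrable_indicator_iff hDm]
    refine Measure.integrableOn_of_bounded (M := A ^ 3) hDt ?_ ?_
    · exact ((Complex.continuous_conj.measurable.comp hIm).mul
      (Complex.measurable_ofReal.comp (hIm.norm.pow_const 2))).aestronglyMeasurable
    · refine of_forall fun t => ?_
      simp only [norm_mul, RCLike.norm_conj, norm_real, norm_pow, norm_norm]
      calc ‖I t‖ * ‖I t‖ ^ 2 = ‖I t‖ ^ 3 := by ring
        _ ≤ A ^ 3 := by gcongr; exact hIb t
  -- Y as an integral
  have hY1 : ∫ t, f t * I t = ((Y.toReal : ℝ) : ℂ) := by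
    have : ∀ t, f t * I t = D.indicator (fun t => ((‖I t‖ ^ 4 : ℝ) : ℂ)) t := by
      intro t
      rw [hf]
      by_cases h : t ∈ D
      · simp only [indicator_of_mem h]
        rw [mul_right_comm, ← Complex.normSq_eq_conj_mul_self, Complex.normSq_eq_norm_sq]
        push_cast; ring
      · simp [indicator_of_notMem h]
    simp_rw [this]
    rw [integral_indicator hDm]
    have e5 : ∫ t in D, ((‖I t‖ ^ 4 : ℝ) : ℂ) = ((∫ t in D, ‖I t‖ ^ 4 : ℝ) : ℂ) := integral_ofReal
    rw [e5, integral_eq_lintegral_of_nonneg_ae]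
    · rw [hY]
      congr 3
      ext t
      rw [ENNReal.ofReal_pow (norm_nonneg _), ofReal_norm]
    · exact of_forall fun t => by positivity
    · exact (hIm.norm.pow_const 4).aestronglyMeasurable
  obtain ⟨Φ, hΦ⟩ : ∃ Φ : V2 → ℂ, Φ = fun ξ => ∫ t, f t * e t ξ := ⟨_, rfl⟩
  have hint1 : Integrable (Function.uncurry fun t ξ => f t * (e t ξ * g ξ))
      (volume.prod (volume.restrict E)) := by
    have h1 : Integrable (fun z : ℝ × V2 => f z.1 * g z.2) (volume.prod (volume.restrict E)) :=
      hfi.mul_prod hgi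
    have := h1.bdd_mul (c := 1) hem.aestronglyMeasurable
      (of_forall fun z => by simp [Function.uncurry, hen])
    refine this.congr (of_forall fun z => ?_)
    simp only [Function.uncurry]; ring
  have hY2 : ((Y.toReal : ℝ) : ℂ) = ∫ ξ in E, g ξ * Φ ξ := by
    rw [← hY1]
    calc ∫ t, f t * I t = ∫ t, ∫ ξ in E, f t * (e t ξ * g ξ) := by
          congr 1; ext t; rw [integral_const_mul, hI, he]; rfl
      _ = ∫ ξ in E, ∫ t, f t * (e t ξ * g ξ) := integral_integral_swap hint1
      _ = _ := by
          congr 1; ext ξ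
          rw [hΦ]; simp only
          rw [← integral_const_mul]
          congr 1; ext t; ring
  have hΦm : Measurable Φ := by
    have : StronglyMeasurable (Function.uncurry fun ξ t => f t * e t ξ) :=
      ((hfm.comp measurable_snd).mul (hem.comp measurable_swap)).stronglyMeasurable
    rw [hΦ]; exact this.integral_prod_right.measurable
  have hY3 : Y ≤ B ^ (1 / 2 : ℝ) * (∫⁻ ξ in E, ‖Φ ξ‖ₑ ^ 2) ^ (1 / 2 : ℝ) := by
    calc Y = ‖((Y.toReal : ℝ) : ℂ)‖ₑ := by
          rw [← ofReal_norm, norm_real, Real.norm_of_nonneg ENNReal.toReal_nonneg,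
            ENNReal.ofReal_toReal hYt]
      _ ≤ ∫⁻ ξ in E, ‖g ξ * Φ ξ‖ₑ := by rw [hY2]; exact enorm_integral_le_lintegral_enorm _
      _ = ∫⁻ ξ in E, ((fun ξ => ‖g ξ‖ₑ) * fun ξ => ‖Φ ξ‖ₑ) ξ := by simp [enorm_mul]
      _ ≤ _ := by
          have := ENNReal.lintegral_mul_le_Lp_mul_Lq (volume.restrict E) (p := 2) (q := 2)
            (by constructor <;> norm_num) (f := fun ξ => ‖g ξ‖ₑ)
            (g := fun ξ => ‖Φ ξ‖ₑ) hg.enorm.aemeasurable hΦm.enorm.aemeasurable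
          refine this.trans_eq ?_
          simp only [ENNReal.rpow_ofNat]
          rw [hB]
  have hΦ2 : ∫⁻ ξ in E, ‖Φ ξ‖ₑ ^ 2 ≤ C * ofReal K * Y ^ (3 / 2 : ℝ) := by
    refine (tt_A σ K E hK0 hEt hK X f hfm hfi e he hem hen Φ hΦ hΦm C H).trans_eq ?_
    have : ∫⁻ t, ‖f t‖ₑ ^ (4 / 3 : ℝ) = Y := by
      rw [hY, ← lintegral_indicator hDm]
      apply lintegral_congr; intro t
      rw [← ofReal_norm, hfn]
      by_cases h : t ∈ D
      · simp only [indicator_of_mem h]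
        rw [ENNReal.ofReal_pow (norm_nonneg _), ofReal_norm, ← ENNReal.rpow_natCast, ← erm,
          ← ENNReal.rpow_natCast]
        congr 1; norm_num
      · simp only [indicator_of_notMem h]; simp
    rw [this]; ring
  have hfin : Y ≤ (C * ofReal K * B) ^ (1 / 2 : ℝ) * Y ^ (3 / 4 : ℝ) := by
    refine hY3.trans ((mul_le_mul_right (erl hΦ2 (by norm_num)) _).trans_eq ?_)
    rw [mul_rpow_of_nonneg _ _ (by norm_num), mul_rpow_of_nonneg _ B (by norm_num),
      ← erm, ← mul_assoc, mul_comm (B ^ (1 / 2 : ℝ))]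
    norm_num
  rcases eq_or_ne Y 0 with h0 | h0
  · rw [h0]; exact zero_le
  have h34 : Y ^ (3 / 4 : ℝ) ≠ 0 := by simp [ENNReal.rpow_eq_zero_iff, h0]; intro _; norm_num
  have h34t : Y ^ (3 / 4 : ℝ) ≠ ∞ := by finiteness
  have h14 : Y ^ (1 / 4 : ℝ) ≤ (C * ofReal K * B) ^ (1 / 2 : ℝ) := by
    have : Y = Y ^ (1 / 4 : ℝ) * Y ^ (3 / 4 : ℝ) := by
      rw [← ENNReal.rpow_add _ _ h0 hYt]; norm_num
    have h5 : Y ^ (1 / 4 : ℝ) * Y ^ (3 / 4 : ℝ) ≤ (C * ofReal K * B) ^ (1 / 2 : ℝ) * Y ^ (3 / 4 : ℝ) := by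
      rw [← this]; exact hfin
    exact (ENNReal.mul_le_mul_iff_left h34 h34t).1 h5
  have := erl h14 (by norm_num : (0 : ℝ) ≤ 4)
  rw [← erm, ← erm] at this
  norm_num at this
  exact this

lemma tt_exh (F : ℝ → ℝ≥0∞) (b : ℝ≥0∞) (key : ∀ T : ℕ, ∫⁻ t in Icc (-(T : ℝ)) T, F t ≤ b) :
    ∫⁻ t, F t ≤ b := by
  have hmono : Monotone fun T : ℕ => Icc (-(T : ℝ)) T := by
    intro a b hab
    have : (a : ℝ) ≤ b := by exact_mod_cast hab
    exact Set.Icc_subset_Icc (by linarith) this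
  have hU : ⋃ T : ℕ, Icc (-(T : ℝ)) T = univ := by
    ext t
    simp only [Set.mem_iUnion, Set.mem_univ, iff_true]
    obtain ⟨T, hT⟩ := exists_nat_ge |t|
    exact ⟨T, abs_le.1 hT⟩
  have : ∫⁻ t, F t = ⨆ T : ℕ, ∫⁻ t in Icc (-(T : ℝ)) T, F t := by
    rw [← setLIntegral_iUnion_of_directed _ (hmono.directed_le), hU, setLIntegral_univ]
  rw [this]
  exact iSup_le key

lemma tt_C (C : ℝ≥0∞) (H : ∀ f : ℝ → ℝ≥0∞, Measurable f → ∫⁻ t, f t * ∫⁻ s, f s * ofReal (|t - s| ^ (-(1 / 2) : ℝ)) ≤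
      C * (∫⁻ t, f t ^ (4 / 3 : ℝ)) ^ (3 / 2 : ℝ)) (g : V2 → ℂ) (σ K : ℝ) (E : Set V2) (hK0 : 0 ≤ K) (hg : Measurable g)
    (hEt : volume E ≠ ∞)
    (hK : ∀ (t : ℝ) (x : V2), t ≠ 0 → ‖∫ ξ in E, ph σ t x ξ‖ ≤ K * |t| ^ (-(1 / 2) : ℝ))
    (X : ℝ → V2) (hX : Measurable X) :
      ∫⁻ t, ‖PP g σ E t (X t)‖ₑ ^ 4 ≤ (C * ofReal K * ∫⁻ ξ in E, ‖g ξ‖ₑ ^ 2) ^ 2 := by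
  by_cases hgi : IntegrableOn g E
  · have hIm : Measurable fun t => PP g σ E t (X t) :=
      Measurable.comp (g := fun z : ℝ × V2 => PP g σ E z.1 z.2) (f := fun t => (t, X t))
        (PP_cont g σ E).measurable (Measurable.prodMk measurable_id' hX)
    have hem : Measurable (Function.uncurry fun (t : ℝ) (ξ : V2) => ph σ t (X t) ξ) :=
      Measurable.comp (g := fun z : (ℝ × V2) × V2 => ph σ z.1.1 z.1.2 z.2)
        (f := fun w : ℝ × V2 => ((w.1, X w.1), w.2)) (ph_cont σ).measurable (by fun_prop)
    apply tt_exh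
    intro T
    exact tt_B g σ K E hK0 hg hEt hK X hgi _ rfl hIm _ (fun t => PP_bound _ _ _ _ _) _ rfl hem
        (fun t ξ => ph_norm _ _ _ _) _ rfl C H T
  · have : ∀ t, ‖PP g σ E t (X t)‖ₑ ^ 4 = 0 := fun t => by rw [PP_zero hgi]; simp
    rw [lintegral_congr this]; simp

lemma ttstar : ∃ C : ℝ≥0∞, C ≠ ∞ ∧ ∀ (g : V2 → ℂ) (σ K : ℝ) (E : Set V2), 0 ≤ K → Measurable g →
    volume E ≠ ∞ →
    (∀ (t : ℝ) (x : V2), t ≠ 0 → ‖∫ ξ in E, ph σ t x ξ‖ ≤ K * |t| ^ (-(1 / 2) : ℝ)) →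
    ∀ X : ℝ → V2, Measurable X →
      ∫⁻ t, ‖PP g σ E t (X t)‖ₑ ^ 4 ≤ (C * ofReal K * ∫⁻ ξ in E, ‖g ξ‖ₑ ^ 2) ^ 2 :=
  Exists.elim hls1 fun C h => ⟨C, h.1, fun g σ K E hK0 hg hEt hK X hX =>
    tt_C C h.2 g σ K E hK0 hg hEt hK X hX⟩

def dq (j : ℕ) : V2 := TopologicalSpace.denseSeq V2 j

def PS (g : V2 → ℂ) (σ : ℝ) (E : Set V2) (t : ℝ) : ℝ≥0∞ := ⨆ j, ‖PP g σ E t (dq j)‖ₑ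

lemma PP_contx (g : V2 → ℂ) (σ : ℝ) (E : Set V2) (t : ℝ) : Continuous fun x => PP g σ E t x :=
  Continuous.comp (g := fun z : ℝ × V2 => PP g σ E z.1 z.2) (f := fun x => (t, x)) (PP_cont g σ E) (by fun_prop)

lemma PP_measX (g : V2 → ℂ) (σ : ℝ) (E : Set V2) {X : ℝ → V2} (hX : Measurable X) :
    Measurable fun t => PP g σ E t (X t) :=
  Measurable.comp (g := fun z : ℝ × V2 => PP g σ E z.1 z.2) (f := fun t => (t, X t))
    (PP_cont g σ E).measurable (Measurable.prodMk measurable_id' hX)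

lemma PP_le_PS (g : V2 → ℂ) (σ : ℝ) (E : Set V2) (t : ℝ) (x : V2) : ‖PP g σ E t x‖ₑ ≤ PS g σ E t := by
  have hcl : IsClosed {x | ‖PP g σ E t x‖ₑ ≤ PS g σ E t} :=
    isClosed_le (PP_contx g σ E t).enorm continuous_const
  have hd : Dense (Set.range dq) := TopologicalSpace.denseRange_denseSeq V2
  have hsub : Set.range dq ⊆ {x | ‖PP g σ E t x‖ₑ ≤ PS g σ E t} := by
    rintro _ ⟨j, rfl⟩
    exact le_iSup (fun j => ‖PP g σ E t (dq j)‖ₑ) j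
  have := hcl.closure_subset_iff.2 hsub
  rw [hd.closure_eq] at this
  exact this (Set.mem_univ x)

open Classical in
def selx (g : V2 → ℂ) (σ : ℝ) (E : Set V2) : ℕ → ℝ → V2
  | 0, _ => dq 0
  | n + 1, t => if ‖PP g σ E t (selx g σ E n t)‖ₑ < ‖PP g σ E t (dq (n + 1))‖ₑ then dq (n + 1)
      else selx g σ E n t

lemma selx_meas (g : V2 → ℂ) (σ : ℝ) (E : Set V2) (n : ℕ) : Measurable (selx g σ E n) := by
  induction n with
  | zero => exact measurable_const
  | succ n ih =>
    have : selx g σ E (n + 1) = fun t =>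
      if ‖PP g σ E t (selx g σ E n t)‖ₑ < ‖PP g σ E t (dq (n + 1))‖ₑ then dq (n + 1)
      else selx g σ E n t := by ext1 t; rw [selx]
    rw [this]
    refine Measurable.ite ?_ measurable_const ih
    exact measurableSet_lt (PP_measX g σ E ih).enorm (PP_measX g σ E measurable_const).enorm

lemma selx_mono (g : V2 → ℂ) (σ : ℝ) (E : Set V2) (t : ℝ) :
    Monotone fun n => ‖PP g σ E t (selx g σ E n t)‖ₑ := by
  apply monotone_nat_of_le_succ
  intro n
  rw [selx.eq_2]
  split_ifs with h
  · exact h.le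
  · exact le_rfl

lemma selx_ge (g : V2 → ℂ) (σ : ℝ) (E : Set V2) (t : ℝ) (n : ℕ) :
    ‖PP g σ E t (dq n)‖ₑ ≤ ‖PP g σ E t (selx g σ E n t)‖ₑ := by
  cases n with
  | zero => rw [selx]
  | succ n =>
    rw [selx.eq_2]
    split_ifs with h
    · exact le_rfl
    · exact not_lt.1 h

lemma PS_eq (g : V2 → ℂ) (σ : ℝ) (E : Set V2) (t : ℝ) :
    PS g σ E t = ⨆ n, ‖PP g σ E t (selx g σ E n t)‖ₑ := by
  apply le_antisymm
  · exact iSup_mono fun n => selx_ge g σ E t n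
  · exact iSup_le fun n => PP_le_PS g σ E t _

lemma tt_sup : ∃ C : ℝ≥0∞, C ≠ ∞ ∧ ∀ (g : V2 → ℂ) (σ K : ℝ) (E : Set V2), 0 ≤ K → Measurable g →
    volume E ≠ ∞ →
    (∀ (t : ℝ) (x : V2), t ≠ 0 → ‖∫ ξ in E, ph σ t x ξ‖ ≤ K * |t| ^ (-(1 / 2) : ℝ)) →
      ∫⁻ t, PS g σ E t ^ 4 ≤ (C * ofReal K * ∫⁻ ξ in E, ‖g ξ‖ₑ ^ 2) ^ 2 := by
  obtain ⟨C, hC, H⟩ := ttstar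
  refine ⟨C, hC, ?_⟩
  intro g σ K E hK0 hg hEt hK
  have h1 : ∀ t, PS g σ E t ^ 4 = ⨆ n, ‖PP g σ E t (selx g σ E n t)‖ₑ ^ 4 := by
    intro t
    rw [PS_eq]
    exact Monotone.map_iSup_of_continuousAt (f := fun a : ℝ≥0∞ => a ^ 4)
      (ENNReal.continuous_pow 4).continuousAt (fun a b h => pow_le_pow_left₀ zero_le h 4) (by simp)
  rw [lintegral_congr h1, lintegral_iSup]
  · exact iSup_le fun n => H g σ K E hK0 hg hEt hK _ (selx_meas g σ E n)
  · intro n; exact (PP_measX g σ E (selx_meas g σ E n)).enorm.pow_const 4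
  · intro n m hnm t
    exact pow_le_pow_left' (selx_mono g σ E t hnm) 4

section
open scoped FourierTransform SchwartzMap ContDiff in
lemma planch_ae (H : V2 → ℂ) (h1 : Integrable H) (h2 : MemLp H 2) :
    ∀ᵐ x, (𝓕 H) x = (𝓕 (h2.toLp H) : Lp ℂ 2 (volume : Measure V2)) x := by
  apply ae_eq_of_integral_contDiff_smul_eq
  · apply Continuous.locallyIntegrable
    exact VectorFourier.fourierIntegral_continuous Real.continuous_fourierChar
      (by exact continuous_inner) h1
  · exact (Lp.memLp _).locallyIntegrable (by norm_num)
  intro g hg hgs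
  have hgc : ContDiff ℝ ∞ fun x => ((g x : ℝ) : ℂ) := Complex.ofRealCLM.contDiff.comp hg
  have hgcs : HasCompactSupport fun x => ((g x : ℝ) : ℂ) := hgs.comp_left (g := ((↑) : ℝ → ℂ)) (by simp)
  let G : 𝓢(V2, ℂ) := hgcs.toSchwartzMap hgc
  have hG : ∀ x, G x = g x := fun x => rfl
  have e1 : ∫ x, g x • (𝓕 (h2.toLp H) : Lp ℂ 2 (volume : Measure V2)) x =
      (Lp.toTemperedDistribution (𝓕 (h2.toLp H))) G := by
    rw [Lp.toTemperedDistribution_apply]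
    congr 1
  rw [e1, ← Lp.fourier_toTemperedDistribution_eq, TemperedDistribution.fourier_apply,
    Lp.toTemperedDistribution_apply]
  have e2 : ∫ x, (𝓕 G) x • (h2.toLp H) x = ∫ x, (𝓕 G) x • H x := by
    apply integral_congr_ae
    filter_upwards [h2.coeFn_toLp] with x hx
    rw [hx]
  rw [e2]
  have := VectorFourier.integral_fourierIntegral_smul_eq_flip (L := innerₗ V2) (μ := volume) (ν := volume)
    (f := fun x => G x) (g := H) Real.continuous_fourierChar (by exact continuous_inner) G.integrable h1
  rw [flip_innerₗ] at this
  exact this.symm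

open scoped FourierTransform in
lemma planch (H : V2 → ℂ) (h1 : Integrable H) : ∫⁻ x, ‖(𝓕 H) x‖ₑ ^ 2 ≤ ∫⁻ x, ‖H x‖ₑ ^ 2 := by
  by_cases hfin : ∫⁻ x, ‖H x‖ₑ ^ 2 = ∞
  · rw [hfin]; exact le_top
  have h2 : MemLp H 2 := by
    refine ⟨h1.aestronglyMeasurable, ?_⟩
    rw [eLpNorm_lt_top_iff_lintegral_rpow_enorm_lt_top (by norm_num) (by norm_num)]
    simpa using lt_top_iff_ne_top.2 hfin
  have e0 : ∀ F : Lp ℂ 2 (volume : Measure V2), ∫⁻ x, ‖F x‖ₑ ^ 2 = ‖F‖ₑ ^ 2 := by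
    intro F
    rw [Lp.enorm_def, eLpNorm_eq_lintegral_rpow_enorm_toReal (by norm_num) (by norm_num), ← ENNReal.rpow_natCast _ 2, ← erm]
    simp
  have e1 : ∫⁻ x, ‖(𝓕 H) x‖ₑ ^ 2 = ∫⁻ x, ‖(𝓕 (h2.toLp H) : Lp ℂ 2 (volume : Measure V2)) x‖ₑ ^ 2 := by
    apply lintegral_congr_ae
    filter_upwards [planch_ae H h1 h2] with x hx
    rw [hx]
  have e2 : ∫⁻ x, ‖H x‖ₑ ^ 2 = ∫⁻ x, ‖(h2.toLp H) x‖ₑ ^ 2 := by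
    apply lintegral_congr_ae
    filter_upwards [h2.coeFn_toLp] with x hx
    rw [hx]
  rw [e1, e2, e0, e0]
  apply le_of_eq
  congr 1
  rw [← ofReal_norm, ← ofReal_norm, Lp.norm_fourier_eq]

open scoped FourierTransform in
lemma bessel (H : V2 → ℂ) (h1 : Integrable H) :
    ∫⁻ x, ‖∫ ξ, Complex.exp (I * ((⟪x, ξ⟫ : ℝ) : ℂ)) * H ξ‖ₑ ^ 2 ≤
      ofReal ((2 * π) ^ 2) * ∫⁻ x, ‖H x‖ₑ ^ 2 := by
  set r : ℝ := -(2 * π)⁻¹ with hr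
  have hr0 : r ≠ 0 := by rw [hr]; have := Real.pi_pos; simp [this.ne']
  have e1 : ∀ x, ∫ ξ, Complex.exp (I * ((⟪x, ξ⟫ : ℝ) : ℂ)) * H ξ = (𝓕 H) (r • x) := by
    intro x
    rw [Real.fourier_eq']
    congr 1; ext ξ
    rw [smul_eq_mul, inner_smul_right, real_inner_comm]
    congr 2
    rw [hr]
    have := Real.pi_ne_zero
    push_cast
    field_simp
  simp_rw [e1]
  have hm : Measurable fun x => ‖(𝓕 H) x‖ₑ ^ 2 := by
    have : Continuous (𝓕 H) := VectorFourier.fourierIntegral_continuous Real.continuous_fourierChar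
      (by exact continuous_inner) h1
    exact this.measurable.enorm.pow_const 2
  rw [← lintegral_map hm (measurable_const_smul r), Measure.map_addHaar_smul _ hr0, lintegral_smul_measure]
  simp only [finrank_euclideanSpace, Fintype.card_fin, smul_eq_mul]
  have : |(r ^ 2)⁻¹| = (2 * π) ^ 2 := by
    rw [hr, abs_of_nonneg (by positivity)]; field_simp
  rw [this]
  exact mul_le_mul_right (planch H h1) _
end


lemma vol_box (μ : ℝ) (ζ : V2) : volume (box ζ μ) = ofReal (2 * μ) * ofReal (2 * μ) := by
  have : box ζ μ = eV ⁻¹' (Ioo (ζ 0 - μ) (ζ 0 + μ) ×ˢ Ioo (ζ 1 - μ) (ζ 1 + μ)) := by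
    ext ξ
    simp only [box, Set.mem_ofPred_eq, Set.mem_preimage, eV_apply, Set.mem_prod, Set.mem_Ioo, abs_lt]
    constructor
    · rintro ⟨⟨h1, h2⟩, h3, h4⟩; exact ⟨⟨by linarith, by linarith⟩, by linarith, by linarith⟩
    · rintro ⟨⟨h1, h2⟩, h3, h4⟩; exact ⟨⟨by linarith, by linarith⟩, by linarith, by linarith⟩
  rw [this, eV_mp.measure_preimage (measurableSet_Ioo.prod measurableSet_Ioo).nullMeasurableSet,
    Measure.volume_eq_prod, Measure.prod_prod, Real.volume_Ioo, Real.volume_Ioo]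
  congr 2 <;> ring

lemma mem_box_iff (ζ ξ : V2) (μ : ℝ) : ξ ∈ box ζ μ ↔ ζ - ξ ∈ box 0 μ := by
  simp only [box, Set.mem_ofPred_eq, PiLp.sub_apply, PiLp.zero_apply, sub_zero]
  rw [abs_sub_comm (ξ 0), abs_sub_comm (ξ 1)]

lemma box_norm {μ : ℝ} {η : V2} (h : η ∈ box 0 μ) : ‖η‖ ^ 2 ≤ 2 * μ ^ 2 := by
  simp only [box, Set.mem_ofPred_eq, PiLp.zero_apply, sub_zero] at h
  rw [EuclideanSpace.real_norm_sq_eq, Fin.sum_univ_two, ← sq_abs (η 0), ← sq_abs (η 1)]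
  have := abs_nonneg (η 0)
  have := abs_nonneg (η 1)
  nlinarith [h.1, h.2]

def bb (μ : ℝ) (y : V2) : ℂ := ∫ η, Complex.exp (I * ((⟪y, η⟫ : ℝ) : ℂ)) * (box 0 μ).indicator (fun _ => (1 : ℂ)) η

lemma bb_ge {μ c : ℝ} (hμ : 0 < μ) (hc : 0 < c) (h : μ * c ≤ 1 / 2) {y : V2} (hy : ‖y‖ < c) :
    2 * μ ^ 2 ≤ ‖bb μ y‖ := by
  have hvt : volume (box 0 μ) ≠ ∞ := by rw [vol_box]; finiteness
  have e1 : bb μ y = ∫ η in box 0 μ, Complex.exp (I * ((⟪y, η⟫ : ℝ) : ℂ)) := by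
    rw [bb, ← integral_indicator (meas_box 0 μ)]
    congr 1; ext η
    by_cases hη : η ∈ box 0 μ
    · simp [hη]
    · simp [hη]
  have hcont : Continuous fun η : V2 => Complex.exp (I * ((⟪y, η⟫ : ℝ) : ℂ)) := by fun_prop
  have hi : IntegrableOn (fun η : V2 => Complex.exp (I * ((⟪y, η⟫ : ℝ) : ℂ))) (box 0 μ) := by
    refine Measure.integrableOn_of_bounded (M := 1) hvt hcont.aestronglyMeasurable
      (of_forall fun η => ?_)
    rw [mul_comm, norm_exp_ofReal_mul_I]
  refine le_trans ?_ (Complex.re_le_norm _)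
  rw [e1]
  have e2 : (∫ η in box 0 μ, Complex.exp (I * ((⟪y, η⟫ : ℝ) : ℂ))).re =
      ∫ η in box 0 μ, Real.cos ⟪y, η⟫ := by
    refine (integral_re hi).symm.trans ?_
    congr 1; ext η
    rw [mul_comm]
    exact Complex.exp_ofReal_mul_I_re _
  rw [e2]
  have e3 : ∫ _ in box 0 μ, (1 / 2 : ℝ) = 2 * μ ^ 2 := by
    rw [setIntegral_const, measureReal_def, vol_box, ← ofReal_mul (by positivity),
      ENNReal.toReal_ofReal (by positivity), smul_eq_mul]; ring
  rw [← e3]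
  refine setIntegral_mono_on (integrableOn_const hvt) ?_ (meas_box 0 μ) ?_
  · refine Measure.integrableOn_of_bounded (M := 1) hvt ?_ (of_forall fun η => ?_)
    · exact (by fun_prop : Continuous fun η : V2 => Real.cos ⟪y, η⟫).aestronglyMeasurable
    · exact Real.abs_cos_le_one _
  · intro η hη
    have h1 := Real.one_sub_sq_div_two_le_cos (x := ⟪y, η⟫)
    have h2 := box_norm hη
    have h3 : ⟪y, η⟫ ^ 2 ≤ ‖y‖ ^ 2 * ‖η‖ ^ 2 := by
      rw [← mul_pow, ← sq_abs]
      exact pow_le_pow_left₀ (abs_nonneg _) (abs_real_inner_le_norm y η) 2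
    have h4 : ‖y‖ ^ 2 * ‖η‖ ^ 2 ≤ c ^ 2 * (2 * μ ^ 2) := by
      gcongr
    have h5 : c ^ 2 * (2 * μ ^ 2) ≤ 1 / 2 := by
      have : 0 ≤ μ * c := by positivity
      nlinarith
    linarith

lemma fub_box {h : V2 → ℂ} (hh : Integrable h) (μ : ℝ) :
    Integrable (fun ζ => ∫ ξ in box ζ μ, h ξ) ∧ ∀ y : V2,
      ∫ ζ, Complex.exp (I * ((⟪y, ζ⟫ : ℝ) : ℂ)) * ∫ ξ in box ζ μ, h ξ =
      bb μ y * ∫ ξ, Complex.exp (I * ((⟪y, ξ⟫ : ℝ) : ℂ)) * h ξ := by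
  set k : V2 → ℂ := (box 0 μ).indicator (fun _ => (1 : ℂ)) with hk
  have hvt : volume (box 0 μ) ≠ ∞ := by rw [vol_box]; finiteness
  have hki : Integrable k := (integrable_indicator_iff (meas_box 0 μ)).2 (integrableOn_const hvt)
  have hF : Integrable (fun p : V2 × V2 => h p.2 * k (p.1 - p.2)) (volume.prod volume) :=
    hh.convolution_integrand (ContinuousLinearMap.mul ℝ ℂ) hki
  have e1 : ∀ ζ, ∫ ξ in box ζ μ, h ξ = ∫ ξ, h ξ * k (ζ - ξ) := by
    intro ζ
    rw [← integral_indicator (meas_box ζ μ)]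
    congr 1; ext ξ
    rw [hk]
    by_cases hξ : ξ ∈ box ζ μ
    · rw [indicator_of_mem hξ, indicator_of_mem ((mem_box_iff _ _ _).1 hξ), mul_one]
    · rw [indicator_of_notMem hξ, indicator_of_notMem (fun h' => hξ ((mem_box_iff _ _ _).2 h')), mul_zero]
  simp_rw [e1]
  refine ⟨hF.integral_prod_left, fun y => ?_⟩
  have hF2 : Integrable (Function.uncurry fun ζ ξ : V2 => Complex.exp (I * ((⟪y, ζ⟫ : ℝ) : ℂ)) * (h ξ * k (ζ - ξ)))
      (volume.prod volume) := by
    refine Integrable.bdd_mul (c := 1) (f := fun p : V2 × V2 => Complex.exp (I * ((⟪y, p.1⟫ : ℝ) : ℂ))) hF ?_ ?_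
    · exact (by fun_prop : Continuous fun p : V2 × V2 => Complex.exp (I * ((⟪y, p.1⟫ : ℝ) : ℂ))).aestronglyMeasurable
    · refine of_forall fun p => ?_
      rw [mul_comm, norm_exp_ofReal_mul_I]
  calc ∫ ζ, Complex.exp (I * ((⟪y, ζ⟫ : ℝ) : ℂ)) * ∫ ξ, h ξ * k (ζ - ξ)
      = ∫ ζ, ∫ ξ, Complex.exp (I * ((⟪y, ζ⟫ : ℝ) : ℂ)) * (h ξ * k (ζ - ξ)) := by
        congr 1; ext ζ; rw [integral_const_mul]
    _ = ∫ ξ, ∫ ζ, Complex.exp (I * ((⟪y, ζ⟫ : ℝ) : ℂ)) * (h ξ * k (ζ - ξ)) := integral_integral_swap hF2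
    _ = ∫ ξ, bb μ y * (Complex.exp (I * ((⟪y, ξ⟫ : ℝ) : ℂ)) * h ξ) := by
        congr 1; ext ξ
        rw [← integral_add_right_eq_self _ ξ, bb, ← integral_mul_const]
        congr 1; ext η
        rw [add_sub_cancel_right, inner_add_right]
        push_cast
        rw [mul_add, Complex.exp_add]; ring
    _ = _ := integral_const_mul _ _

lemma locL2 (g : V2 → ℂ) (hg : Integrable g) (σ t : ℝ) (x : V2) {μ c : ℝ} (hμ : 0 < μ) (hc : 0 < c) (h : μ * c ≤ 1 / 2) :
    ∫⁻ y, (if ‖x - y‖ < c then 1 else 0) * ‖PP g σ univ t y‖ₑ ^ 2 ≤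
      ofReal (π ^ 2 * μ⁻¹ ^ 4) * ∫⁻ ζ, ‖PP g σ (box ζ μ) t x‖ₑ ^ 2 := by
  have hh : Integrable fun ξ => ph σ t x ξ * g ξ := by
    have := PP_int (E := univ) (σ := σ) hg.integrableOn t x
    rwa [integrableOn_univ] at this
  obtain ⟨hi, hF⟩ := fub_box hh μ
  have hB := bessel _ hi
  simp_rw [hF] at hB
  have e1 : ∀ y, ∫ ξ, Complex.exp (I * ((⟪y, ξ⟫ : ℝ) : ℂ)) * (ph σ t x ξ * g ξ) = PP g σ univ t (x + y) := by
    intro y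
    rw [PP, setIntegral_univ]
    congr 1; ext ξ
    rw [← mul_assoc]; congr 1
    rw [ph, ph, ← Complex.exp_add, inner_add_left]
    congr 1; push_cast; ring
  simp_rw [e1] at hB
  have e2 : ∫⁻ y, (if ‖x - y‖ < c then 1 else 0) * ‖PP g σ univ t y‖ₑ ^ 2 =
      ∫⁻ y, (if ‖y‖ < c then 1 else 0) * ‖PP g σ univ t (x + y)‖ₑ ^ 2 := by
    rw [← lintegral_add_left_eq_self _ x]
    simp
  have e3 : ofReal ((2 * μ ^ 2) ^ 2) * ∫⁻ y, (if ‖y‖ < c then 1 else 0) * ‖PP g σ univ t (x + y)‖ₑ ^ 2 ≤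
      ∫⁻ y, ‖bb μ y * PP g σ univ t (x + y)‖ₑ ^ 2 := by
    rw [← lintegral_const_mul' _ _ ofReal_ne_top]
    apply lintegral_mono; intro y
    simp only
    split_ifs with hy
    · rw [one_mul, enorm_mul, ENNReal.ofReal_pow (by positivity), mul_pow ‖bb μ y‖ₑ]
      gcongr
      rw [← ofReal_norm]
      exact ofReal_le_ofReal (bb_ge hμ hc h hy)
    · simp
  have e4 := e3.trans hB
  rw [e2]
  set L := ∫⁻ y, (if ‖y‖ < c then 1 else 0) * ‖PP g σ univ t (x + y)‖ₑ ^ 2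
  have e5 : L = ofReal (((2 * μ ^ 2) ^ 2)⁻¹) * (ofReal ((2 * μ ^ 2) ^ 2) * L) := by
    rw [← mul_assoc, ← ofReal_mul (by positivity), inv_mul_cancel₀ (by positivity), ENNReal.ofReal_one, one_mul]
  rw [e5]
  refine (mul_le_mul_right e4 _).trans_eq ?_
  rw [← mul_assoc, ← ofReal_mul (by positivity)]
  congr 2
  field_simp

lemma meas_boxset (l : ℝ) : MeasurableSet {z : ((ℝ × V2) × (ℝ × V2)) × V2 | z.2 ∈ box z.1.2.2 z.1.2.1 ∩ ann l} := by
  have h1 : MeasurableSet {z : ((ℝ × V2) × (ℝ × V2)) × V2 | |z.2 0 - z.1.2.2 0| < z.1.2.1} := by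
    apply measurableSet_lt <;> fun_prop
  have h2 : MeasurableSet {z : ((ℝ × V2) × (ℝ × V2)) × V2 | |z.2 1 - z.1.2.2 1| < z.1.2.1} := by
    apply measurableSet_lt <;> fun_prop
  have h3 : MeasurableSet {z : ((ℝ × V2) × (ℝ × V2)) × V2 | z.2 ∈ ann l} := measurable_snd (meas_ann l)
  have : {z : ((ℝ × V2) × (ℝ × V2)) × V2 | z.2 ∈ box z.1.2.2 z.1.2.1 ∩ ann l} =
    ({z | |z.2 0 - z.1.2.2 0| < z.1.2.1} ∩ {z | |z.2 1 - z.1.2.2 1| < z.1.2.1}) ∩ {z | z.2 ∈ ann l} := by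
    ext z; simp [box]
  rw [this]
  exact (h1.inter h2).inter h3

open Classical in
lemma PPm {g : V2 → ℂ} (hg : Measurable g) (σ l : ℝ) :
    Measurable fun w : (ℝ × V2) × (ℝ × V2) => PP g σ (box w.2.2 w.2.1 ∩ ann l) w.1.1 w.1.2 := by
  have e : ∀ w : (ℝ × V2) × (ℝ × V2), PP g σ (box w.2.2 w.2.1 ∩ ann l) w.1.1 w.1.2 =
      ∫ ξ, if ξ ∈ box w.2.2 w.2.1 ∩ ann l then ph σ w.1.1 w.1.2 ξ * g ξ else 0 := by
    intro w
    rw [PP, ← integral_indicator ((meas_box _ _).inter (meas_ann l))]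
    congr 1; ext ξ
    rw [Set.indicator_apply]
  simp_rw [e]
  have hm : Measurable fun z : ((ℝ × V2) × (ℝ × V2)) × V2 =>
      if z.2 ∈ box z.1.2.2 z.1.2.1 ∩ ann l then ph σ z.1.1.1 z.1.1.2 z.2 * g z.2 else 0 := by
    refine Measurable.ite (meas_boxset l) ?_ measurable_const
    refine Measurable.mul ?_ (hg.comp measurable_snd)
    exact Measurable.comp (g := fun z : (ℝ × V2) × V2 => ph σ z.1.1 z.1.2 z.2)
      (f := fun z : ((ℝ × V2) × (ℝ × V2)) × V2 => (z.1.1, z.2)) (ph_cont σ).measurable (by fun_prop)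
  exact (StronglyMeasurable.integral_prod_right (f := fun (w : (ℝ × V2) × (ℝ × V2)) (ξ : V2) =>
    if ξ ∈ box w.2.2 w.2.1 ∩ ann l then ph σ w.1.1 w.1.2 ξ * g ξ else 0) hm.stronglyMeasurable).measurable

lemma PSm {g : V2 → ℂ} (hg : Measurable g) (σ l : ℝ) :
    Measurable fun w : ℝ × (ℝ × V2) => PS g σ (box w.2.2 w.2.1 ∩ ann l) w.1 := by
  refine Measurable.iSup fun j => ?_
  exact (Measurable.comp (g := fun w : (ℝ × V2) × (ℝ × V2) => PP g σ (box w.2.2 w.2.1 ∩ ann l) w.1.1 w.1.2)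
    (f := fun w : ℝ × (ℝ × V2) => ((w.1, dq j), w.2)) (PPm hg σ l) (by fun_prop)).enorm

def NN (g : V2 → ℂ) (σ μ l t : ℝ) (x : V2) : ℝ≥0∞ := ∫⁻ ζ, ‖PP g σ (box ζ μ ∩ ann l) t x‖ₑ ^ 2

def NS (g : V2 → ℂ) (σ μ l t : ℝ) : ℝ≥0∞ := ∫⁻ ζ, PS g σ (box ζ μ ∩ ann l) t ^ 2

def BB (g : V2 → ℂ) (E : Set V2) : ℝ≥0∞ := ∫⁻ ξ in E, ‖g ξ‖ₑ ^ 2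

lemma NN_meas {g : V2 → ℂ} (hg : Measurable g) (σ l : ℝ) :
    Measurable fun z : (ℝ × V2) × ℝ => NN g σ z.2 l z.1.1 z.1.2 := by
  refine Measurable.lintegral_prod_right' (f := fun z : ((ℝ × V2) × ℝ) × V2 => ‖PP g σ (box z.2 z.1.2 ∩ ann l) z.1.1.1 z.1.1.2‖ₑ ^ 2) ?_
  exact (Measurable.comp (g := fun w : (ℝ × V2) × (ℝ × V2) => PP g σ (box w.2.2 w.2.1 ∩ ann l) w.1.1 w.1.2)
    (f := fun z : ((ℝ × V2) × ℝ) × V2 => (z.1.1, (z.1.2, z.2))) (PPm hg σ l) (by fun_prop)).enorm.pow_const 2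

lemma BB_box {g : V2 → ℂ} (hg : Measurable g) {μ : ℝ} (hμ : 0 < μ) (l : ℝ) :
    ∫⁻ ζ, BB g (box ζ μ ∩ ann l) = ofReal (4 * μ ^ 2) * BB g (ann l) := by
  classical
  have e1 : ∀ ζ, BB g (box ζ μ ∩ ann l) = ∫⁻ ξ in ann l, if ζ ∈ box ξ μ then ‖g ξ‖ₑ ^ 2 else 0 := by
    intro ζ
    rw [BB, ← Measure.restrict_restrict (meas_box ζ μ), ← lintegral_indicator (meas_box ζ μ)]
    apply lintegral_congr; intro ξ
    rw [Set.indicator_apply]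
    have : ξ ∈ box ζ μ ↔ ζ ∈ box ξ μ := by
      simp only [box, Set.mem_ofPred_eq]; rw [abs_sub_comm, abs_sub_comm (ξ 1)]
    simp only [this]
  simp_rw [e1]
  have hms : MeasurableSet {z : V2 × V2 | z.1 ∈ box z.2 μ} := by
    have h1 : MeasurableSet {z : V2 × V2 | |z.1 0 - z.2 0| < μ} := by
      apply measurableSet_lt <;> fun_prop
    have h2 : MeasurableSet {z : V2 × V2 | |z.1 1 - z.2 1| < μ} := by
      apply measurableSet_lt <;> fun_prop
    have : {z : V2 × V2 | z.1 ∈ box z.2 μ} = {z | |z.1 0 - z.2 0| < μ} ∩ {z | |z.1 1 - z.2 1| < μ} := by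
      ext z; simp [box]
    rw [this]; exact h1.inter h2
  rw [lintegral_lintegral_swap]
  · rw [BB, ← lintegral_const_mul' _ _ ofReal_ne_top]
    apply lintegral_congr; intro ξ
    have : ∀ ζ, (if ζ ∈ box ξ μ then ‖g ξ‖ₑ ^ 2 else 0) = (box ξ μ).indicator (fun _ => ‖g ξ‖ₑ ^ 2) ζ := fun ζ => by
      rw [Set.indicator_apply]
    rw [lintegral_congr this, lintegral_indicator (meas_box ξ μ), setLIntegral_const, vol_box,
      ← ofReal_mul (by positivity), mul_comm]
    congr 2; ring
  · exact (Measurable.ite hms ((hg.comp measurable_snd).enorm.pow_const 2) measurable_const).aemeasurable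

lemma NS_L2 : ∃ C : ℝ≥0∞, C ≠ ∞ ∧ ∀ (g : V2 → ℂ) (σ μ l : ℝ), (σ = 1 ∨ σ = -1) → Measurable g → 0 < μ → 0 < l →
    ∫⁻ t, NS g σ μ l t ^ 2 ≤ (C * ofReal (min μ l * √l * μ ^ 2) * BB g (ann l)) ^ 2 := by
  obtain ⟨C, hC, H⟩ := tt_sup
  refine ⟨C * ofReal 960, by finiteness, ?_⟩
  intro g σ μ l hσ hg hμ hl
  have hm := mink (volume : Measure ℝ) (volume : Measure V2) (p := 2) (by norm_num) (F := fun t ζ => PS g σ (box ζ μ ∩ ann l) t ^ 2)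
    ((Measurable.comp (g := fun w : ℝ × (ℝ × V2) => PS g σ (box w.2.2 w.2.1 ∩ ann l) w.1)
      (f := fun z : ℝ × V2 => (z.1, (μ, z.2))) (PSm hg σ l) (by fun_prop)).pow_const 2)
  have hb : ∀ ζ, (∫⁻ t, (PS g σ (box ζ μ ∩ ann l) t ^ 2) ^ (2 : ℝ)) ^ (1 / 2 : ℝ) ≤
      C * ofReal (240 * min μ l * √l) * BB g (box ζ μ ∩ ann l) := by
    intro ζ
    have h1 := H g σ (240 * min μ l * √l) (box ζ μ ∩ ann l) (by have := le_min hμ.le hl.le; positivity) hg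
      (ne_top_of_le_ne_top (vol_ann_lt_top l).ne (measure_mono Set.inter_subset_right)) ?_
    · have h2 := erl h1 (by norm_num : (0 : ℝ) ≤ 1 / 2)
      rw [← ENNReal.rpow_natCast _ 2, ← erm] at h2
      norm_num at h2
      refine le_trans (le_of_eq ?_) h2
      congr 1; norm_num
      apply lintegral_congr; intro t
      rw [← pow_mul]
    · intro t x ht
      have h3 := kernel_bound hl hμ (t := σ * t) (by rcases hσ with h | h <;> simp [h, ht]) ζ x
      have h4 : |σ * t| = |t| := by rcases hσ with h | h <;> simp [h]
      rw [h4] at h3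
      exact h3
  have h5 := hm.trans (lintegral_mono hb)
  rw [lintegral_const_mul' _ _ (by finiteness), BB_box hg hμ] at h5
  have h7 : C * ofReal (240 * min μ l * √l) * (ofReal (4 * μ ^ 2) * BB g (ann l)) =
      C * ofReal 960 * ofReal (min μ l * √l * μ ^ 2) * BB g (ann l) := by
    have e : ofReal (240 * min μ l * √l) * ofReal (4 * μ ^ 2) =
        ofReal 960 * ofReal (min μ l * √l * μ ^ 2) := by
      rw [← ENNReal.ofReal_mul' (by positivity), ← ofReal_mul (by norm_num)]
      congr 1; ring
    calc _ = C * (ofReal (240 * min μ l * √l) * ofReal (4 * μ ^ 2)) * BB g (ann l) := by ring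
      _ = _ := by rw [e]; ring
  rw [h7] at h5
  generalize C * ofReal 960 * ofReal (min μ l * √l * μ ^ 2) * BB g (ann l) = Z at h5 ⊢
  have h6 := erl h5 (by norm_num : (0 : ℝ) ≤ 2)
  rw [← erm] at h6
  norm_num at h6
  exact h6

lemma vol_ann_le {l : ℝ} (hl : 0 < l) : volume (ann l) ≤ ofReal (16 * l ^ 2) := by
  have : ann l ⊆ box 0 (2 * l) := by
    intro ξ h
    simp only [ann, box, Set.mem_ofPred_eq, PiLp.zero_apply, sub_zero] at h ⊢
    exact ⟨(le_max_left _ _).trans_lt h.2, (le_max_right _ _).trans_lt h.2⟩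
  refine (measure_mono this).trans ?_
  rw [vol_box, ← ofReal_mul (by positivity)]
  apply ofReal_le_ofReal; nlinarith

lemma NN_sup {g : V2 → ℂ} (hg : Measurable g) (σ : ℝ) {μ l : ℝ} (hμ : 0 < μ) (hl : 0 < l) (t : ℝ) (x : V2) :
    NN g σ μ l t x ≤ ofReal (64 * (min μ l) ^ 2 * μ ^ 2) * BB g (ann l) := by
  have hm0 : 0 < min μ l := lt_min hμ hl
  have h1 : ∀ ζ, ‖PP g σ (box ζ μ ∩ ann l) t x‖ₑ ^ 2 ≤ ofReal (16 * min μ l ^ 2) * BB g (box ζ μ ∩ ann l) := by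
    intro ζ
    have hv : volume (box ζ μ ∩ ann l) ≤ ofReal (16 * min μ l ^ 2) := by
      rcases le_total μ l with h | h
      · rw [min_eq_left h]
        refine (measure_mono Set.inter_subset_left).trans ?_
        rw [vol_box, ← ofReal_mul (by positivity)]
        apply ofReal_le_ofReal; nlinarith
      · rw [min_eq_right h]
        exact (measure_mono Set.inter_subset_right).trans (vol_ann_le hl)
    have h2 : ‖PP g σ (box ζ μ ∩ ann l) t x‖ₑ ≤ ∫⁻ ξ in box ζ μ ∩ ann l, ‖g ξ‖ₑ := by
      refine (enorm_integral_le_lintegral_enorm _).trans_eq ?_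
      apply lintegral_congr; intro ξ
      rw [enorm_mul, ← ofReal_norm, ph_norm]; simp
    have h3 := ENNReal.lintegral_mul_le_Lp_mul_Lq (volume.restrict (box ζ μ ∩ ann l)) (p := 2) (q := 2)
      (by constructor <;> norm_num) (f := fun _ => (1:ℝ≥0∞)) (g := fun ξ : V2 => ‖g ξ‖ₑ) aemeasurable_const hg.enorm.aemeasurable
    have h4 := erl (h2.trans ((lintegral_congr fun ξ => (by simp [Pi.mul_apply] : ‖g ξ‖ₑ = ((fun _ => (1:ℝ≥0∞)) * (fun ξ : V2 => ‖g ξ‖ₑ) : V2 → ℝ≥0∞) ξ)).le.trans h3)) (by norm_num : (0 : ℝ) ≤ 2)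
    rw [mul_rpow_of_nonneg _ _ (by norm_num), ← erm, ← erm] at h4
    norm_num at h4
    refine h4.trans ?_
    gcongr
    exact le_rfl
  refine (lintegral_mono h1).trans_eq ?_
  rw [lintegral_const_mul' _ _ (by finiteness), BB_box hg hμ, ← mul_assoc, ← ofReal_mul (by positivity)]
  congr 2; ring

lemma NN_le_NS (g : V2 → ℂ) (σ μ l t : ℝ) (x : V2) : NN g σ μ l t x ≤ NS g σ μ l t :=
  lintegral_mono fun _ => pow_le_pow_left₀ zero_le (PP_le_PS g σ _ t x) 2

lemma NN_int {g : V2 → ℂ} (hg : Measurable g) (hgi : Integrable g) (σ : ℝ) {μ l : ℝ} (hμ : 0 < μ) (t : ℝ) :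
    ∫⁻ x, NN g σ μ l t x ≤ ofReal (16 * π ^ 2 * μ ^ 2) * BB g (ann l) := by
  unfold NN
  rw [lintegral_lintegral_swap]
  · have h1 : ∀ ζ, ∫⁻ x, ‖PP g σ (box ζ μ ∩ ann l) t x‖ₑ ^ 2 ≤ ofReal ((2 * π) ^ 2) * BB g (box ζ μ ∩ ann l) := by
      intro ζ
      have hE : MeasurableSet (box ζ μ ∩ ann l) := (meas_box _ _).inter (meas_ann l)
      have hi : Integrable ((box ζ μ ∩ ann l).indicator fun ξ => ph σ t 0 ξ * g ξ) :=
        (integrable_indicator_iff hE).2 (PP_int hgi.integrableOn t 0)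
      refine le_trans (le_of_eq ?_) ((bessel _ hi).trans_eq ?_)
      · apply lintegral_congr; intro x
        congr 2
        rw [PP, ← integral_indicator hE]
        congr 1; ext ξ
        by_cases h : ξ ∈ box ζ μ ∩ ann l
        · rw [indicator_of_mem h, indicator_of_mem h, ← mul_assoc]
          congr 1
          rw [ph, ph, ← Complex.exp_add, inner_zero_left]
          congr 1; push_cast; ring
        · rw [indicator_of_notMem h, indicator_of_notMem h, mul_zero]
      · congr 1
        rw [BB, ← lintegral_indicator hE]
        apply lintegral_congr; intro ξ
        by_cases h : ξ ∈ box ζ μ ∩ ann l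
        · rw [indicator_of_mem h, indicator_of_mem h, enorm_mul, ← ofReal_norm, ph_norm]; simp
        · rw [indicator_of_notMem h, indicator_of_notMem h]; simp
    refine (lintegral_mono h1).trans_eq ?_
    rw [lintegral_const_mul' _ _ (by finiteness), BB_box hg hμ, ← mul_assoc, ← ofReal_mul (by positivity)]
    congr 2; ring
  · exact ((Measurable.comp (g := fun w : (ℝ × V2) × (ℝ × V2) => PP g σ (box w.2.2 w.2.1 ∩ ann l) w.1.1 w.1.2)
      (f := fun z : V2 × V2 => ((t, z.1), (μ, z.2))) (PPm hg σ l) (by fun_prop)).enorm.pow_const 2).aemeasurable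

lemma interp_mixed {p Q : ℝ} (hp : 0 < p) (hQ : 1 < Q) (hg : 0 ≤ 1 - 1 / Q - 2 / p)
    (N : ℝ → V2 → ℝ≥0∞) (S : ℝ → ℝ≥0∞) (hS : Measurable S) (M1 M3 K : ℝ≥0∞)
    (hN : ∀ t, Measurable (N t))
    (h1 : ∀ t x, N t x ≤ S t) (h2 : ∀ t x, N t x ≤ M3) (h3 : ∀ t, ∫⁻ x, N t x ≤ M1)
    (h4 : ∫⁻ t, S t ^ 2 ≤ K ^ 2) :
    (∫⁻ t, (∫⁻ x, N t x ^ Q) ^ (p / Q)) ^ (1 / p) ≤ K ^ (2 / p) * M3 ^ (1 - 1 / Q - 2 / p) * M1 ^ (1 / Q) := by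
  have hQ0 : 0 < Q := by linarith
  have hgp : 0 ≤ p - p / Q - 2 := by
    have := mul_nonneg hp.le hg
    have e : p * (1 - 1 / Q - 2 / p) = p - p / Q - 2 := by field_simp
    linarith
  have hA : ∀ t, (∫⁻ x, N t x ^ Q) ^ (p / Q) ≤ S t ^ 2 * (M3 ^ (p - p / Q - 2) * M1 ^ (p / Q)) := by
    intro t
    have a1 : ∫⁻ x, N t x ^ Q ≤ (min (S t) M3) ^ (Q - 1) * M1 := by
      calc ∫⁻ x, N t x ^ Q = ∫⁻ x, N t x ^ (Q - 1) * N t x := by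
            apply lintegral_congr; intro x
            nth_rewrite 3 [← ENNReal.rpow_one (N t x)]
            rw [← ENNReal.rpow_add_of_nonneg _ _ (by linarith) (by norm_num)]
            congr 1; ring
        _ ≤ ∫⁻ x, (min (S t) M3) ^ (Q - 1) * N t x := by
            apply lintegral_mono; intro x
            exact mul_le_mul_left (erl (le_min (h1 t x) (h2 t x)) (by linarith)) _
        _ = (min (S t) M3) ^ (Q - 1) * ∫⁻ x, N t x := lintegral_const_mul _ (hN t)
        _ ≤ _ := mul_le_mul_right (h3 t) _
    calc (∫⁻ x, N t x ^ Q) ^ (p / Q) ≤ ((min (S t) M3) ^ (Q - 1) * M1) ^ (p / Q) := erl a1 (by positivity)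
      _ = (min (S t) M3) ^ (2 + (p - p / Q - 2)) * M1 ^ (p / Q) := by
          rw [mul_rpow_of_nonneg _ _ (by positivity), ← erm]
          congr 2; field_simp; ring
      _ = (min (S t) M3) ^ (2 : ℝ) * (min (S t) M3) ^ (p - p / Q - 2) * M1 ^ (p / Q) := by
          rw [ENNReal.rpow_add_of_nonneg _ _ (by norm_num) hgp]
      _ ≤ S t ^ (2 : ℝ) * M3 ^ (p - p / Q - 2) * M1 ^ (p / Q) := by
          gcongr
          · exact min_le_left _ _
          · exact min_le_right _ _
      _ = _ := by rw [mul_assoc]; norm_num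
  have hB := erl ((lintegral_mono hA).trans ((lintegral_mul_const _ (hS.pow_const 2)).le.trans
    (mul_le_mul_left h4 _))) (by positivity : 0 ≤ 1 / p)
  refine hB.trans_eq ?_
  rw [mul_rpow_of_nonneg _ _ (by positivity), mul_rpow_of_nonneg _ _ (by positivity),
    ← ENNReal.rpow_natCast, ← erm, ← erm, ← erm, mul_assoc]
  congr 2
  · congr 1; push_cast; ring
  · congr 1; field_simp
  · congr 1; field_simp

lemma NS_meas {g : V2 → ℂ} (hg : Measurable g) (σ μ l : ℝ) : Measurable fun t => NS g σ μ l t := by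
  refine Measurable.lintegral_prod_right' (f := fun z : ℝ × V2 => PS g σ (box z.2 μ ∩ ann l) z.1 ^ 2) ?_
  exact (Measurable.comp (g := fun w : ℝ × (ℝ × V2) => PS g σ (box w.2.2 w.2.1 ∩ ann l) w.1)
      (f := fun z : ℝ × V2 => (z.1, (μ, z.2))) (PSm hg σ l) (by fun_prop)).pow_const 2

lemma NN_mixed {p Q : ℝ} (hp : 0 < p) (hQ : 1 < Q) (hg0 : 0 ≤ 1 - 1 / Q - 2 / p) :
    ∃ C : ℝ≥0∞, C ≠ ∞ ∧ ∀ (g : V2 → ℂ) (σ μ l : ℝ), (σ = 1 ∨ σ = -1) → Measurable g → Integrable g → 0 < μ → 0 < l →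
    (∫⁻ t, (∫⁻ x, NN g σ μ l t x ^ Q) ^ (p / Q)) ^ (1 / p) ≤
      C * ofReal (μ ^ 2 * l ^ (1 / p) * min μ l ^ (2 - 2 / Q - 2 / p)) * BB g (ann l) := by
  obtain ⟨C, hC, H⟩ := NS_L2
  have hQ0 : 0 < Q := by linarith
  refine ⟨C ^ (2 / p) * ofReal 64 ^ (1 - 1 / Q - 2 / p) * ofReal (16 * π ^ 2) ^ (1 / Q), ?_, ?_⟩
  · have := rpow_ne_top_of_nonneg (by positivity : 0 ≤ 2 / p) hC
    have h2 := rpow_ne_top_of_nonneg hg0 (ofReal_ne_top (r := 64))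
    have h3 := rpow_ne_top_of_nonneg (by positivity : 0 ≤ 1 / Q) (ofReal_ne_top (r := 16 * π ^ 2))
    finiteness
  intro g σ μ l hσ hg hgi hμ hl
  have hm : 0 < min μ l := lt_min hμ hl
  have hN : ∀ t, Measurable fun x => NN g σ μ l t x := fun t =>
    Measurable.comp (g := fun z : (ℝ × V2) × ℝ => NN g σ z.2 l z.1.1 z.1.2) (f := fun x : V2 => ((t, x), μ)) (NN_meas hg σ l) (by fun_prop)
  refine (interp_mixed hp hQ hg0 (fun t x => NN g σ μ l t x) (fun t => NS g σ μ l t) (NS_meas hg σ μ l) _ _ _ hN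
    (NN_le_NS g σ μ l) (NN_sup hg σ hμ hl) (NN_int hg hgi σ hμ) (H g σ μ l hσ hg hμ hl)).trans_eq ?_
  generalize min μ l = m at hm ⊢
  generalize BB g (ann l) = B
  have e1 : C * ofReal (m * √l * μ ^ 2) * B = C * ofReal (m * √l) * (ofReal (μ ^ 2) * B) := by
    rw [ofReal_mul (by positivity)]; ring
  have e2 : ofReal (64 * m ^ 2 * μ ^ 2) * B = ofReal 64 * ofReal (m ^ 2) * (ofReal (μ ^ 2) * B) := by
    rw [ofReal_mul (by positivity), ofReal_mul (by positivity)]; ring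
  have e3 : ofReal (16 * π ^ 2 * μ ^ 2) * B = ofReal (16 * π ^ 2) * (ofReal (μ ^ 2) * B) := by
    rw [ofReal_mul (by positivity)]; ring
  rw [e1, e2, e3]
  have e4 : ofReal (μ ^ 2 * l ^ (1 / p) * m ^ (2 - 2 / Q - 2 / p)) * B =
      ofReal (m * √l) ^ (2 / p) * ofReal (m ^ 2) ^ (1 - 1 / Q - 2 / p) * (ofReal (μ ^ 2) * B) := by
    rw [ENNReal.ofReal_rpow_of_nonneg (by positivity) (by positivity), ENNReal.ofReal_rpow_of_nonneg (by positivity) hg0,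
      ← ofReal_mul (by positivity), ← mul_assoc, ← ofReal_mul (by positivity)]
    congr 2
    rw [Real.mul_rpow hm.le (by positivity), Real.sqrt_eq_rpow, ← Real.rpow_mul hl.le, ← Real.rpow_natCast m 2, ← Real.rpow_mul hm.le,
      show (2 - 2 / Q - 2 / p) = 2 / p + ((2 : ℕ) : ℝ) * (1 - 1 / Q - 2 / p) by push_cast; ring, Real.rpow_add hm]
    rw [show 1 / 2 * (2 / p) = 1 / p by ring]
    ring
  rw [mul_assoc _ (ofReal _) B, e4]
  generalize ofReal (μ ^ 2) * B = R
  have e5 : R = R ^ (2 / p) * R ^ (1 - 1 / Q - 2 / p) * R ^ (1 / Q) := by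
    rw [← ENNReal.rpow_add_of_nonneg _ _ (by positivity) hg0, ← ENNReal.rpow_add_of_nonneg _ _ (by have : 0 ≤ 2 / p := by positivity
                                                                                                   linarith) (by positivity)]
    rw [show 2 / p + (1 - 1 / Q - 2 / p) + 1 / Q = 1 by ring, ENNReal.rpow_one]
  rw [mul_rpow_of_nonneg _ _ (by positivity), mul_rpow_of_nonneg _ _ (by positivity),
    mul_rpow_of_nonneg _ _ hg0, mul_rpow_of_nonneg _ _ hg0, mul_rpow_of_nonneg _ _ (by positivity)]
  nth_rewrite 4 [e5]
  ring

def MX (p Q : ℝ) (F : ℝ → V2 → ℝ≥0∞) : ℝ≥0∞ := (∫⁻ t, (∫⁻ x, F t x ^ Q) ^ (p / Q)) ^ (1 / p)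

lemma MX_mono {p Q : ℝ} (hp : 0 < p) (hQ : 0 < Q) {F G : ℝ → V2 → ℝ≥0∞} (h : ∀ t x, F t x ≤ G t x) : MX p Q F ≤ MX p Q G := by
  unfold MX
  refine erl (lintegral_mono fun t => erl (lintegral_mono fun x => erl (h t x) hQ.le) ?_) ?_ <;> positivity

lemma MX_const {p Q : ℝ} (hp : 0 < p) (hQ : 0 < Q) {F : ℝ → V2 → ℝ≥0∞} {c : ℝ≥0∞} (hc : c ≠ ∞) :
    MX p Q (fun t x => c * F t x) = c * MX p Q F := by
  have h1 : ∀ t, (∫⁻ x, (c * F t x) ^ Q) ^ (p / Q) = c ^ p * (∫⁻ x, F t x ^ Q) ^ (p / Q) := by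
    intro t
    have : ∀ x, (c * F t x) ^ Q = c ^ Q * F t x ^ Q := fun x => mul_rpow_of_nonneg _ _ hQ.le
    rw [lintegral_congr this, lintegral_const_mul' _ _ (rpow_ne_top_of_nonneg hQ.le hc),
      mul_rpow_of_nonneg _ _ (by positivity), ← erm]
    congr 2; field_simp
  unfold MX
  rw [lintegral_congr h1, lintegral_const_mul' _ _ (rpow_ne_top_of_nonneg hp.le hc),
    mul_rpow_of_nonneg _ _ (by positivity), ← erm, mul_one_div_cancel hp.ne', ENNReal.rpow_one]

lemma MX_mink {β : Type*} [MeasurableSpace β] (ν : Measure β) [SFinite ν] {p Q : ℝ} (hp : 1 ≤ p) (hQ : 1 ≤ Q)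
    {F : β → ℝ → V2 → ℝ≥0∞} (hF : Measurable fun z : (ℝ × V2) × β => F z.2 z.1.1 z.1.2) :
    MX p Q (fun t x => ∫⁻ y, F y t x ∂ν) ≤ ∫⁻ y, MX p Q (F y) ∂ν := by
  have hp0 : 0 < p := by linarith
  have hQ0 : 0 < Q := by linarith
  have hm : ∀ t, Measurable (Function.uncurry fun (x : V2) (y : β) => F y t x) := fun t =>
    Measurable.comp (g := fun z : (ℝ × V2) × β => F z.2 z.1.1 z.1.2) (f := fun z : V2 × β => ((t, z.1), z.2)) hF (by fun_prop)
  have h1 : ∀ t, (∫⁻ x, (∫⁻ y, F y t x ∂ν) ^ Q) ^ (p / Q) ≤ (∫⁻ y, (∫⁻ x, F y t x ^ Q) ^ (1 / Q) ∂ν) ^ p := by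
    intro t
    have := erl (mink (volume : Measure V2) ν hQ (hm t)) hp0.le
    rw [← erm, one_div_mul_eq_div] at this
    exact this
  have hm2 : Measurable (Function.uncurry fun (t : ℝ) (y : β) => (∫⁻ x, F y t x ^ Q) ^ (1 / Q)) := by
    refine Measurable.pow_const ?_ _
    refine Measurable.lintegral_prod_right' (f := fun z : (ℝ × β) × V2 => F z.1.2 z.1.1 z.2 ^ Q) ?_
    exact (Measurable.comp (g := fun z : (ℝ × V2) × β => F z.2 z.1.1 z.1.2) (f := fun z : (ℝ × β) × V2 => ((z.1.1, z.2), z.1.2)) hF (by fun_prop)).pow_const _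
  unfold MX
  refine (erl (lintegral_mono h1) (by positivity)).trans ((mink (volume : Measure ℝ) ν hp hm2).trans_eq ?_)
  apply lintegral_congr; intro y
  congr 1; apply lintegral_congr; intro t
  rw [← erm, one_div_mul_eq_div]

lemma wsum {ε : ℝ} (hε : 0 < ε) : ∃ C : ℝ≥0∞, C ≠ ∞ ∧ ∀ c : ℝ, 0 < c →
    ∑' k : ℤ, ofReal (min ((2:ℝ) ^ k * c) (1 / ((2:ℝ) ^ k * c)) ^ ε) ≤ C := by
  have hs : Summable fun k : ℤ => (2:ℝ) ^ ε * ((2:ℝ) ^ (-ε)) ^ k.natAbs := by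
    apply Summable.mul_left
    have hg : Summable fun n : ℕ => ((2:ℝ) ^ (-ε)) ^ n :=
      summable_geometric_of_lt_one (by positivity) (Real.rpow_lt_one_of_one_lt_of_neg (by norm_num) (by linarith))
    apply Summable.of_nat_of_neg <;> simpa using hg
  refine ⟨∑' k : ℤ, ofReal ((2:ℝ) ^ ε * ((2:ℝ) ^ (-ε)) ^ k.natAbs), hs.tsum_ofReal_ne_top, ?_⟩
  intro c hc
  obtain ⟨j, hj1, hj2⟩ := exists_mem_Ico_zpow hc (by norm_num : (1:ℝ) < 2)
  rw [← (Equiv.addRight j).tsum_eq (fun k : ℤ => ofReal ((2:ℝ) ^ ε * ((2:ℝ) ^ (-ε)) ^ k.natAbs))]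
  refine ENNReal.tsum_le_tsum fun k => ofReal_le_ofReal ?_
  have hb : min ((2:ℝ) ^ k * c) (1 / ((2:ℝ) ^ k * c)) ≤ 2 * (2:ℝ) ^ (-((k + j).natAbs : ℝ)) := by
    rcases le_total 0 (k + j) with h | h
    · refine (min_le_right _ _).trans ?_
      have e : (((k + j).natAbs : ℝ)) = ((k + j : ℤ) : ℝ) := by
        have : (((k + j).natAbs : ℤ)) = k + j := Int.natAbs_of_nonneg h
        have := congrArg (fun z : ℤ => (z : ℝ)) this
        simp only [Int.cast_natCast] at this
        exact this
      rw [e, Real.rpow_neg (by norm_num), Real.rpow_intCast, zpow_add₀ (by norm_num)]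
      have h1 : (2:ℝ) ^ k * (2:ℝ) ^ j ≤ (2:ℝ) ^ k * c := by gcongr
      rw [one_div]
      have h2 : (0:ℝ) < (2:ℝ) ^ k * (2:ℝ) ^ j := by positivity
      have := inv_anti₀ h2 h1
      have h3 : 0 < ((2:ℝ) ^ k * (2:ℝ) ^ j)⁻¹ := by positivity
      linarith
    · refine (min_le_left _ _).trans ?_
      have e : -(((k + j).natAbs : ℝ)) = ((k + j : ℤ) : ℝ) := by
        have : (((k + j).natAbs : ℤ)) = -(k + j) := Int.ofNat_natAbs_of_nonpos h
        have := congrArg (fun z : ℤ => (z : ℝ)) this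
        simp only [Int.cast_natCast, Int.cast_neg] at this
        linarith
      rw [e, Real.rpow_intCast, zpow_add₀ (by norm_num)]
      rw [zpow_add₀ (by norm_num)] at hj2
      have : (2:ℝ) ^ k * c ≤ (2:ℝ) ^ k * (2 ^ j * 2 ^ (1:ℤ)) := by gcongr
      refine this.trans_eq ?_
      simp; ring
  refine (Real.rpow_le_rpow (by positivity) hb hε.le).trans_eq ?_
  rw [Real.mul_rpow (by norm_num) (by positivity), ← Real.rpow_mul (by norm_num), ← Real.rpow_natCast, ← Real.rpow_mul (by norm_num)]
  simp only [Equiv.coe_addRight]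
  congr 2; ring

lemma wCS {w v : ℤ → ℝ≥0∞} (a : ℤ → ℝ≥0∞) (h : ∀ k, v k * w k = 1) :
    (∑' k, a k) ^ 2 ≤ (∑' k, v k) * ∑' k, w k * a k ^ 2 := by
  have h3 := ENNReal.lintegral_mul_le_Lp_mul_Lq (Measure.count : Measure ℤ) (p := 2) (q := 2)
      (by constructor <;> norm_num) (f := fun k => v k ^ (1/2:ℝ)) (g := fun k => w k ^ (1/2:ℝ) * a k) (Measurable.of_discrete).aemeasurable (Measurable.of_discrete).aemeasurable
  have h4 := erl h3 (by norm_num : (0 : ℝ) ≤ 2)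
  rw [mul_rpow_of_nonneg _ _ (by norm_num), ← erm, ← erm] at h4
  have e1 : ∀ k, ((fun k => v k ^ (1/2:ℝ)) * (fun k => w k ^ (1/2:ℝ) * a k) : ℤ → ℝ≥0∞) k = a k := by
    intro k
    simp only [Pi.mul_apply]
    rw [← mul_assoc, ← mul_rpow_of_nonneg _ _ (by norm_num), h, ENNReal.one_rpow, one_mul]
  have e2 : ∀ k, (v k ^ (1/2:ℝ)) ^ (2:ℝ) = v k := by
    intro k; rw [← erm]; norm_num
  have e3 : ∀ k, (w k ^ (1/2:ℝ) * a k) ^ (2:ℝ) = w k * a k ^ 2 := by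
    intro k; rw [mul_rpow_of_nonneg _ _ (by norm_num), ← erm]; norm_num
  rw [lintegral_congr e1, lintegral_congr e2, lintegral_congr e3] at h4
  simp only [lintegral_count] at h4
  norm_num at h4
  exact h4

lemma cint {α β ε : ℝ} (h1 : α + ε < 1) (h2 : 1 < α + β - ε) (hε : 0 < ε) (hβ : 0 < β) {l : ℝ} (hl : 0 < l) :
    ∫⁻ c in Ioi (0:ℝ), ofReal (c ^ (-α) * max (l * c) (1 / (l * c)) ^ ε * min (1 / (2 * c)) l ^ β) ≤
      ofReal ((1 / (1 - α - ε) + 1 / (α + β - ε - 1)) * l ^ (α + β - 1)) := by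
  have hl' : 0 < 1 / l := by positivity
  rw [← Set.Ioc_union_Ioi_eq_Ioi hl'.le]
  refine (lintegral_union_le _ _ _).trans ?_
  rw [add_mul, ENNReal.ofReal_add (by have : 0 < 1 - α - ε := by linarith
                                      positivity) (by have : 0 < α + β - ε - 1 := by linarith
                                                      positivity)]
  apply add_le_add
  · calc _ ≤ ∫⁻ c in Ioc 0 (1 / l), ofReal (l ^ (β - ε)) * ofReal (c ^ ((1 - α - ε) - 1)) := by
          refine setLIntegral_mono' measurableSet_Ioc fun c hc => ?_
          rw [← ofReal_mul (by positivity)]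
          apply ofReal_le_ofReal
          have hc0 := hc.1
          have hlc : l * c ≤ 1 := by have := hc.2; rw [le_div_iff₀ hl] at this; linarith
          have e1 : max (l * c) (1 / (l * c)) = 1 / (l * c) := max_eq_right (hlc.trans (by rw [le_div_iff₀ (by positivity)]; linarith))
          rw [e1]
          have : min (1 / (2 * c)) l ^ β ≤ l ^ β := Real.rpow_le_rpow (by positivity) (min_le_right _ _) hβ.le
          refine (mul_le_mul_of_nonneg_left this (by positivity)).trans_eq ?_
          rw [Real.div_rpow (by norm_num) (by positivity), Real.mul_rpow hl.le hc0.le, Real.one_rpow, show 1 - α - ε - 1 = -α - ε by ring,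
            Real.rpow_sub hl, Real.rpow_sub hc0]
          field_simp
      _ = _ := by
          rw [lintegral_const_mul' _ _ (by finiteness), lint_Ioc_rpow (by linarith) hl'.le, ← ofReal_mul (by positivity)]
          congr 1
          rw [one_div l, Real.inv_rpow hl.le, ← Real.rpow_neg hl.le, mul_div_assoc', ← Real.rpow_add hl]
          rw [div_eq_inv_mul, one_div]; congr 2; ring
  · calc _ ≤ ∫⁻ c in Ioi (1 / l), ofReal (l ^ ε) * ofReal (c ^ (-(α + β - ε - 1) - 1)) := by
          refine setLIntegral_mono' measurableSet_Ioi fun c hc => ?_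
          rw [← ofReal_mul (by positivity)]
          apply ofReal_le_ofReal
          have hc0 : 0 < c := hl'.trans hc
          have hlc : 1 ≤ l * c := by have := (Set.mem_Ioi.1 hc).le; rw [div_le_iff₀ hl] at this; linarith
          have e1 : max (l * c) (1 / (l * c)) = l * c := max_eq_left ((by rw [div_le_iff₀ (by positivity)]; nlinarith : 1 / (l * c) ≤ 1).trans hlc)
          rw [e1]
          have : min (1 / (2 * c)) l ^ β ≤ (1 / c) ^ β := Real.rpow_le_rpow (by positivity) ((min_le_left _ _).trans (by
            gcongr; linarith)) hβ.le
          refine (mul_le_mul_of_nonneg_left this (by positivity)).trans_eq ?_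
          rw [one_div, Real.inv_rpow hc0.le, ← Real.rpow_neg hc0.le, Real.mul_rpow hl.le hc0.le]
          rw [show c ^ (-α) * (l ^ ε * c ^ ε) * c ^ (-β) = l ^ ε * (c ^ (-α) * c ^ ε * c ^ (-β)) by ring, ← Real.rpow_add hc0, ← Real.rpow_add hc0]
          congr 2; ring
      _ = _ := by
          rw [lintegral_const_mul' _ _ (by finiteness), lint_Ioi_rpow (by linarith) hl', ← ofReal_mul (by positivity)]
          congr 1
          rw [one_div l, Real.inv_rpow hl.le, ← Real.rpow_neg hl.le, mul_div_assoc', ← Real.rpow_add hl]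
          rw [div_eq_inv_mul, one_div]; congr 2; ring

lemma ann_disj {k j : ℤ} (h : k ≠ j) : Disjoint (ann ((2:ℝ) ^ k)) (ann ((2:ℝ) ^ j)) := by
  have key : ∀ k j : ℤ, k < j → ∀ ξ : V2, ξ ∈ ann ((2:ℝ) ^ k) → ξ ∈ ann ((2:ℝ) ^ j) → False := by
    intro k j h ξ h1 h2
    have a := h1.2
    have b := h2.1
    have : (2:ℝ) ^ (k + 1) ≤ 2 ^ j := zpow_le_zpow_right₀ (by norm_num) (by omega)
    rw [zpow_add₀ (by norm_num), zpow_one] at this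
    linarith
  rw [Set.disjoint_left]
  intro ξ h1 h2
  rcases lt_or_gt_of_ne h with h | h
  · exact key _ _ h ξ h1 h2
  · exact key _ _ h ξ h2 h1

lemma ann_cover : (⋃ k : ℤ, ann ((2:ℝ) ^ k)) =ᵐ[volume] (univ : Set V2) := by
  have h : ∀ᵐ ξ : V2, ξ ≠ 0 := by
    rw [ae_iff]; simp
  filter_upwards [h] with ξ hξ
  have : 0 < max |ξ 0| |ξ 1| := by
    by_contra hc
    apply hξ
    have h0 : |ξ 0| ≤ 0 := (le_max_left _ _).trans (not_lt.1 hc)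
    have h1 : |ξ 1| ≤ 0 := (le_max_right _ _).trans (not_lt.1 hc)
    ext i; fin_cases i
    · simpa using h0
    · simpa using h1
  obtain ⟨k, hk1, hk2⟩ := exists_mem_Ico_zpow this (by norm_num : (1:ℝ) < 2)
  have hm : ξ ∈ ⋃ k : ℤ, ann ((2:ℝ) ^ k) := Set.mem_iUnion.2 ⟨k, hk1, by rwa [zpow_add₀ (by norm_num), zpow_one, mul_comm] at hk2⟩
  apply propext
  exact ⟨fun _ => trivial, fun _ => hm⟩

lemma PP_dyad {g : V2 → ℂ} (hg : Integrable g) (σ t : ℝ) (x ζ : V2) (μ : ℝ) :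
    ‖PP g σ (box ζ μ) t x‖ₑ ≤ ∑' k : ℤ, ‖PP g σ (box ζ μ ∩ ann ((2:ℝ) ^ k)) t x‖ₑ := by
  have h1 : PP g σ (box ζ μ) t x = ∫ ξ in ⋃ k : ℤ, (box ζ μ ∩ ann ((2:ℝ) ^ k)), ph σ t x ξ * g ξ := by
    unfold PP
    apply setIntegral_congr_set
    rw [← Set.inter_iUnion]
    have := (Filter.EventuallyEq.refl (ae volume) (box ζ μ)).inter ann_cover
    rw [Set.inter_univ] at this
    exact this.symm
  have h2 := hasSum_integral_iUnion (μ := volume) (f := fun ξ => ph σ t x ξ * g ξ) (s := fun k : ℤ => box ζ μ ∩ ann ((2:ℝ) ^ k))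
    (fun k => (meas_box _ _).inter (meas_ann _)) (fun k j h => (ann_disj h).mono Set.inter_subset_right Set.inter_subset_right)
    (PP_int hg.integrableOn t x)
  rw [h1, ← h2.tsum_eq]
  exact enorm_tsum_le_tsum_enorm

def ww (ε c : ℝ) (k : ℤ) : ℝ≥0∞ := ofReal (max ((2:ℝ) ^ k * c) (1 / ((2:ℝ) ^ k * c)) ^ ε)

lemma boxL2 {ε : ℝ} (hε : 0 < ε) : ∃ C : ℝ≥0∞, C ≠ ∞ ∧ ∀ (g : V2 → ℂ), Measurable g → Integrable g → ∀ (σ t : ℝ) (x : V2) (c μ : ℝ), 0 < c →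
    ∫⁻ ζ, ‖PP g σ (box ζ μ) t x‖ₑ ^ 2 ≤ C * ∑' k : ℤ, ww ε c k * NN g σ μ ((2:ℝ) ^ k) t x := by
  obtain ⟨C, hC, H⟩ := wsum hε
  refine ⟨C, hC, ?_⟩
  intro g hgm hg σ t x c μ hc
  have hm : ∀ k : ℤ, Measurable fun ζ => ‖PP g σ (box ζ μ ∩ ann ((2:ℝ) ^ k)) t x‖ₑ ^ 2 := fun k =>
    (Measurable.comp (g := fun w : (ℝ × V2) × (ℝ × V2) => PP g σ (box w.2.2 w.2.1 ∩ ann ((2:ℝ) ^ k)) w.1.1 w.1.2)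
    (f := fun z : V2 => ((t, x), (μ, z))) (PPm hgm σ _) (by fun_prop)).enorm.pow_const 2
  calc ∫⁻ ζ, ‖PP g σ (box ζ μ) t x‖ₑ ^ 2 ≤ ∫⁻ ζ, C * ∑' k : ℤ, ww ε c k * ‖PP g σ (box ζ μ ∩ ann ((2:ℝ) ^ k)) t x‖ₑ ^ 2 := by
        apply lintegral_mono; intro ζ
        refine (pow_le_pow_left₀ zero_le (PP_dyad hg σ t x ζ μ) 2).trans ?_
        refine (wCS (v := fun k => ofReal (min ((2:ℝ) ^ k * c) (1 / ((2:ℝ) ^ k * c)) ^ ε)) (w := ww ε c) _ ?_).trans (mul_le_mul_left (H c hc) _)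
        intro k
        have h0 : 0 < (2:ℝ) ^ k * c := by positivity
        rw [ww, ← ofReal_mul (by positivity), ← Real.mul_rpow (by positivity) (by positivity), min_mul_max,
          mul_one_div_cancel h0.ne']
        simp
    _ = C * ∑' k : ℤ, ∫⁻ ζ, ww ε c k * ‖PP g σ (box ζ μ ∩ ann ((2:ℝ) ^ k)) t x‖ₑ ^ 2 := by
        rw [lintegral_const_mul' _ _ hC, lintegral_tsum]
        intro k
        exact ((hm k).const_mul _).aemeasurable
    _ = _ := by
        congr 1; apply tsum_congr; intro k
        rw [lintegral_const_mul _ (hm k)]; rfl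

def TT (α : ℝ) (u : V2 → ℝ≥0∞) (x : V2) : ℝ≥0∞ := ∫⁻ y, ofReal (‖x - y‖ ^ (-(1 + α))) * u y ^ 2

lemma TT_bound {α ε : ℝ} (hα : 0 ≤ α) (hε : 0 < ε) : ∃ C : ℝ≥0∞, C ≠ ∞ ∧ ∀ (g : V2 → ℂ), Measurable g → Integrable g → ∀ (σ t : ℝ) (x : V2),
    TT α (fun y => ‖PP g σ univ t y‖ₑ) x ≤
      C * ∫⁻ c in Ioi (0:ℝ), ∑' k : ℤ, ofReal (c ^ (2 - α)) * ww ε c k * NN g σ (1 / (2 * c)) ((2:ℝ) ^ k) t x := by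
  obtain ⟨C, hC, H⟩ := boxL2 hε
  refine ⟨ofReal (1 + α) * (ofReal (16 * π ^ 2) * C), by finiteness, ?_⟩
  intro g hgm hg σ t x
  have hP : Measurable fun y => ‖PP g σ univ t y‖ₑ ^ 2 := ((PP_contx g σ univ t).measurable.enorm).pow_const 2
  have hset : MeasurableSet {z : V2 × ℝ | ‖x - z.1‖ < z.2} := by apply measurableSet_lt <;> fun_prop
  have hI : Measurable fun z : V2 × ℝ => (if ‖x - z.1‖ < z.2 then (1:ℝ≥0∞) else 0) := Measurable.ite hset measurable_const measurable_const
  calc TT α (fun y => ‖PP g σ univ t y‖ₑ) x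
      ≤ ∫⁻ y, ofReal (1 + α) * ∫⁻ c in Ioi (0:ℝ), ofReal (c ^ (-(1 + α) - 1)) * ((if ‖x - y‖ < c then 1 else 0) * ‖PP g σ univ t y‖ₑ ^ 2) := by
        apply lintegral_mono; intro y
        refine (mul_le_mul_left (ker_le (by linarith : 0 < 1 + α) (norm_nonneg (x - y))) _).trans_eq ?_
        rw [mul_assoc, ← lintegral_mul_const]
        · simp only [mul_assoc]
        · refine Measurable.mul (by fun_prop) ?_
          exact Measurable.comp (g := fun z : V2 × ℝ => (if ‖x - z.1‖ < z.2 then (1:ℝ≥0∞) else 0)) (f := fun c => (y, c)) hI (by fun_prop)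
    _ = ofReal (1 + α) * ∫⁻ c in Ioi (0:ℝ), ofReal (c ^ (-(1 + α) - 1)) * ∫⁻ y, (if ‖x - y‖ < c then 1 else 0) * ‖PP g σ univ t y‖ₑ ^ 2 := by
        rw [lintegral_const_mul' _ _ (by finiteness), lintegral_lintegral_swap]
        · congr 1; apply lintegral_congr; intro c
          rw [lintegral_const_mul' _ _ (by finiteness)]
        · refine Measurable.aemeasurable ?_
          refine Measurable.mul (by fun_prop) (Measurable.mul hI (hP.comp measurable_fst))
    _ ≤ ofReal (1 + α) * ∫⁻ c in Ioi (0:ℝ), (ofReal (16 * π ^ 2) * C) * ∑' k : ℤ, ofReal (c ^ (2 - α)) * ww ε c k * NN g σ (1 / (2 * c)) ((2:ℝ) ^ k) t x := by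
        refine mul_le_mul_right (setLIntegral_mono' measurableSet_Ioi fun c hc => ?_) _
        have hc0 : 0 < c := hc
        have h1 := (locL2 g hg σ t x (μ := 1 / (2 * c)) (c := c) (by positivity) hc0 (le_of_eq (by field_simp))).trans
          (mul_le_mul_right (H g hgm hg σ t x c (1 / (2 * c)) hc0) _)
        refine (mul_le_mul_right h1 _).trans_eq ?_
        simp only [mul_assoc]
        rw [ENNReal.tsum_mul_left]
        rw [← mul_assoc (ofReal _) (ofReal _), ← ofReal_mul (by positivity)]
        have e : c ^ (-(1 + α) - 1) * (π ^ 2 * (1 / (2 * c))⁻¹ ^ 4) = (16 * π ^ 2) * c ^ (2 - α) := by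
          have : c ^ (2 - α) = c ^ (-(1 + α) - 1) * c ^ 4 := by
            rw [← Real.rpow_natCast c 4, ← Real.rpow_add hc0]; congr 1; push_cast; ring
          rw [this]; field_simp; ring
        rw [e, ofReal_mul (by positivity)]
        ring
    _ = _ := by rw [lintegral_const_mul' _ _ (by finiteness)]; ring

lemma ww_meas (ε : ℝ) (k : ℤ) : Measurable fun c => ww ε c k := by
  unfold ww; fun_prop

lemma F_meas {g : V2 → ℂ} (hg : Measurable g) (σ α ε : ℝ) (k : ℤ) : Measurable fun z : (ℝ × V2) × ℝ =>
    ofReal (z.2 ^ (2 - α)) * ww ε z.2 k * NN g σ (1 / (2 * z.2)) ((2:ℝ) ^ k) z.1.1 z.1.2 := by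
  refine Measurable.mul (Measurable.mul (by fun_prop) ((ww_meas ε k).comp measurable_snd)) ?_
  exact Measurable.comp (g := fun z : (ℝ × V2) × ℝ => NN g σ z.2 ((2:ℝ) ^ k) z.1.1 z.1.2)
    (f := fun z : (ℝ × V2) × ℝ => (z.1, 1 / (2 * z.2))) (NN_meas hg σ _) (by fun_prop)

lemma MX_tsum {p Q : ℝ} (hp : 1 ≤ p) (hQ : 1 ≤ Q) {F : ℤ → ℝ → V2 → ℝ≥0∞} (hF : ∀ k, Measurable fun z : ℝ × V2 => F k z.1 z.2) :
    MX p Q (fun t x => ∑' k, F k t x) ≤ ∑' k, MX p Q (F k) := by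
  have := MX_mink (Measure.count : Measure ℤ) hp hQ (F := F) (measurable_from_prod_countable_left fun k => hF k)
  simpa only [lintegral_count] using this

lemma BBsum {g : V2 → ℂ} {e : ℝ} (he : 0 ≤ e) :
    ∑' k : ℤ, ofReal (((2:ℝ) ^ k) ^ e) * BB g (ann ((2:ℝ) ^ k)) ≤ ∫⁻ ξ, ofReal (‖ξ‖ ^ e) * ‖g ξ‖ₑ ^ 2 := by
  calc _ ≤ ∑' k : ℤ, ∫⁻ ξ in ann ((2:ℝ) ^ k), ofReal (‖ξ‖ ^ e) * ‖g ξ‖ₑ ^ 2 := by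
        refine ENNReal.tsum_le_tsum fun k => ?_
        rw [BB, ← lintegral_const_mul' _ _ (by finiteness)]
        refine setLIntegral_mono' (meas_ann _) fun ξ hξ => ?_
        exact mul_le_mul_left (ofReal_le_ofReal (Real.rpow_le_rpow (by positivity) (ann_le _ ξ hξ) he)) _
    _ = ∫⁻ ξ in ⋃ k : ℤ, ann ((2:ℝ) ^ k), ofReal (‖ξ‖ ^ e) * ‖g ξ‖ₑ ^ 2 := by
        rw [lintegral_iUnion (fun k => meas_ann _) (fun k j h => ann_disj h)]
    _ ≤ _ := setLIntegral_le_lintegral _ _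

lemma term_le {c α M L N : ℝ} (hc : 0 < c) (hM : 0 ≤ M) (hL : 0 ≤ L) (hN : 0 ≤ N) (C B : ℝ≥0∞) :
    ofReal (c ^ (2 - α)) * ofReal M * (C * ofReal ((1 / (2 * c)) ^ 2 * L * N) * B) ≤
      C * B * ofReal L * ofReal (c ^ (-α) * M * N) := by
  have h : ofReal (c ^ (2 - α)) * ofReal M * ofReal ((1 / (2 * c)) ^ 2 * L * N) ≤ ofReal L * ofReal (c ^ (-α) * M * N) := by
    rw [← ofReal_mul (by positivity), ← ofReal_mul (by positivity), ← ofReal_mul hL]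
    apply ofReal_le_ofReal
    have e : c ^ (2 - α) = c ^ 2 * c ^ (-α) := by
      rw [← Real.rpow_natCast c 2, ← Real.rpow_add hc]; congr 1
    rw [e]
    have e2 : c ^ 2 * c ^ (-α) * M * ((1 / (2 * c)) ^ 2 * L * N) = 1 / 4 * (L * (c ^ (-α) * M * N)) := by
      field_simp; ring
    rw [e2]
    have : 0 ≤ L * (c ^ (-α) * M * N) := by positivity
    linarith
  calc _ = C * B * (ofReal (c ^ (2 - α)) * ofReal M * ofReal ((1 / (2 * c)) ^ 2 * L * N)) := by ring
    _ ≤ C * B * (ofReal L * ofReal (c ^ (-α) * M * N)) := mul_le_mul_right h _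
    _ = _ := by ring

lemma free_est {p Q α : ℝ} (hp : 1 ≤ p) (hQ : 1 < Q) (hpQ : 2 / p + 2 / Q < 1) (hα0 : 0 ≤ α) (hα1 : α < 1) :
    ∃ C : ℝ≥0∞, C ≠ ∞ ∧ ∀ (g : V2 → ℂ) (σ : ℝ), (σ = 1 ∨ σ = -1) → Measurable g →
      MX p Q (fun t x => TT α (fun y => ‖PP g σ univ t y‖ₑ) x) ≤
        C * ∫⁻ ξ, ofReal (‖ξ‖ ^ (1 + α - 2 / Q - 1 / p)) * ‖g ξ‖ₑ ^ 2 := by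
  have hp0 : 0 < p := by linarith
  have hQ0 : 0 < Q := by linarith
  have hip : 0 < 1 / p := by positivity
  have hiQ : 0 < 1 / Q := by positivity
  have d1 : 2 / p = 2 * (1 / p) := by ring
  have d2 : 2 / Q = 2 * (1 / Q) := by ring
  obtain ⟨β, hβ⟩ : ∃ β, β = 2 - 2 / Q - 2 / p := ⟨_, rfl⟩
  have hβ1 : 1 < β := by linarith
  obtain ⟨ε, hε⟩ : ∃ ε, ε = min ((1 - α) / 2) ((β - 1) / 2) := ⟨_, rfl⟩
  have hε0 : 0 < ε := by rw [hε]; apply lt_min <;> linarith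
  have hε1 : α + ε < 1 := by have := min_le_left ((1 - α) / 2) ((β - 1) / 2); linarith
  have hε2 : 1 < α + β - ε := by have := min_le_right ((1 - α) / 2) ((β - 1) / 2); linarith
  obtain ⟨C1, hC1, H1⟩ := TT_bound hα0 hε0
  obtain ⟨C2, hC2, H2⟩ := NN_mixed hp0 hQ (by linarith : 0 ≤ 1 - 1 / Q - 2 / p)
  rw [← hβ] at H2
  obtain ⟨K, hK⟩ : ∃ K, K = 1 / (1 - α - ε) + 1 / (α + β - ε - 1) := ⟨_, rfl⟩
  have hK0 : 0 ≤ K := by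
    have : 0 < 1 - α - ε := by linarith
    have : 0 < α + β - ε - 1 := by linarith
    rw [hK]; positivity
  refine ⟨C1 * C2 * ofReal K, by finiteness, ?_⟩
  intro g σ hσ hgm
  by_cases hg : Integrable g
  swap
  · have : ∀ t y, PP g σ univ t y = 0 := fun t y => PP_zero (by rwa [integrableOn_univ]) t y
    simp only [this, TT, MX]
    simp [hp0, hQ0]
  have hm := F_meas hgm σ α ε
  calc MX p Q (fun t x => TT α (fun y => ‖PP g σ univ t y‖ₑ) x)
      ≤ C1 * MX p Q (fun t x => ∫⁻ c in Ioi (0:ℝ), ∑' k : ℤ, ofReal (c ^ (2 - α)) * ww ε c k * NN g σ (1 / (2 * c)) ((2:ℝ) ^ k) t x) := by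
        rw [← MX_const hp0 hQ0 hC1]
        exact MX_mono hp0 hQ0 fun t x => H1 g hgm hg σ t x
    _ ≤ C1 * ∫⁻ c in Ioi (0:ℝ), MX p Q (fun t x => ∑' k : ℤ, ofReal (c ^ (2 - α)) * ww ε c k * NN g σ (1 / (2 * c)) ((2:ℝ) ^ k) t x) := by
        refine mul_le_mul_right ?_ _
        exact MX_mink (volume.restrict (Ioi (0:ℝ))) hp hQ.le (F := fun c t x => ∑' k : ℤ, ofReal (c ^ (2 - α)) * ww ε c k * NN g σ (1 / (2 * c)) ((2:ℝ) ^ k) t x) (Measurable.tsum hm)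
    _ ≤ C1 * ∫⁻ c in Ioi (0:ℝ), ∑' k : ℤ, C2 * BB g (ann ((2:ℝ) ^ k)) * ofReal (((2:ℝ) ^ k) ^ (1 / p)) *
          ofReal (c ^ (-α) * max ((2:ℝ) ^ k * c) (1 / ((2:ℝ) ^ k * c)) ^ ε * min (1 / (2 * c)) ((2:ℝ) ^ k) ^ β) := by
        refine mul_le_mul_right (setLIntegral_mono' measurableSet_Ioi fun c hc => ?_) _
        have hc0 : 0 < c := hc
        refine (MX_tsum hp hQ.le fun k => ?_).trans (ENNReal.tsum_le_tsum fun k => ?_)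
        · exact Measurable.comp (g := fun z : (ℝ × V2) × ℝ => ofReal (z.2 ^ (2 - α)) * ww ε z.2 k * NN g σ (1 / (2 * z.2)) ((2:ℝ) ^ k) z.1.1 z.1.2)
            (f := fun z : ℝ × V2 => (z, c)) (hm k) (by fun_prop)
        · rw [MX_const hp0 hQ0 (by unfold ww; finiteness)]
          refine (mul_le_mul_right (H2 g σ (1 / (2 * c)) ((2:ℝ) ^ k) hσ hgm hg (by positivity) (by positivity)) _).trans ?_
          exact term_le hc0 (by positivity) (by positivity) (by positivity) C2 _
    _ = C1 * ∑' k : ℤ, C2 * BB g (ann ((2:ℝ) ^ k)) * ofReal (((2:ℝ) ^ k) ^ (1 / p)) *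
          ∫⁻ c in Ioi (0:ℝ), ofReal (c ^ (-α) * max ((2:ℝ) ^ k * c) (1 / ((2:ℝ) ^ k * c)) ^ ε * min (1 / (2 * c)) ((2:ℝ) ^ k) ^ β) := by
        rw [lintegral_tsum fun k => Measurable.aemeasurable (by fun_prop)]
        congr 1; apply tsum_congr; intro k
        rw [lintegral_const_mul _ (by fun_prop)]
    _ ≤ C1 * ∑' k : ℤ, C2 * BB g (ann ((2:ℝ) ^ k)) * ofReal (((2:ℝ) ^ k) ^ (1 / p)) *
          ofReal (K * ((2:ℝ) ^ k) ^ (α + β - 1)) := by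
        refine mul_le_mul_right (ENNReal.tsum_le_tsum fun k => mul_le_mul_right ?_ _) _
        rw [hK]
        exact cint hε1 hε2 hε0 (by linarith) (by positivity)
    _ = C1 * C2 * ofReal K * ∑' k : ℤ, ofReal (((2:ℝ) ^ k) ^ (1 + α - 2 / Q - 1 / p)) * BB g (ann ((2:ℝ) ^ k)) := by
        rw [← ENNReal.tsum_mul_left, ← ENNReal.tsum_mul_left]
        apply tsum_congr; intro k
        have hl : 0 < (2:ℝ) ^ k := by positivity
        rw [show 1 + α - 2 / Q - 1 / p = 1 / p + (α + β - 1) by rw [hβ]; ring, Real.rpow_add hl, ofReal_mul hK0, ofReal_mul (p := ((2:ℝ) ^ k) ^ (1 / p)) (by positivity)]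
        ring
    _ ≤ _ := mul_le_mul_right (BBsum (by linarith)) _

lemma cs_half {α : Type*} [MeasurableSpace α] (μ : Measure α) {a b : α → ℝ≥0∞} (ha : AEMeasurable a μ) (hb : AEMeasurable b μ) :
    ∫⁻ x, a x ^ (1/2:ℝ) * b x ^ (1/2:ℝ) ∂μ ≤ (∫⁻ x, a x ∂μ) ^ (1/2:ℝ) * (∫⁻ x, b x ∂μ) ^ (1/2:ℝ) := by
  have h3 := ENNReal.lintegral_mul_le_Lp_mul_Lq μ (p := 2) (q := 2)
      (by constructor <;> norm_num) (f := fun k => a k ^ (1/2:ℝ)) (g := fun k => b k ^ (1/2:ℝ)) (ha.pow_const _) (hb.pow_const _)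
  have e : ∀ z : ℝ≥0∞, (z ^ (1/2:ℝ)) ^ (2:ℝ) = z := fun z => by rw [← erm]; norm_num
  simp only [e, Pi.mul_apply] at h3
  exact h3

lemma TT_meas {α : ℝ} {u : ℝ → V2 → ℝ≥0∞} (hu : Measurable fun z : ℝ × V2 => u z.1 z.2) :
    Measurable fun z : ℝ × V2 => TT α (u z.1) z.2 := by
  refine Measurable.lintegral_prod_right' (f := fun z : (ℝ × V2) × V2 => ofReal (‖z.1.2 - z.2‖ ^ (-(1 + α))) * u z.1.1 z.2 ^ 2) ?_
  refine Measurable.mul (by fun_prop) ?_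
  exact (Measurable.comp (g := fun z : ℝ × V2 => u z.1 z.2) (f := fun z : (ℝ × V2) × V2 => (z.1.1, z.2)) hu (by fun_prop)).pow_const 2

def XX (α p Q : ℝ) (u : ℝ → V2 → ℝ≥0∞) : ℝ≥0∞ := MX p Q (fun t x => TT α (u t) x) ^ (1/2:ℝ)

lemma XX_eq {α p Q : ℝ} (hp : 0 < p) (hQ : 0 < Q) (u : ℝ → V2 → ℝ≥0∞) :
    XX α p Q u = MX (2 * p) (2 * Q) (fun t x => TT α (u t) x ^ (1/2:ℝ)) := by
  unfold XX MX
  rw [← erm]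
  have e : ∀ z : ℝ≥0∞, (z ^ (1/2:ℝ)) ^ (2 * Q) = z ^ Q := fun z => by rw [← erm]; congr 1; ring
  simp only [e]
  rw [show 2 * p / (2 * Q) = p / Q by field_simp]
  congr 1; field_simp

lemma XX_mono {α p Q : ℝ} (hp : 0 < p) (hQ : 0 < Q) {u v : ℝ → V2 → ℝ≥0∞} (h : ∀ t x, u t x ≤ v t x) :
    XX α p Q u ≤ XX α p Q v := by
  refine erl (MX_mono hp hQ fun t x => lintegral_mono fun y => mul_le_mul_right ?_ _) (by norm_num)
  exact pow_le_pow_left₀ zero_le (h t y) 2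

lemma XX_const {α p Q : ℝ} (hp : 0 < p) (hQ : 0 < Q) {u : ℝ → V2 → ℝ≥0∞} {c : ℝ≥0∞} (hc : c ≠ ∞) :
    XX α p Q (fun t x => c * u t x) = c * XX α p Q u := by
  unfold XX
  have : (fun t x => TT α (fun x => c * u t x) x) = fun t x => c ^ 2 * TT α (u t) x := by
    ext t x
    unfold TT
    rw [← lintegral_const_mul' _ _ (by finiteness)]
    apply lintegral_congr; intro y
    ring
  rw [this, MX_const hp hQ (by finiteness), mul_rpow_of_nonneg _ _ (by norm_num), ← ENNReal.rpow_natCast, ← erm]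
  norm_num

lemma TT_mink {β : Type*} [MeasurableSpace β] (ν : Measure β) [SFinite ν] (α : ℝ) {w : β → V2 → ℝ≥0∞}
    (hw : Measurable fun z : V2 × β => w z.2 z.1) (x : V2) :
    TT α (fun y => ∫⁻ r, w r y ∂ν) x ^ (1/2:ℝ) ≤ ∫⁻ r, TT α (w r) x ^ (1/2:ℝ) ∂ν := by
  have h := mink (volume : Measure V2) ν (p := 2) (by norm_num) (F := fun y r => ofReal (‖x - y‖ ^ (-(1 + α))) ^ (1/2:ℝ) * w r y)
    (Measurable.mul (by fun_prop) hw)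
  have e : ∀ z a : ℝ≥0∞, (z ^ (1/2:ℝ) * a) ^ (2:ℝ) = z * a ^ 2 := fun z a => by
    rw [mul_rpow_of_nonneg _ _ (by norm_num), ← erm]; norm_num
  have e2 : ∀ y, ∫⁻ r, ofReal (‖x - y‖ ^ (-(1 + α))) ^ (1/2:ℝ) * w r y ∂ν = ofReal (‖x - y‖ ^ (-(1 + α))) ^ (1/2:ℝ) * ∫⁻ r, w r y ∂ν := by
    intro y
    rw [lintegral_const_mul' _ _ (rpow_ne_top_of_nonneg (by norm_num) (by finiteness))]
  simp only [e2, e] at h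
  exact h

lemma XX_mink {β : Type*} [MeasurableSpace β] (ν : Measure β) [SFinite ν] {α p Q : ℝ} (hp : 1 ≤ p) (hQ : 1 ≤ Q) {w : β → ℝ → V2 → ℝ≥0∞}
    (hw : Measurable fun z : (ℝ × V2) × β => w z.2 z.1.1 z.1.2) :
    XX α p Q (fun t x => ∫⁻ r, w r t x ∂ν) ≤ ∫⁻ r, XX α p Q (w r) ∂ν := by
  have hp0 : 0 < p := by linarith
  have hQ0 : 0 < Q := by linarith
  simp only [XX_eq hp0 hQ0]
  refine (MX_mono (by positivity) (by positivity) fun t x => TT_mink ν α ?_ x).trans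
    (MX_mink ν (F := fun r t x => TT α (w r t) x ^ (1/2:ℝ)) (by linarith) (by linarith) ?_)
  · exact Measurable.comp (g := fun z : (ℝ × V2) × β => w z.2 z.1.1 z.1.2) (f := fun z : V2 × β => ((t, z.1), z.2)) hw (by fun_prop)
  · refine Measurable.pow_const ?_ _
    refine Measurable.lintegral_prod_right' (f := fun z : ((ℝ × V2) × β) × V2 => ofReal (‖z.1.1.2 - z.2‖ ^ (-(1 + α))) * w z.1.2 z.1.1.1 z.2 ^ 2) ?_
    refine Measurable.mul (by fun_prop) ?_
    exact (Measurable.comp (g := fun z : (ℝ × V2) × β => w z.2 z.1.1 z.1.2) (f := fun z : ((ℝ × V2) × β) × V2 => ((z.1.1.1, z.2), z.1.2)) hw (by fun_prop)).pow_const 2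

lemma XX_add {α p Q : ℝ} (hp : 1 ≤ p) (hQ : 1 ≤ Q) {u v : ℝ → V2 → ℝ≥0∞}
    (hu : Measurable fun z : ℝ × V2 => u z.1 z.2) (hv : Measurable fun z : ℝ × V2 => v z.1 z.2) :
    XX α p Q (fun t x => u t x + v t x) ≤ XX α p Q u + XX α p Q v := by
  have := XX_mink (Measure.count : Measure Bool) (α := α) hp hQ (w := fun b t x => if b then u t x else v t x) (measurable_from_prod_countable_left (fun b => by
    cases b
    · simpa using hv
    · simpa using hu))
  simp only [lintegral_count, tsum_fintype, Fintype.sum_bool] at this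
  simpa using this

def KK (α : ℝ) (u v : V2 → ℝ≥0∞) (x : V2) : ℝ≥0∞ := ∫⁻ y, u y * v y * ofReal (‖x - y‖ ^ (-(1 + α)))

lemma KK_le {α : ℝ} {u v : V2 → ℝ≥0∞} (hu : Measurable u) (hv : Measurable v) (x : V2) :
    KK α u v x ≤ TT α u x ^ (1/2:ℝ) * TT α v x ^ (1/2:ℝ) := by
  have := cs_half volume (a := fun y => ofReal (‖x - y‖ ^ (-(1 + α))) * u y ^ 2)
    (b := fun y => ofReal (‖x - y‖ ^ (-(1 + α))) * v y ^ 2) (Measurable.aemeasurable (by fun_prop)) (Measurable.aemeasurable (by fun_prop))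
  refine le_trans (le_of_eq ?_) this
  apply lintegral_congr; intro y
  have e : ∀ z a : ℝ≥0∞, (z * a ^ 2) ^ (1/2:ℝ) = z ^ (1/2:ℝ) * a := fun z a => by
    rw [mul_rpow_of_nonneg _ _ (by norm_num), ← ENNReal.rpow_natCast, ← erm]; norm_num
  rw [e, e]
  generalize ofReal (‖x - y‖ ^ (-(1 + α))) = k
  have : k = k ^ (1/2:ℝ) * k ^ (1/2:ℝ) := by
    rw [← ENNReal.rpow_add_of_nonneg _ _ (by norm_num) (by norm_num)]; norm_num
  nth_rewrite 1 [this]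
  ring

lemma MX_bilin {α p Q : ℝ} (hp : 0 < p) (hQ : 0 < Q) {u v : ℝ → V2 → ℝ≥0∞}
    (hu : Measurable fun z : ℝ × V2 => u z.1 z.2) (hv : Measurable fun z : ℝ × V2 => v z.1 z.2) :
    MX p Q (fun t x => KK α (u t) (v t) x) ≤ XX α p Q u * XX α p Q v := by
  have hs : ∀ {f : ℝ × V2 → ℝ≥0∞}, Measurable f → ∀ t, Measurable fun x => f (t, x) := fun hf t => hf.comp (by fun_prop)
  have mu := TT_meas (α := α) hu
  have mv := TT_meas (α := α) hv
  have h1 : ∀ t, (∫⁻ x, KK α (u t) (v t) x ^ Q) ^ (p / Q) ≤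
      ((∫⁻ x, TT α (u t) x ^ Q) ^ (p / Q)) ^ (1/2:ℝ) * ((∫⁻ x, TT α (v t) x ^ Q) ^ (p / Q)) ^ (1/2:ℝ) := by
    intro t
    rw [← erm, mul_comm (p / Q), erm, ← erm _ (p / Q), mul_comm (p / Q), erm, ← mul_rpow_of_nonneg _ _ (by positivity)]
    refine erl ?_ (by positivity)
    refine le_trans (lintegral_mono fun x => ?_) (cs_half volume ((hs mu t).pow_const Q).aemeasurable ((hs mv t).pow_const Q).aemeasurable)
    refine (erl (KK_le (hs hu t) (hs hv t) x) hQ.le).trans_eq ?_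
    rw [mul_rpow_of_nonneg _ _ hQ.le, ← erm, ← erm, ← erm, ← erm, mul_comm Q]
  have hm : ∀ {f : ℝ × V2 → ℝ≥0∞}, Measurable f → Measurable fun t => (∫⁻ x, f (t, x) ^ Q) ^ (p / Q) := fun hf =>
    (Measurable.lintegral_prod_right' (hf.pow_const Q)).pow_const _
  unfold XX MX
  rw [← erm, mul_comm (1 / p), erm, ← erm _ (1 / p), mul_comm (1 / p), erm, ← mul_rpow_of_nonneg _ _ (by positivity)]
  refine erl ?_ (by positivity)
  exact (lintegral_mono h1).trans (cs_half volume (hm mu).aemeasurable (hm mv).aemeasurable)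

section
open scoped FourierTransform
instance haarST : (volume : Measure (ℝ × V2)).IsAddHaarMeasure := by
  rw [Measure.volume_eq_prod]; infer_instance

def uL (u : SST) : SchwartzMap (WithLp 2 (ℝ × V2)) ℂ :=
  SchwartzMap.compCLMOfContinuousLinearEquiv ℂ (WithLp.prodContinuousLinearEquiv 2 ℝ ℝ V2) u

lemma uL_apply (u : SST) (v : WithLp 2 (ℝ × V2)) : uL u v = u (WithLp.ofLp v) := rfl

lemma ftST_eq (u : SST) (q : ℝ × V2) :
    ftST u q.1 q.2 = 𝓕 (uL u) (WithLp.toLp 2 ((2 * π)⁻¹ • q)) := by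
  rw [SchwartzMap.fourier_coe, Real.fourier_eq', ftST,
    ← (WithLp.volume_preserving_toLp ℝ V2).integral_comp (MeasurableEquiv.toLp 2 (ℝ × V2)).measurableEmbedding]
  congr 1; ext p
  rw [uL_apply, smul_eq_mul, WithLp.prod_inner_apply]
  congr 2
  simp only [Prod.smul_fst, Prod.smul_snd, inner_smul_right, smul_eq_mul]
  have : ⟪p.1, (2 * π)⁻¹ * q.1⟫ = p.1 * q.1 * (2 * π)⁻¹ := by simp; ring
  rw [this]
  have hpi : (π : ℂ) ≠ 0 := by exact_mod_cast pi_ne_zero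
  push_cast
  field_simp

lemma ftST_cont (u : SST) : Continuous fun q : ℝ × V2 => ftST u q.1 q.2 := by
  simp only [ftST_eq]
  refine (𝓕 (uL u)).continuous.comp ?_
  exact (WithLp.prodContinuousLinearEquiv 2 ℝ ℝ V2).symm.continuous.comp (continuous_const_smul _)

lemma ftST_int (u : SST) : Integrable fun q : ℝ × V2 => ftST u q.1 q.2 := by
  simp only [ftST_eq]
  have h1 : Integrable (fun q : ℝ × V2 => (𝓕 (uL u)) (WithLp.toLp 2 q)) :=
    (WithLp.volume_preserving_toLp ℝ V2).integrable_comp_of_integrable (𝓕 (uL u)).integrable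
  exact h1.comp_smul (by positivity)

lemma ftST_inv : ∃ c : ℂ, ∀ (u : SST) (p : ℝ × V2),
    u p = c * ∫ q : ℝ × V2, Complex.exp (I * ((p.1 * q.1 + ⟪p.2, q.2⟫ : ℝ) : ℂ)) * ftST u q.1 q.2 := by
  refine ⟨(((|(2 * π) ^ Module.finrank ℝ (ℝ × V2)|)⁻¹ : ℝ) : ℂ), ?_⟩
  intro u p
  have h := congrArg (fun F : SchwartzMap (WithLp 2 (ℝ × V2)) ℂ => F (WithLp.toLp 2 p)) (FourierTransform.fourierInv_fourier_eq (F := SchwartzMap (WithLp 2 (ℝ × V2)) ℂ) (uL u))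
  simp only [SchwartzMap.fourierInv_coe, uL_apply] at h
  rw [← h, Real.fourierInv_eq', ← (WithLp.volume_preserving_toLp ℝ V2).integral_comp (MeasurableEquiv.toLp 2 (ℝ × V2)).measurableEmbedding]
  have h2 := Measure.integral_comp_inv_smul (volume : Measure (ℝ × V2)) (fun q => Complex.exp (I * ((2 * π * (p.1 * q.1 + ⟪p.2, q.2⟫) : ℝ) : ℂ)) * 𝓕 (uL u) (WithLp.toLp 2 q)) (2 * π)
  have e : ∀ q : ℝ × V2, Complex.exp (I * ((2 * π * (p.1 * ((2 * π)⁻¹ • q).1 + ⟪p.2, ((2 * π)⁻¹ • q).2⟫) : ℝ) : ℂ)) * 𝓕 (uL u) (WithLp.toLp 2 ((2 * π)⁻¹ • q)) =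
      Complex.exp (I * ((p.1 * q.1 + ⟪p.2, q.2⟫ : ℝ) : ℂ)) * ftST u q.1 q.2 := by
    intro q
    rw [ftST_eq]
    congr 4
    simp only [Prod.smul_fst, Prod.smul_snd, inner_smul_right, smul_eq_mul]
    field_simp
  simp only [e] at h2
  rw [h2, Complex.real_smul, ← mul_assoc, ← Complex.ofReal_mul, inv_mul_cancel₀ (by positivity), Complex.ofReal_one, one_mul]
  congr 1; ext q
  rw [smul_eq_mul, WithLp.prod_inner_apply]
  congr 2
  have : ⟪q.1, p.1⟫ = p.1 * q.1 := by simp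
  simp only [this, real_inner_comm]
  push_cast; ring
end


lemma shear (σ : ℝ) : MeasurePreserving (fun z : ℝ × V2 => (z.1 + σ * ‖z.2‖, z.2)) volume volume := by
  have h1 : MeasurePreserving (fun z : V2 × ℝ => (id z.1, z.2 + σ * ‖z.1‖)) ((volume : Measure V2).prod (volume : Measure ℝ)) ((volume : Measure V2).prod (volume : Measure ℝ)) :=
    MeasurePreserving.skew_product (MeasurePreserving.id _) (g := fun (ξ : V2) (ρ : ℝ) => ρ + σ * ‖ξ‖) (by fun_prop)
      (of_forall fun ξ => (measurePreserving_add_right volume (σ * ‖ξ‖)).map_eq)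
  have h2 := (Measure.measurePreserving_swap (μ := (volume : Measure V2)) (ν := (volume : Measure ℝ))).comp
    (h1.comp (Measure.measurePreserving_swap (μ := (volume : Measure ℝ)) (ν := (volume : Measure V2))))
  exact h2

def gr (G : ℝ × V2 → ℂ) (S : Set ℝ) (σ ρ : ℝ) (ξ : V2) : ℂ := S.indicator (fun τ => G (τ, ξ)) (ρ + σ * ‖ξ‖)

lemma gr_meas {G : ℝ × V2 → ℂ} (hG : Measurable G) {S : Set ℝ} (hS : MeasurableSet S) (σ : ℝ) :
    Measurable fun z : ℝ × V2 => gr G S σ z.1 z.2 := by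
  have : (fun z : ℝ × V2 => gr G S σ z.1 z.2) = fun z => (Prod.fst ⁻¹' S).indicator G (z.1 + σ * ‖z.2‖, z.2) := by
    ext z
    by_cases h : z.1 + σ * ‖z.2‖ ∈ S
    · rw [indicator_of_mem (show (z.1 + σ * ‖z.2‖, z.2) ∈ Prod.fst ⁻¹' S from h), gr, indicator_of_mem h]
    · rw [indicator_of_notMem (show (z.1 + σ * ‖z.2‖, z.2) ∉ Prod.fst ⁻¹' S from h), gr, indicator_of_notMem h]
  rw [this]
  exact Measurable.comp (g := (Prod.fst ⁻¹' S).indicator G) (f := fun z : ℝ × V2 => (z.1 + σ * ‖z.2‖, z.2)) (hG.indicator (measurable_fst hS)) (by fun_prop)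

lemma gr_meas' {G : ℝ × V2 → ℂ} (hG : Measurable G) {S : Set ℝ} (hS : MeasurableSet S) (σ ρ : ℝ) :
    Measurable (gr G S σ ρ) := 
  Measurable.comp (g := fun z : ℝ × V2 => gr G S σ z.1 z.2) (f := fun ξ => (ρ, ξ)) (gr_meas hG hS σ) (by fun_prop)

lemma PPgr_meas {G : ℝ × V2 → ℂ} (hG : Measurable G) {S : Set ℝ} (hS : MeasurableSet S) (σ : ℝ) :
    Measurable fun z : (ℝ × V2) × ℝ => PP (gr G S σ z.2) σ univ z.1.1 z.1.2 := by
  unfold PP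
  simp only [Measure.restrict_univ]
  refine (StronglyMeasurable.integral_prod_right (f := fun (z : (ℝ × V2) × ℝ) (ξ : V2) => ph σ z.1.1 z.1.2 ξ * gr G S σ z.2 ξ) (Measurable.stronglyMeasurable ?_)).measurable
  refine Measurable.mul ?_ ?_
  · exact Measurable.comp (g := fun z : (ℝ × V2) × V2 => ph σ z.1.1 z.1.2 z.2)
      (f := fun z : ((ℝ × V2) × ℝ) × V2 => (z.1.1, z.2)) (ph_cont σ).measurable (by fun_prop)
  · exact Measurable.comp (g := fun z : ℝ × V2 => gr G S σ z.1 z.2) (f := fun z : ((ℝ × V2) × ℝ) × V2 => (z.1.2, z.2)) (gr_meas hG hS σ) (by fun_prop)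

def eST (t : ℝ) (x : V2) (q : ℝ × V2) : ℂ := Complex.exp (I * ((t * q.1 + ⟪x, q.2⟫ : ℝ) : ℂ))

lemma eST_norm (t : ℝ) (x : V2) (q : ℝ × V2) : ‖eST t x q‖ = 1 := by
  rw [eST, mul_comm, norm_exp_ofReal_mul_I]

lemma eST_cont (t : ℝ) (x : V2) : Continuous (eST t x) := by
  unfold eST; fun_prop

lemma halfbound {G : ℝ × V2 → ℂ} (hG : Measurable G) (hGi : Integrable G) {S : Set ℝ} (hS : MeasurableSet S) (σ t : ℝ) (x : V2) :
    ‖∫ q in Prod.fst ⁻¹' S, eST t x q * G q‖ₑ ≤ ∫⁻ ρ, ‖PP (gr G S σ ρ) σ univ t x‖ₑ := by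
  have hSm : MeasurableSet (Prod.fst ⁻¹' S : Set (ℝ × V2)) := measurable_fst hS
  have hi : Integrable ((Prod.fst ⁻¹' S).indicator fun q : ℝ × V2 => eST t x q * G q) := by
    refine Integrable.indicator ?_ hSm
    exact hGi.bdd_mul (c := 1) (eST_cont t x).aestronglyMeasurable (of_forall fun q => by rw [eST_norm])
  have hmS : AEStronglyMeasurable ((Prod.fst ⁻¹' S).indicator fun q : ℝ × V2 => eST t x q * G q) (Measure.map (fun z : ℝ × V2 => (z.1 + σ * ‖z.2‖, z.2)) volume) := by
    rw [(shear σ).map_eq]; exact hi.1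
  rw [← integral_indicator hSm, ← (shear σ).map_eq, integral_map (shear σ).measurable.aemeasurable hmS]
  have hi2 : Integrable (fun z : ℝ × V2 => (Prod.fst ⁻¹' S).indicator (fun q : ℝ × V2 => eST t x q * G q) (z.1 + σ * ‖z.2‖, z.2)) volume :=
    (shear σ).integrable_comp_of_integrable hi
  rw [Measure.volume_eq_prod] at hi2 ⊢
  rw [integral_prod _ hi2]
  refine (enorm_integral_le_lintegral_enorm _).trans_eq ?_
  apply lintegral_congr; intro ρ
  have e : ∀ ξ : V2, ((Prod.fst ⁻¹' S).indicator fun q : ℝ × V2 => eST t x q * G q) (ρ + σ * ‖ξ‖, ξ) =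
      Complex.exp (((t * ρ : ℝ) : ℂ) * I) * (ph σ t x ξ * gr G S σ ρ ξ) := by
    intro ξ
    by_cases h : ρ + σ * ‖ξ‖ ∈ S
    · rw [indicator_of_mem (show (ρ + σ * ‖ξ‖, ξ) ∈ Prod.fst ⁻¹' S from h), gr, indicator_of_mem h, ← mul_assoc]
      congr 1
      rw [eST, ph, ← Complex.exp_add]
      congr 1; push_cast; ring
    · rw [indicator_of_notMem (show (ρ + σ * ‖ξ‖, ξ) ∉ Prod.fst ⁻¹' S from h), gr, indicator_of_notMem h]; simp
  simp only [e]
  rw [integral_const_mul, enorm_mul, ← ofReal_norm, norm_exp_ofReal_mul_I, PP, Measure.restrict_univ]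
  simp

lemma HNbound {s θ e : ℝ} (hθ : 1 / 2 < θ) (he0 : 0 ≤ e) (he : e ≤ 2 * s) : ∃ C : ℝ≥0∞, C ≠ ∞ ∧
    ∀ (G : ℝ × V2 → ℂ) (S : Set ℝ) (σ : ℝ), Measurable G → MeasurableSet S → (σ = 1 ∨ σ = -1) → (∀ τ ∈ S, |τ| = σ * τ) →
    ∫⁻ ρ, (∫⁻ ξ, ofReal (‖ξ‖ ^ e) * ‖gr G S σ ρ ξ‖ₑ ^ 2) ^ (1/2:ℝ) ≤
      C * (∫⁻ q : ℝ × V2, (ofReal (wgt s θ q.1 q.2) * ‖G q‖ₑ) ^ 2) ^ (1/2:ℝ) := by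
  refine ⟨(∫⁻ ρ : ℝ, ofReal ((1 + ‖ρ‖) ^ (-(2 * θ)))) ^ (1/2:ℝ), ?_, ?_⟩
  · refine rpow_ne_top_of_nonneg (by norm_num) ?_
    have := integrable_one_add_norm (E := ℝ) (μ := volume) (r := 2 * θ) (by simp; linarith)
    exact this.lintegral_lt_top.ne
  intro G S σ hG hS hσ hSσ
  have hm1 : Measurable fun z : ℝ × V2 => ofReal (‖z.2‖ ^ e) * ‖gr G S σ z.1 z.2‖ₑ ^ 2 :=
    Measurable.mul (by fun_prop) ((gr_meas hG hS σ).enorm.pow_const 2)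
  have hm2 : Measurable fun ρ : ℝ => ofReal ((1 + ‖ρ‖) ^ (2 * θ)) * ∫⁻ ξ, ofReal (‖ξ‖ ^ e) * ‖gr G S σ ρ ξ‖ₑ ^ 2 :=
    Measurable.mul (by fun_prop) hm1.lintegral_prod_right'
  have h1 := cs_half volume (a := fun ρ : ℝ => ofReal ((1 + ‖ρ‖) ^ (-(2 * θ))))
    (b := fun ρ : ℝ => ofReal ((1 + ‖ρ‖) ^ (2 * θ)) * ∫⁻ ξ, ofReal (‖ξ‖ ^ e) * ‖gr G S σ ρ ξ‖ₑ ^ 2)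
    (Measurable.aemeasurable (by fun_prop)) hm2.aemeasurable
  refine le_trans (le_of_eq ?_) (h1.trans (mul_le_mul_right (erl ?_ (by norm_num)) _))
  · apply lintegral_congr; intro ρ
    rw [← mul_rpow_of_nonneg _ _ (by norm_num), ← mul_assoc, ← ofReal_mul (by positivity), ← Real.rpow_add (by positivity)]
    simp
  · have hmW : Measurable fun q : ℝ × V2 => (ofReal (wgt s θ q.1 q.2) * ‖G q‖ₑ) ^ 2 := by
      refine (Measurable.mul ?_ hG.enorm).pow_const 2
      unfold wgt; fun_prop
    rw [← (shear σ).lintegral_comp hmW]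
    have e1 : ∀ ρ : ℝ, ofReal ((1 + ‖ρ‖) ^ (2 * θ)) * ∫⁻ ξ, ofReal (‖ξ‖ ^ e) * ‖gr G S σ ρ ξ‖ₑ ^ 2 =
        ∫⁻ ξ, ofReal ((1 + ‖ρ‖) ^ (2 * θ)) * (ofReal (‖ξ‖ ^ e) * ‖gr G S σ ρ ξ‖ₑ ^ 2) := fun ρ => by
      rw [lintegral_const_mul' _ _ (by finiteness)]
    simp only [e1]
    have hmc : Measurable fun z : ℝ × V2 => (ofReal (wgt s θ (z.1 + σ * ‖z.2‖) z.2) * ‖G (z.1 + σ * ‖z.2‖, z.2)‖ₑ) ^ 2 := by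
      have h0 : Measurable fun z : ℝ × V2 => (z.1 + σ * ‖z.2‖, z.2) := by fun_prop
      refine (Measurable.mul ?_ (Measurable.enorm (Measurable.comp (g := G) (f := fun z : ℝ × V2 => (z.1 + σ * ‖z.2‖, z.2)) hG h0))).pow_const 2
      unfold wgt; fun_prop
    rw [Measure.volume_eq_prod, lintegral_prod _ hmc.aemeasurable]
    refine lintegral_mono fun ρ => lintegral_mono fun ξ => ?_
    by_cases h : ρ + σ * ‖ξ‖ ∈ S
    swap
    · rw [gr, indicator_of_notMem h]; simp
    rw [gr, indicator_of_mem h, mul_pow, ← mul_assoc, ← ofReal_mul (by positivity), ← ENNReal.ofReal_pow (by unfold wgt; positivity)]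
    refine mul_le_mul_left (ofReal_le_ofReal ?_) _
    have e2 : |(|ρ + σ * ‖ξ‖| - ‖ξ‖)| = |ρ| := by
      rw [hSσ _ h]
      rcases hσ with h | h
      · rw [h]; congr 1; ring
      · rw [h, ← abs_neg]; congr 1; ring
    have e3 : ((1 + ‖ξ‖ ^ 2) ^ (s / 2)) ^ 2 = (1 + ‖ξ‖ ^ 2) ^ s := by
      rw [← Real.rpow_natCast ((1 + ‖ξ‖ ^ 2) ^ (s / 2)), ← Real.rpow_mul (by positivity)]; congr 1; push_cast; ring
    have e4 : ((1 + |ρ|) ^ θ) ^ 2 = (1 + |ρ|) ^ (2 * θ) := by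
      rw [← Real.rpow_natCast ((1 + |ρ|) ^ θ), ← Real.rpow_mul (by positivity)]; congr 1; push_cast; ring
    rw [wgt, e2, mul_pow, e3, e4, mul_comm, Real.norm_eq_abs]
    refine mul_le_mul_of_nonneg_right ?_ (by positivity)
    calc ‖ξ‖ ^ e ≤ (1 + ‖ξ‖ ^ 2) ^ (e / 2) := by
          have : ‖ξ‖ ^ e = (‖ξ‖ ^ 2) ^ (e / 2) := by
            rw [← Real.rpow_natCast, ← Real.rpow_mul (norm_nonneg _)]; congr 1; push_cast; ring
          rw [this]
          exact Real.rpow_le_rpow (by positivity) (by linarith) (by positivity)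
      _ ≤ (1 + ‖ξ‖ ^ 2) ^ s := Real.rpow_le_rpow_of_exponent_le (by nlinarith [sq_nonneg ‖ξ‖]) (by linarith)

def hw (u : ℝ × V2 → ℂ) (S : Set ℝ) (σ t : ℝ) (x : V2) : ℝ≥0∞ :=
  ∫⁻ ρ, ‖PP (gr (fun q => ftST u q.1 q.2) S σ ρ) σ univ t x‖ₑ

lemma hw_meas (u : SST) {S : Set ℝ} (hS : MeasurableSet S) (σ : ℝ) :
    Measurable fun z : ℝ × V2 => hw u S σ z.1 z.2 :=
  Measurable.lintegral_prod_right' (f := fun z : (ℝ × V2) × ℝ => ‖PP (gr (fun q => ftST u q.1 q.2) S σ z.2) σ univ z.1.1 z.1.2‖ₑ)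
    (PPgr_meas (ftST_cont u).measurable hS σ).enorm

lemma hw_bound : ∃ c : ℝ≥0∞, c ≠ ∞ ∧ ∀ (u : SST) (t : ℝ) (x : V2),
    ‖u (t, x)‖ₑ ≤ c * (hw u (Set.Ici 0) 1 t x + hw u (Set.Iio 0) (-1) t x) := by
  obtain ⟨c, hc⟩ := ftST_inv
  refine ⟨‖c‖ₑ, by simp, fun u t x => ?_⟩
  rw [hc u (t, x), enorm_mul]
  refine mul_le_mul_right ?_ _
  have hm := (ftST_cont u).measurable
  have hi := ftST_int u
  have hi2 : Integrable fun q : ℝ × V2 => eST t x q * ftST u q.1 q.2 :=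
    hi.bdd_mul (c := 1) (eST_cont t x).aestronglyMeasurable (of_forall fun q => by rw [eST_norm])
  have hS : MeasurableSet (Prod.fst ⁻¹' (Set.Ici 0) : Set (ℝ × V2)) := measurable_fst measurableSet_Ici
  have h1 := integral_add_compl hS hi2
  have h2 : (Prod.fst ⁻¹' (Set.Ici 0) : Set (ℝ × V2))ᶜ = Prod.fst ⁻¹' (Set.Iio 0) := by
    ext z; simp
  have e : ∫ q : ℝ × V2, Complex.exp (I * (((t, x).1 * q.1 + ⟪(t, x).2, q.2⟫ : ℝ) : ℂ)) * ftST u q.1 q.2 = ∫ q : ℝ × V2, eST t x q * ftST u q.1 q.2 := rfl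
  rw [e, ← h1, h2]
  exact (enorm_add_le _ _).trans (add_le_add (halfbound hm hi measurableSet_Ici 1 t x) (halfbound hm hi measurableSet_Iio (-1) t x))

lemma HN_eq (s θ : ℝ) (u : ℝ × V2 → ℂ) : HN s θ u =
    (∫⁻ q : ℝ × V2, (ofReal (wgt s θ q.1 q.2) * ‖ftST u q.1 q.2‖ₑ) ^ 2) ^ (1/2:ℝ) := rfl

lemma XX_hw {s θ α p Q : ℝ} (hθ : 1 / 2 < θ) (hp : 1 ≤ p) (hQ : 1 < Q) (hpQ : 2 / p + 2 / Q < 1) (hα0 : 0 ≤ α) (hα1 : α < 1)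
    (he0 : 0 ≤ 1 + α - 2 / Q - 1 / p) (he : 1 + α - 2 / Q - 1 / p ≤ 2 * s) : ∃ C : ℝ≥0∞, C ≠ ∞ ∧
    ∀ (u : SST) (S : Set ℝ) (σ : ℝ), MeasurableSet S → (σ = 1 ∨ σ = -1) → (∀ τ ∈ S, |τ| = σ * τ) →
      XX α p Q (hw u S σ) ≤ C * HN s θ u := by
  obtain ⟨C1, hC1, h1⟩ := free_est hp hQ hpQ hα0 hα1
  obtain ⟨C2, hC2, h2⟩ := HNbound hθ he0 he
  refine ⟨C1 ^ (1/2:ℝ) * C2, by finiteness, fun u S σ hS hσ hSσ => ?_⟩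
  have hm := (ftST_cont u).measurable
  refine (XX_mink volume hp hQ.le (w := fun ρ t x => ‖PP (gr (fun q => ftST u q.1 q.2) S σ ρ) σ univ t x‖ₑ) (PPgr_meas hm hS σ).enorm).trans ?_
  rw [mul_assoc, HN_eq]
  refine le_trans ?_ (mul_le_mul_right (h2 _ S σ hm hS hσ hSσ) _)
  rw [← lintegral_const_mul' _ _ (by finiteness)]
  refine lintegral_mono fun ρ => ?_
  rw [XX, ← mul_rpow_of_nonneg _ _ (by norm_num)]
  exact erl (h1 _ σ hσ (gr_meas' hm hS σ ρ)) (by norm_num)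

lemma XX_bound {s θ α p Q : ℝ} (hθ : 1 / 2 < θ) (hp : 1 ≤ p) (hQ : 1 < Q) (hpQ : 2 / p + 2 / Q < 1) (hα0 : 0 ≤ α) (hα1 : α < 1)
    (he0 : 0 ≤ 1 + α - 2 / Q - 1 / p) (he : 1 + α - 2 / Q - 1 / p ≤ 2 * s) : ∃ C : ℝ≥0∞, C ≠ ∞ ∧
    ∀ (u : SST), XX α p Q (fun t x => ‖u (t, x)‖ₑ) ≤ C * HN s θ u := by
  obtain ⟨c, hc, h1⟩ := hw_bound
  obtain ⟨C, hC, h2⟩ := XX_hw hθ hp hQ hpQ hα0 hα1 he0 he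
  refine ⟨c * (C + C), by finiteness, fun u => ?_⟩
  have hp0 : 0 < p := by linarith
  have hQ0 : 0 < Q := by linarith
  refine (XX_mono hp0 hQ0 (h1 u)).trans ?_
  rw [XX_const hp0 hQ0 hc, mul_assoc, add_mul]
  refine mul_le_mul_right ?_ _
  refine (XX_add hp hQ.le (hw_meas u measurableSet_Ici 1) (hw_meas u measurableSet_Iio (-1))).trans (add_le_add ?_ ?_)
  · exact h2 u _ _ measurableSet_Ici (Or.inl rfl) fun τ hτ => by rw [one_mul]; exact abs_of_nonneg hτ
  · exact h2 u _ _ measurableSet_Iio (Or.inr rfl) fun τ hτ => by rw [neg_one_mul]; exact abs_of_neg hτ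

lemma PP_L2 (g : V2 → ℂ) (hg : Measurable g) (σ t : ℝ) : ∫⁻ x, ‖PP g σ univ t x‖ₑ ^ 2 ≤ ofReal ((2 * π) ^ 2) * ∫⁻ ξ, ‖g ξ‖ₑ ^ 2 := by
  by_cases h : IntegrableOn g univ
  swap
  · simp [PP_zero h]
  have h' : Integrable fun ξ => Complex.exp (((σ * t * ‖ξ‖ : ℝ) : ℂ) * I) * g ξ := by
    rw [integrableOn_univ] at h
    exact h.bdd_mul (c := 1) (Continuous.aestronglyMeasurable (by fun_prop)) (of_forall fun q => by rw [norm_exp_ofReal_mul_I])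
  have := bessel _ h'
  refine le_trans (le_of_eq ?_) (this.trans (le_of_eq ?_))
  · apply lintegral_congr; intro x
    rw [PP, Measure.restrict_univ]
    congr 3
    ext ξ
    rw [← mul_assoc, ← Complex.exp_add, ph]
    congr 2; push_cast; ring
  · congr 1
    apply lintegral_congr; intro x
    rw [enorm_mul, ← ofReal_norm, norm_exp_ofReal_mul_I]; simp

lemma L2_hw {s θ : ℝ} (hθ : 1 / 2 < θ) (hs : 0 < s) : ∃ C : ℝ≥0∞, C ≠ ∞ ∧
    ∀ (u : SST) (S : Set ℝ) (σ t : ℝ), MeasurableSet S → (σ = 1 ∨ σ = -1) → (∀ τ ∈ S, |τ| = σ * τ) →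
      (∫⁻ x, hw u S σ t x ^ (2:ℝ)) ^ (1/2:ℝ) ≤ C * HN s θ u := by
  obtain ⟨C2, hC2, h2⟩ := HNbound (s := s) hθ (le_refl 0) (by linarith)
  refine ⟨ofReal ((2 * π) ^ 2) ^ (1/2:ℝ) * C2, by finiteness, fun u S σ t hS hσ hSσ => ?_⟩
  have hm := (ftST_cont u).measurable
  refine (mink volume volume (p := 2) (by norm_num) (F := fun x ρ => ‖PP (gr (fun q => ftST u q.1 q.2) S σ ρ) σ univ t x‖ₑ) ?_).trans ?_
  · exact Measurable.comp (g := fun z : (ℝ × V2) × ℝ => ‖PP (gr (fun q => ftST u q.1 q.2) S σ z.2) σ univ z.1.1 z.1.2‖ₑ)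
      (f := fun z : V2 × ℝ => ((t, z.1), z.2)) (PPgr_meas hm hS σ).enorm (by fun_prop)
  rw [mul_assoc, HN_eq]
  refine le_trans ?_ (mul_le_mul_right (h2 _ S σ hm hS hσ hSσ) _)
  rw [← lintegral_const_mul' _ _ (by finiteness)]
  refine lintegral_mono fun ρ => ?_
  dsimp only
  rw [← mul_rpow_of_nonneg _ _ (by norm_num)]
  refine erl ?_ (by norm_num)
  have := PP_L2 _ (gr_meas' hm hS σ ρ) σ t
  simpa using this

lemma L2_bound {s θ : ℝ} (hθ : 1 / 2 < θ) (hs : 0 < s) : ∃ C : ℝ≥0∞, C ≠ ∞ ∧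
    ∀ (u : SST) (t : ℝ), (∫⁻ x, ‖u (t, x)‖ₑ ^ (2:ℝ)) ^ (1/2:ℝ) ≤ C * HN s θ u := by
  obtain ⟨c, hc, h1⟩ := hw_bound
  obtain ⟨C, hC, h2⟩ := L2_hw hθ hs
  refine ⟨c * (C + C), by finiteness, fun u t => ?_⟩
  refine (erl (lintegral_mono fun x => erl (h1 u t x) (by norm_num)) (by norm_num)).trans ?_
  simp only [mul_rpow_of_nonneg _ _ (by norm_num : (0:ℝ) ≤ 2)]
  rw [lintegral_const_mul' _ _ (by finiteness), mul_rpow_of_nonneg _ _ (by norm_num : (0:ℝ) ≤ 1/2), ← erm, mul_assoc, add_mul,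
    show (2:ℝ) * (1/2) = 1 by norm_num, ENNReal.rpow_one]
  refine mul_le_mul_right ?_ _
  have hs : ∀ {f : ℝ × V2 → ℝ≥0∞}, Measurable f → ∀ t, Measurable fun x => f (t, x) := fun hf t => hf.comp (by fun_prop)
  refine (ENNReal.lintegral_Lp_add_le (hs (hw_meas u measurableSet_Ici 1) t).aemeasurable (hs (hw_meas u measurableSet_Iio (-1)) t).aemeasurable (by norm_num : (1:ℝ) ≤ 2)).trans (add_le_add ?_ ?_)
  · exact h2 u _ _ t measurableSet_Ici (Or.inl rfl) fun τ hτ => by rw [one_mul]; exact abs_of_nonneg hτ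
  · exact h2 u _ _ t measurableSet_Iio (Or.inr rfl) fun τ hτ => by rw [neg_one_mul]; exact abs_of_neg hτ

section
open scoped FourierTransform LineDeriv
lemma ft2_eq (g : SchwartzMap V2 ℂ) (ξ : V2) : ft2 g ξ = 𝓕 g ((2 * π)⁻¹ • ξ) := by
  rw [SchwartzMap.fourier_coe, Real.fourier_eq', ft2]
  congr 1; ext x
  rw [smul_eq_mul, inner_smul_right]
  congr 2
  have hpi : (π : ℂ) ≠ 0 := by exact_mod_cast pi_ne_zero
  push_cast
  field_simp

def dS (j : Fin 2) (g : SchwartzMap V2 ℂ) : SchwartzMap V2 ℂ := ∂_{(EuclideanSpace.single j 1 : V2)} g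

lemma dS_apply (j : Fin 2) (g : SchwartzMap V2 ℂ) (x : V2) : dS j g x = fderiv ℝ g x (EuclideanSpace.single j 1) := rfl

lemma ft2_deriv (g : SchwartzMap V2 ℂ) (j : Fin 2) (ξ : V2) :
    ft2 (dS j g) ξ = I * (ξ j : ℂ) * ft2 g ξ := by
  rw [ft2_eq, dS, SchwartzMap.fourier_lineDerivOp_eq, ft2_eq, SchwartzMap.smul_apply, SchwartzMap.smulLeftCLM_apply_apply (by fun_prop)]
  rw [real_inner_comm, EuclideanSpace.inner_single_left]
  have hpi : (π : ℂ) ≠ 0 := by exact_mod_cast pi_ne_zero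
  simp
  field_simp

lemma ft2_add (g h : SchwartzMap V2 ℂ) (ξ : V2) : ft2 ⇑(g + h) ξ = ft2 g ξ + ft2 h ξ := by
  simp only [ft2_eq]
  rw [FourierTransform.fourier_add]; rfl

lemma ft2_lap (A G0 G1 : SchwartzMap V2 ℂ)
    (h : dS 0 (dS 0 A) + dS 1 (dS 1 A) = dS 0 G0 + dS 1 G1) (ξ : V2) :
    ((‖ξ‖ ^ 2 : ℝ) : ℂ) * ft2 A ξ = -I * ((ξ 0 : ℂ) * ft2 G0 ξ + (ξ 1 : ℂ) * ft2 G1 ξ) := by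
  have h2 := congrArg (fun F : SchwartzMap V2 ℂ => ft2 F ξ) h
  simp only [ft2_add, ft2_deriv] at h2
  have e : ‖ξ‖ ^ 2 = ξ 0 ^ 2 + ξ 1 ^ 2 := by
    rw [EuclideanSpace.norm_sq_eq]; simp
  rw [e]
  push_cast
  linear_combination -h2 + (((ξ 0 : ℂ) ^ 2 + (ξ 1 : ℂ) ^ 2) * ft2 A ξ) * Complex.I_sq

lemma ft2_cont (g : SchwartzMap V2 ℂ) : Continuous (ft2 g) := by
  have : ft2 g = fun ξ => 𝓕 g ((2 * π)⁻¹ • ξ) := funext (ft2_eq g)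
  rw [this]
  exact (𝓕 g).continuous.comp (by fun_prop)

lemma ft2_int (g : SchwartzMap V2 ℂ) {α : ℝ} (hα0 : 0 ≤ α) (hα1 : α ≤ 1) : Integrable fun ξ => ((‖ξ‖ ^ α : ℝ) : ℂ) * ft2 g ξ := by
  have h0 : Integrable fun ξ : V2 => ‖ξ‖ ^ 0 * ‖𝓕 g ξ‖ := (𝓕 g).integrable_pow_mul volume 0
  have h1 : Integrable fun ξ : V2 => ‖ξ‖ ^ 1 * ‖𝓕 g ξ‖ := (𝓕 g).integrable_pow_mul volume 1
  have h2 := (h0.comp_smul (R := (2 * π)⁻¹) (by positivity)).add ((h1.comp_smul (R := (2 * π)⁻¹) (by positivity)).const_mul (2 * π))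
  refine h2.mono ?_ (of_forall fun ξ => ?_)
  · refine Measurable.aestronglyMeasurable (Measurable.mul ?_ (ft2_cont g).measurable)
    exact Complex.measurable_ofReal.comp (by fun_prop)
  · have : ‖ξ‖ ^ α ≤ 1 + ‖ξ‖ := by
      rcases le_total ‖ξ‖ 1 with h | h
      · have := Real.rpow_le_one (norm_nonneg ξ) h hα0
        linarith [norm_nonneg ξ]
      · have := Real.rpow_le_rpow_of_exponent_le h hα1
        rw [Real.rpow_one] at this; linarith
    rw [norm_mul, norm_real, Real.norm_of_nonneg (by positivity), ft2_eq]
    refine (mul_le_mul_of_nonneg_right this (norm_nonneg _)).trans (le_trans (le_of_eq ?_) (le_abs_self _))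
    simp only [Pi.add_apply, norm_smul, Real.norm_of_nonneg (show 0 ≤ (2 * π)⁻¹ by positivity)]
    have := pi_pos
    field_simp

lemma ft2_inv (g : SchwartzMap V2 ℂ) (x : V2) : g x = ift2 (fun ξ => ft2 g ξ) x := by
  have h := congrArg (fun F : SchwartzMap V2 ℂ => F x) (FourierTransform.fourierInv_fourier_eq (F := SchwartzMap V2 ℂ) g)
  simp only [SchwartzMap.fourierInv_coe] at h
  rw [← h, Real.fourierInv_eq', ift2]
  have h2 := Measure.integral_comp_inv_smul (volume : Measure V2) (fun ξ => Complex.exp (I * ((2 * π * ⟪x, ξ⟫ : ℝ) : ℂ)) * 𝓕 g ξ) (2 * π)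
  have e : ∀ ξ : V2, Complex.exp (I * ((2 * π * ⟪x, (2 * π)⁻¹ • ξ⟫ : ℝ) : ℂ)) * 𝓕 g ((2 * π)⁻¹ • ξ) =
      Complex.exp (I * ((⟪x, ξ⟫ : ℝ) : ℂ)) * ft2 g ξ := by
    intro ξ
    rw [ft2_eq]
    congr 4
    rw [inner_smul_right]
    field_simp
  simp only [e] at h2
  rw [h2, Complex.real_smul, ← mul_assoc, ← Complex.ofReal_mul]
  have : ((2 * π) ^ 2)⁻¹ * |(2 * π) ^ Module.finrank ℝ V2| = 1 := by
    rw [finrank_euclideanSpace_fin, abs_of_nonneg (by positivity), inv_mul_cancel₀ (by positivity)]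
  rw [this, Complex.ofReal_one, one_mul]
  congr 1; ext ξ
  rw [smul_eq_mul, real_inner_comm]
  congr 2
  push_cast; ring
end


lemma gint {h : ℝ} (hh : 0 < h) : Integrable fun ξ : V2 => Complex.exp (-(h:ℂ) * (‖ξ‖:ℂ) ^ 2) := by
  have := GaussianFourier.integrable_cexp_neg_mul_sq_norm_add (V := V2) (b := (h:ℂ)) (by simpa using hh) 0 0
  simpa using this

lemma gnorm (h : ℝ) (ξ : V2) : ‖Complex.exp (-(h:ℂ) * (‖ξ‖:ℂ) ^ 2)‖ = Real.exp (-h * ‖ξ‖ ^ 2) := by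
  rw [Complex.norm_exp]; congr 1
  have : -(h:ℂ) * (‖ξ‖:ℂ) ^ 2 = ((-h * ‖ξ‖ ^ 2 : ℝ) : ℂ) := by push_cast; ring
  rw [this, Complex.ofReal_re]

lemma gint1 {h : ℝ} (hh : 0 < h) (j : Fin 2) : Integrable fun ξ : V2 => ((ξ j : ℝ):ℂ) * Complex.exp (-(h:ℂ) * (‖ξ‖:ℂ) ^ 2) := by
  have h1 := (gint (half_pos hh)).const_mul ((1 + 2 / h : ℝ) : ℂ)
  refine h1.mono (Continuous.aestronglyMeasurable (by fun_prop)) (of_forall fun ξ => ?_)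
  rw [norm_mul, norm_mul, gnorm, gnorm, norm_real, norm_real, Real.norm_of_nonneg (by positivity : 0 ≤ 1 + 2 / h)]
  have e : Real.exp (-h * ‖ξ‖ ^ 2) = Real.exp (-(h/2) * ‖ξ‖ ^ 2) * Real.exp (-(h/2) * ‖ξ‖ ^ 2) := by
    rw [← Real.exp_add]; congr 1; ring
  have h2 : ‖ξ j‖ ≤ ‖ξ‖ := PiLp.norm_apply_le ξ j
  have h3 : ‖ξ‖ ≤ 1 + ‖ξ‖ ^ 2 := by nlinarith [sq_nonneg (‖ξ‖ - 1)]
  have h4 : ‖ξ‖ ^ 2 * Real.exp (-(h/2) * ‖ξ‖ ^ 2) ≤ 2 / h := by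
    have := Real.add_one_le_exp (h / 2 * ‖ξ‖ ^ 2)
    rw [neg_mul, Real.exp_neg, ← div_eq_mul_inv, div_le_div_iff₀ (Real.exp_pos _) hh]
    nlinarith
  have h5 : Real.exp (-(h/2) * ‖ξ‖ ^ 2) ≤ 1 := Real.exp_le_one_iff.2 (by nlinarith [sq_nonneg ‖ξ‖, mul_nonneg hh.le (sq_nonneg ‖ξ‖)])
  have h0 := Real.exp_pos (-(h/2) * ‖ξ‖ ^ 2)
  rw [e, ← mul_assoc]
  refine mul_le_mul_of_nonneg_right ?_ h0.le
  calc ‖ξ j‖ * Real.exp (-(h/2) * ‖ξ‖ ^ 2) ≤ (1 + ‖ξ‖ ^ 2) * Real.exp (-(h/2) * ‖ξ‖ ^ 2) := mul_le_mul_of_nonneg_right (h2.trans h3) h0.le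
    _ ≤ _ := by nlinarith

lemma ephn (z : ℝ) : ‖Complex.exp (I * (z:ℂ))‖ = 1 := by rw [mul_comm, norm_exp_ofReal_mul_I]

lemma gK {h : ℝ} (hh : 0 < h) (j : Fin 2) (z : V2) :
    ∫ ξ : V2, Complex.exp (I * ((⟪z, ξ⟫ : ℝ) : ℂ)) * (((ξ j : ℝ):ℂ) * Complex.exp (-(h:ℂ) * (‖ξ‖:ℂ) ^ 2)) =
      (I * (z j : ℂ) / (2 * h)) * ((π / h : ℝ) * (Real.exp (-(‖z‖ ^ 2) / (4 * h)) : ℝ)) := by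
  have hh' : (h:ℂ) ≠ 0 := by exact_mod_cast hh.ne'
  have hf : ∀ ξ : V2, HasFDerivAt (fun ξ : V2 => Complex.exp (I * ((⟪z, ξ⟫ : ℝ) : ℂ)))
      (Complex.exp (I * ((⟪z, ξ⟫ : ℝ) : ℂ)) • (I • (Complex.ofRealCLM.comp (innerSL ℝ z)))) ξ := fun ξ =>
    ((Complex.ofRealCLM.comp (innerSL ℝ z)).hasFDerivAt.const_mul I).cexp
  have hn : ∀ ξ : V2, HasFDerivAt (fun ξ : V2 => (‖ξ‖ ^ 2 : ℝ)) (2 • (innerSL ℝ ξ)) ξ := fun ξ => (hasStrictFDerivAt_norm_sq ξ).hasFDerivAt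
  have hg : ∀ ξ : V2, HasFDerivAt (fun ξ : V2 => Complex.exp (-(h:ℂ) * (‖ξ‖:ℂ) ^ 2))
      (Complex.exp (-(h:ℂ) * (‖ξ‖:ℂ) ^ 2) • (-(h:ℂ) • (Complex.ofRealCLM.comp (2 • (innerSL ℝ ξ))))) ξ := fun ξ => by
    have h1 : HasFDerivAt (fun ξ : V2 => (‖ξ‖:ℂ) ^ 2) (Complex.ofRealCLM.comp (2 • (innerSL ℝ ξ))) ξ := by
      have := Complex.ofRealCLM.hasFDerivAt.comp ξ (hn ξ)
      refine this.congr_of_eventuallyEq (of_forall fun y => ?_)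
      simp
    exact (h1.const_mul (-(h:ℂ))).cexp
  set e : V2 := EuclideanSpace.single j 1 with he
  have dz : ⟪z, e⟫ = z j := by rw [he, real_inner_comm, EuclideanSpace.inner_single_left]; simp
  have dξ : ∀ ξ : V2, ⟪ξ, e⟫ = ξ j := fun ξ => by rw [he, real_inner_comm, EuclideanSpace.inner_single_left]; simp
  have df : ∀ ξ : V2, fderiv ℝ (fun ξ : V2 => Complex.exp (I * ((⟪z, ξ⟫ : ℝ) : ℂ))) ξ e = I * (z j : ℂ) * Complex.exp (I * ((⟪z, ξ⟫ : ℝ) : ℂ)) := fun ξ => by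
    rw [(hf ξ).fderiv]; simp [dz]; ring
  have dg : ∀ ξ : V2, fderiv ℝ (fun ξ : V2 => Complex.exp (-(h:ℂ) * (‖ξ‖:ℂ) ^ 2)) ξ e = -(2 * h) * (((ξ j : ℝ) : ℂ) * Complex.exp (-(h:ℂ) * (‖ξ‖:ℂ) ^ 2)) := fun ξ => by
    rw [(hg ξ).fderiv]; simp [dξ]; ring
  have i0 : Integrable fun ξ : V2 => Complex.exp (I * ((⟪z, ξ⟫ : ℝ) : ℂ)) * Complex.exp (-(h:ℂ) * (‖ξ‖:ℂ) ^ 2) :=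
    (gint hh).bdd_mul (c := 1) (Continuous.aestronglyMeasurable (by fun_prop)) (of_forall fun ξ => (ephn _).le)
  have i1 : Integrable fun ξ : V2 => Complex.exp (I * ((⟪z, ξ⟫ : ℝ) : ℂ)) * (((ξ j : ℝ):ℂ) * Complex.exp (-(h:ℂ) * (‖ξ‖:ℂ) ^ 2)) :=
    (gint1 hh j).bdd_mul (c := 1) (Continuous.aestronglyMeasurable (by fun_prop)) (of_forall fun ξ => (ephn _).le)
  have key := integral_mul_fderiv_eq_neg_fderiv_mul_of_integrable (μ := (volume : Measure V2)) (v := e)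
    (f := fun ξ : V2 => Complex.exp (I * ((⟪z, ξ⟫ : ℝ) : ℂ))) (g := fun ξ : V2 => Complex.exp (-(h:ℂ) * (‖ξ‖:ℂ) ^ 2))
    (by simp only [df, mul_assoc]; simpa only [mul_assoc] using i0.const_mul (I * (z j : ℂ)))
    (by simp only [dg]; simpa only [mul_left_comm] using i1.const_mul (-(2 * h) : ℂ))
    i0 (fun ξ _ => (hf ξ).differentiableAt) (fun ξ _ => (hg ξ).differentiableAt)
  have gv := GaussianFourier.integral_cexp_neg_mul_sq_norm_add (V := V2) (b := (h:ℂ)) (by simpa using hh) I z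
  have gv2 : ∫ ξ : V2, Complex.exp (I * ((⟪z, ξ⟫ : ℝ) : ℂ)) * Complex.exp (-(h:ℂ) * (‖ξ‖:ℂ) ^ 2) = (π / h : ℝ) * (Real.exp (-(‖z‖ ^ 2) / (4 * h)) : ℝ) := by
    have e1 : ∀ ξ : V2, Complex.exp (I * ((⟪z, ξ⟫ : ℝ) : ℂ)) * Complex.exp (-(h:ℂ) * (‖ξ‖:ℂ) ^ 2) = Complex.exp (-(h:ℂ) * (‖ξ‖:ℂ) ^ 2 + I * ((⟪z, ξ⟫ : ℝ) : ℂ)) := fun ξ => by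
      rw [← Complex.exp_add, add_comm]
    simp only [e1]
    rw [gv, finrank_euclideanSpace_fin]
    push_cast
    rw [Complex.I_sq]
    norm_num
  simp only [df, dg] at key
  have k1 : ∀ ξ : V2, Complex.exp (I * ((⟪z, ξ⟫ : ℝ) : ℂ)) * (-(2 * (h:ℂ)) * (((ξ j : ℝ):ℂ) * Complex.exp (-(h:ℂ) * (‖ξ‖:ℂ) ^ 2))) = -(2 * (h:ℂ)) * (Complex.exp (I * ((⟪z, ξ⟫ : ℝ) : ℂ)) * (((ξ j : ℝ):ℂ) * Complex.exp (-(h:ℂ) * (‖ξ‖:ℂ) ^ 2))) := fun ξ => by ring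
  have k2 : ∀ ξ : V2, I * (z j : ℂ) * Complex.exp (I * ((⟪z, ξ⟫ : ℝ) : ℂ)) * Complex.exp (-(h:ℂ) * (‖ξ‖:ℂ) ^ 2) = I * (z j : ℂ) * (Complex.exp (I * ((⟪z, ξ⟫ : ℝ) : ℂ)) * Complex.exp (-(h:ℂ) * (‖ξ‖:ℂ) ^ 2)) := fun ξ => by ring
  simp only [k1, k2] at key
  rw [integral_const_mul, integral_const_mul, gv2] at key
  rw [div_mul_eq_mul_div, eq_div_iff (by simpa using hh')]
  linear_combination -key

lemma hconv {h : ℝ} (hh : 0 < h) (j : Fin 2) (G : SchwartzMap V2 ℂ) (x : V2) :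
    ‖∫ ξ : V2, Complex.exp (I * ((⟪x, ξ⟫ : ℝ) : ℂ)) * (((ξ j : ℝ):ℂ) * Complex.exp (-(h:ℂ) * (‖ξ‖:ℂ) ^ 2)) * ft2 G ξ‖ₑ ≤
      ∫⁻ y, ofReal (π / 2 * (h ^ (-2:ℝ) * ‖x - y‖ * Real.exp (-(‖x - y‖ ^ 2) / (4 * h)))) * ‖G y‖ₑ := by
  have hi : Integrable (fun z : V2 × V2 => Complex.exp (I * ((⟪x - z.2, z.1⟫ : ℝ) : ℂ)) * ((((z.1 j : ℝ):ℂ) * Complex.exp (-(h:ℂ) * (‖z.1‖:ℂ) ^ 2)) * G z.2)) (volume.prod volume) := by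
    refine ((gint1 hh j).mul_prod G.integrable).bdd_mul (c := 1) (Continuous.aestronglyMeasurable (by fun_prop)) (of_forall fun ξ => (ephn _).le)
  have e1 : ∀ ξ : V2, Complex.exp (I * ((⟪x, ξ⟫ : ℝ) : ℂ)) * (((ξ j : ℝ):ℂ) * Complex.exp (-(h:ℂ) * (‖ξ‖:ℂ) ^ 2)) * ft2 G ξ =
      ∫ y, Complex.exp (I * ((⟪x - y, ξ⟫ : ℝ) : ℂ)) * ((((ξ j : ℝ):ℂ) * Complex.exp (-(h:ℂ) * (‖ξ‖:ℂ) ^ 2)) * G y) := fun ξ => by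
    rw [ft2, ← integral_const_mul]
    congr 1; ext y
    rw [inner_sub_left, Complex.ofReal_sub, mul_sub, sub_eq_add_neg, Complex.exp_add, neg_mul]
    ring
  simp only [e1]
  rw [integral_integral_swap (f := fun (ξ y : V2) => Complex.exp (I * ((⟪x - y, ξ⟫ : ℝ) : ℂ)) * ((((ξ j : ℝ):ℂ) * Complex.exp (-(h:ℂ) * (‖ξ‖:ℂ) ^ 2)) * G y)) hi]
  refine (enorm_integral_le_lintegral_enorm _).trans (lintegral_mono fun y => ?_)
  have e2 : ∀ ξ : V2, Complex.exp (I * ((⟪x - y, ξ⟫ : ℝ) : ℂ)) * ((((ξ j : ℝ):ℂ) * Complex.exp (-(h:ℂ) * (‖ξ‖:ℂ) ^ 2)) * G y) =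
    Complex.exp (I * ((⟪x - y, ξ⟫ : ℝ) : ℂ)) * (((ξ j : ℝ):ℂ) * Complex.exp (-(h:ℂ) * (‖ξ‖:ℂ) ^ 2)) * G y := fun ξ => by ring
  simp only [e2]
  rw [integral_mul_const, gK hh, enorm_mul]
  refine mul_le_mul_left ?_ _
  rw [← ofReal_norm]
  refine ofReal_le_ofReal ?_
  rw [norm_mul, norm_mul, norm_div, norm_mul, norm_mul, Complex.norm_I, norm_real, norm_real, norm_real, norm_real]
  have h2 : ‖(x - y) j‖ ≤ ‖x - y‖ := PiLp.norm_apply_le (x - y) j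
  have hp := pi_pos
  rw [Real.norm_of_nonneg hh.le, Real.norm_of_nonneg (by positivity : 0 ≤ π / h), Real.norm_of_nonneg (Real.exp_pos _).le, Real.rpow_neg hh.le]
  have : ‖(2:ℂ)‖ = 2 := by simp
  rw [this]
  calc 1 * ‖(x - y) j‖ / (2 * h) * (π / h * Real.exp (-(‖x - y‖ ^ 2) / (4 * h)))
      ≤ 1 * ‖x - y‖ / (2 * h) * (π / h * Real.exp (-(‖x - y‖ ^ 2) / (4 * h))) := by gcongr
    _ = _ := by
      norm_num
      field_simp

lemma hker {α : ℝ} (hα0 : 0 ≤ α) (hα1 : α < 1) : ∃ C : ℝ≥0∞, C ≠ ∞ ∧ ∀ r : ℝ, 0 < r →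
    ∫⁻ h in Ioi (0:ℝ), ofReal (h ^ (-(α/2))) * ofReal (π / 2 * (h ^ (-2:ℝ) * r * Real.exp (-(r ^ 2) / (4 * h)))) ≤ C * ofReal (r ^ (-(1 + α))) := by
  refine ⟨ofReal (π / 2 * 32 / (1 - α/2)) + ofReal (π / 2 / (1 + α / 2)), by finiteness, fun r hr => ?_⟩
  have hp := pi_pos
  have hr2 : 0 < r ^ 2 := by positivity
  have e0 : ∀ c : ℝ, r ^ c = (r ^ 2) ^ (c / 2) := fun c => by
    rw [← Real.rpow_natCast, ← Real.rpow_mul hr.le]; congr 1; push_cast; ring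
  rw [← Set.Ioc_union_Ioi_eq_Ioi hr2.le, add_mul]
  refine (lintegral_union_le _ _ _).trans (add_le_add ?_ ?_)
  · have h1 : ∀ h ∈ Ioc 0 (r^2), ofReal (h ^ (-(α/2))) * ofReal (π / 2 * (h ^ (-2:ℝ) * r * Real.exp (-(r ^ 2) / (4 * h)))) ≤
        ofReal (π / 2 * 32 * (r / (r^2)^2)) * ofReal (h ^ ((1 - α/2) - 1)) := by
      intro h hh
      have hh0 : 0 < h := hh.1
      rw [mul_comm, ← ofReal_mul (by positivity), ← ofReal_mul (by positivity)]
      refine ofReal_le_ofReal ?_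
      rw [show 1 - α/2 - 1 = -(α/2) by ring]
      refine mul_le_mul_of_nonneg_right ?_ (by positivity)
      rw [mul_assoc (π / 2) 32]
      refine mul_le_mul_of_nonneg_left ?_ (by positivity)
      have h3 : Real.exp (-(r ^ 2) / (4 * h)) ≤ 32 * (h ^ 2 / (r^2)^2) := by
        have h4 := Real.quadratic_le_exp_of_nonneg (x := r ^ 2 / (4 * h)) (by positivity)
        have h5 : (r ^ 2 / (4 * h)) ^ 2 / 2 ≤ Real.exp (r ^ 2 / (4 * h)) := by
          have : 0 ≤ r ^ 2 / (4 * h) := by positivity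
          linarith
        rw [neg_div, Real.exp_neg]
        refine (inv_anti₀ (by positivity) h5).trans (le_of_eq ?_)
        field_simp; norm_num
      rw [Real.rpow_neg hh0.le]
      calc (h ^ (2:ℝ))⁻¹ * r * Real.exp (-(r ^ 2) / (4 * h)) ≤ (h ^ (2:ℝ))⁻¹ * r * (32 * (h ^ 2 / (r^2)^2)) := by gcongr
        _ = 32 * (r / (r^2)^2) := by
          norm_num
          field_simp
    refine (setLIntegral_mono' measurableSet_Ioc h1).trans (le_of_eq ?_)
    rw [lintegral_const_mul' _ _ (by finiteness), lint_Ioc_rpow (by linarith) hr2.le, ← ofReal_mul (by positivity), ← ofReal_mul (by apply div_nonneg <;> linarith)]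
    congr 1
    have : r / (r^2)^2 * (r^2) ^ (1 - α/2) = r ^ (-(1+α)) := by
      rw [show (r^2)^2 = r ^ (4:ℝ) by norm_num; ring, show (1 - α/2) = (2 - α) / 2 by ring, ← e0]
      nth_rewrite 1 [← Real.rpow_one r]
      rw [← Real.rpow_sub hr, ← Real.rpow_add hr]; congr 1; ring
    rw [← this]; ring
  · have h1 : ∀ h ∈ Ioi (r^2), ofReal (h ^ (-(α/2))) * ofReal (π / 2 * (h ^ (-2:ℝ) * r * Real.exp (-(r ^ 2) / (4 * h)))) ≤
        ofReal (π / 2 * r) * ofReal (h ^ (-(1 + α/2) - 1)) := by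
      intro h hh
      have hh0 : 0 < h := hr2.trans hh
      rw [← ofReal_mul (by positivity), ← ofReal_mul (by positivity)]
      refine ofReal_le_ofReal ?_
      rw [show -(1 + α/2) - 1 = -(α/2) + -2 by ring, Real.rpow_add hh0]
      have : Real.exp (-(r ^ 2) / (4 * h)) ≤ 1 := Real.exp_le_one_iff.2 (by rw [neg_div]; exact neg_nonpos.2 (by positivity))
      calc h ^ (-(α/2)) * (π / 2 * (h ^ (-2:ℝ) * r * Real.exp (-(r ^ 2) / (4 * h)))) ≤ h ^ (-(α/2)) * (π / 2 * (h ^ (-2:ℝ) * r * 1)) := by gcongr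
        _ = _ := by ring
    refine (setLIntegral_mono' measurableSet_Ioi h1).trans (le_of_eq ?_)
    rw [lintegral_const_mul' _ _ (by finiteness), lint_Ioi_rpow (by linarith) hr2, ← ofReal_mul (by positivity), ← ofReal_mul (by positivity)]
    congr 1
    have : r * (r^2) ^ (-(1 + α/2)) = r ^ (-(1+α)) := by
      rw [show -(1 + α/2) = (-2 - α) / 2 by ring, ← e0]
      nth_rewrite 1 [← Real.rpow_one r]
      rw [← Real.rpow_add hr]; congr 1; ring
    rw [← this]; ring

lemma gam {α : ℝ} (hα1 : α < 1) {r : ℝ} (hr : 0 < r) :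
    ∫ h in Ioi (0:ℝ), h ^ (-(α/2)) * Real.exp (-h * r ^ 2) = Real.Gamma (1 - α/2) * r ^ (α - 2) := by
  have := Real.integral_rpow_mul_exp_neg_mul_Ioi (a := 1 - α/2) (r := r ^ 2) (by linarith) (by positivity)
  rw [show 1 - α/2 - 1 = -(α/2) by ring] at this
  have e : ∀ h : ℝ, -h * r ^ 2 = -(r ^ 2 * h) := fun h => by ring
  simp only [e]
  rw [this, mul_comm]
  congr 1
  rw [one_div, ← Real.rpow_natCast, ← Real.rpow_neg hr.le, ← Real.rpow_mul hr.le]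
  congr 1; push_cast; ring

lemma gam_int {α : ℝ} (hα1 : α < 1) {r : ℝ} (hr : 0 < r) :
    IntegrableOn (fun h : ℝ => h ^ (-(α/2)) * Real.exp (-h * r ^ 2)) (Ioi 0) := by
  by_contra hc
  have h1 := integral_undef hc
  rw [gam hα1 hr] at h1
  have : 0 < Real.Gamma (1 - α/2) := Real.Gamma_pos_of_pos (by linarith)
  have : 0 < r ^ (α - 2) := by positivity
  have : 0 < Real.Gamma (1 - α/2) * r ^ (α - 2) := by positivity
  linarith

def Wk (α : ℝ) (A : V2 → ℂ) (ξ : V2) (h : ℝ) : ℂ :=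
  ((h ^ (-(α/2)) * Real.exp (-h * ‖ξ‖ ^ 2) : ℝ) : ℂ) * (((‖ξ‖ ^ 2 : ℝ) : ℂ) * ft2 A ξ)

lemma Wk_meas (α : ℝ) (A : SchwartzMap V2 ℂ) : Measurable fun z : V2 × ℝ => Wk α A z.1 z.2 := by
  unfold Wk
  refine Measurable.mul (Complex.measurable_ofReal.comp (by fun_prop)) (Measurable.mul (Complex.measurable_ofReal.comp (by fun_prop)) ?_)
  exact (ft2_cont A).measurable.comp measurable_fst

lemma Wk_val {α : ℝ} (hα1 : α < 1) (A : SchwartzMap V2 ℂ) {ξ : V2} (hξ : ξ ≠ 0) :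
    ∫ h in Ioi (0:ℝ), Wk α A ξ h = (Real.Gamma (1 - α/2) : ℂ) * (((‖ξ‖ ^ α : ℝ) : ℂ) * ft2 A ξ) := by
  have hr : 0 < ‖ξ‖ := norm_pos_iff.2 hξ
  unfold Wk
  rw [integral_mul_const, integral_complex_ofReal, gam hα1 hr, ← mul_assoc, ← mul_assoc]
  congr 1
  rw [← Complex.ofReal_mul, ← Complex.ofReal_mul, mul_assoc]
  congr 2
  rw [← Real.rpow_natCast, ← Real.rpow_add hr]; congr 1; push_cast; ring

lemma Wk_nval {α : ℝ} (hα1 : α < 1) (A : SchwartzMap V2 ℂ) {ξ : V2} (hξ : ξ ≠ 0) :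
    ∫ h in Ioi (0:ℝ), ‖Wk α A ξ h‖ = Real.Gamma (1 - α/2) * ‖((‖ξ‖ ^ α : ℝ) : ℂ) * ft2 A ξ‖ := by
  have hr : 0 < ‖ξ‖ := norm_pos_iff.2 hξ
  have e : ∀ h ∈ Ioi (0:ℝ), ‖Wk α A ξ h‖ = (h ^ (-(α/2)) * Real.exp (-h * ‖ξ‖ ^ 2)) * (‖ξ‖ ^ 2 * ‖ft2 A ξ‖) := by
    intro h hh
    have hh0 : 0 < h := hh
    rw [Wk, norm_mul, norm_mul, norm_real, norm_real, Real.norm_of_nonneg (by positivity), Real.norm_of_nonneg (by positivity)]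
  rw [setIntegral_congr_fun measurableSet_Ioi e, integral_mul_const, gam hα1 hr, norm_mul, norm_real, Real.norm_of_nonneg (by positivity), ← mul_assoc, ← mul_assoc]
  congr 1
  rw [mul_assoc]; congr 1
  rw [← Real.rpow_natCast, ← Real.rpow_add hr]; congr 1; push_cast; ring

lemma Wk_int {α : ℝ} (hα0 : 0 ≤ α) (hα1 : α < 1) (A : SchwartzMap V2 ℂ) :
    Integrable (fun z : V2 × ℝ => Wk α A z.1 z.2) (volume.prod (volume.restrict (Ioi 0))) := by
  have hne : ∀ᵐ ξ : V2, ξ ≠ 0 := by simp [ae_iff]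
  rw [integrable_prod_iff (Wk_meas α A).aestronglyMeasurable]
  constructor
  · filter_upwards [hne] with ξ hξ
    exact ((gam_int hα1 (norm_pos_iff.2 hξ)).ofReal (𝕜 := ℂ)).mul_const _
  · refine ((ft2_int A hα0 hα1.le).norm.const_mul (Real.Gamma (1 - α/2))).congr ?_
    filter_upwards [hne] with ξ hξ
    exact (Wk_nval hα1 A hξ).symm

lemma gFi {h : ℝ} (hh : 0 < h) (j : Fin 2) (G : SchwartzMap V2 ℂ) (x : V2) :
    Integrable fun ξ : V2 => Complex.exp (I * ((⟪x, ξ⟫ : ℝ) : ℂ)) * (((ξ j : ℝ):ℂ) * Complex.exp (-(h:ℂ) * (‖ξ‖:ℂ) ^ 2)) * ft2 G ξ := by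
  have h1 := (ft2_int G zero_le_one le_rfl)
  refine h1.mono (Continuous.aestronglyMeasurable ?_) (of_forall fun ξ => ?_)
  · have := ft2_cont G
    fun_prop
  · rw [norm_mul, norm_mul, norm_mul, norm_mul, ephn, gnorm, norm_real, norm_real, Real.rpow_one, one_mul, norm_norm]
    refine mul_le_mul_of_nonneg_right ?_ (norm_nonneg _)
    have h2 : ‖ξ j‖ ≤ ‖ξ‖ := PiLp.norm_apply_le ξ j
    have h5 : Real.exp (-h * ‖ξ‖ ^ 2) ≤ 1 := Real.exp_le_one_iff.2 (by nlinarith [mul_nonneg hh.le (sq_nonneg ‖ξ‖)])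
    calc _ ≤ ‖ξ‖ * 1 := mul_le_mul h2 h5 (Real.exp_pos _).le (norm_nonneg _)
      _ = _ := mul_one _

lemma repr_est {α : ℝ} (hα0 : 0 ≤ α) (hα1 : α < 1) : ∃ C : ℝ≥0∞, C ≠ ∞ ∧ ∀ A G0 G1 : SchwartzMap V2 ℂ,
    dS 0 (dS 0 A) + dS 1 (dS 1 A) = dS 0 G0 + dS 1 G1 → ∀ x,
    ‖ift2 (fun ξ => ((‖ξ‖ ^ α : ℝ) : ℂ) * ft2 A ξ) x‖ₑ ≤ C * ∫⁻ y, (‖G0 y‖ₑ + ‖G1 y‖ₑ) * ofReal (‖x - y‖ ^ (-(1 + α))) := by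
  obtain ⟨C, hC, hk⟩ := hker hα0 hα1
  have hG0 : 0 < Real.Gamma (1 - α/2) := Real.Gamma_pos_of_pos (by linarith)
  have hne : ∀ᵐ ξ : V2, ξ ≠ 0 := by simp [ae_iff]
  refine ⟨‖((((2 * π) ^ 2)⁻¹ : ℝ) : ℂ)‖ₑ * ‖((Real.Gamma (1 - α/2))⁻¹ : ℂ)‖ₑ * C, by finiteness, fun A G0 G1 hA x => ?_⟩
  have e1 : ∫ ξ : V2, Complex.exp (I * ((⟪x, ξ⟫ : ℝ) : ℂ)) * (((‖ξ‖ ^ α : ℝ) : ℂ) * ft2 A ξ) =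
      ((Real.Gamma (1 - α/2))⁻¹ : ℂ) * ∫ ξ : V2, ∫ h in Ioi (0:ℝ), Complex.exp (I * ((⟪x, ξ⟫ : ℝ) : ℂ)) * Wk α A ξ h := by
    rw [← integral_const_mul]
    apply integral_congr_ae
    filter_upwards [hne] with ξ hξ
    rw [integral_const_mul, Wk_val hα1 A hξ]
    have : (Real.Gamma (1 - α/2) : ℂ) ≠ 0 := by exact_mod_cast hG0.ne'
    rw [mul_left_comm (Complex.exp _) (Real.Gamma (1 - α/2) : ℂ), inv_mul_cancel_left₀ this]
  have hi : Integrable (fun z : V2 × ℝ => Complex.exp (I * ((⟪x, z.1⟫ : ℝ) : ℂ)) * Wk α A z.1 z.2) (volume.prod (volume.restrict (Ioi 0))) :=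
    (Wk_int hα0 hα1 A).bdd_mul (c := 1) (Continuous.aestronglyMeasurable (by fun_prop)) (of_forall fun ξ => (ephn _).le)
  rw [ift2, e1, integral_integral_swap (f := fun (ξ : V2) (h : ℝ) => Complex.exp (I * ((⟪x, ξ⟫ : ℝ) : ℂ)) * Wk α A ξ h) hi, enorm_mul, enorm_mul, mul_assoc, mul_assoc]
  refine mul_le_mul_right (mul_le_mul_right ?_ _) _
  have e2 : ∀ h ∈ Ioi (0:ℝ), ‖∫ ξ : V2, Complex.exp (I * ((⟪x, ξ⟫ : ℝ) : ℂ)) * Wk α A ξ h‖ₑ ≤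
      ∫⁻ y, ofReal (h ^ (-(α/2))) * ofReal (π / 2 * (h ^ (-2:ℝ) * ‖x - y‖ * Real.exp (-(‖x - y‖ ^ 2) / (4 * h)))) * (‖G0 y‖ₑ + ‖G1 y‖ₑ) := by
    intro h hh
    have hh0 : 0 < h := hh
    have e3 : ∀ ξ : V2, Complex.exp (I * ((⟪x, ξ⟫ : ℝ) : ℂ)) * Wk α A ξ h = (((h ^ (-(α/2)) : ℝ) : ℂ) * -I) *
        (Complex.exp (I * ((⟪x, ξ⟫ : ℝ) : ℂ)) * (((ξ 0 : ℝ):ℂ) * Complex.exp (-(h:ℂ) * (‖ξ‖:ℂ) ^ 2)) * ft2 G0 ξ +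
          Complex.exp (I * ((⟪x, ξ⟫ : ℝ) : ℂ)) * (((ξ 1 : ℝ):ℂ) * Complex.exp (-(h:ℂ) * (‖ξ‖:ℂ) ^ 2)) * ft2 G1 ξ) := fun ξ => by
      rw [Wk, ft2_lap A G0 G1 hA]
      push_cast
      ring
    simp only [e3]
    rw [integral_const_mul, enorm_mul, integral_add (gFi hh0 0 G0 x) (gFi hh0 1 G1 x), enorm_mul, enorm_neg]
    have e4 : ‖((h ^ (-(α/2)) : ℝ) : ℂ)‖ₑ * ‖I‖ₑ = ofReal (h ^ (-(α/2))) := by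
      rw [← ofReal_norm, ← ofReal_norm, norm_real, Complex.norm_I, Real.norm_of_nonneg (by positivity)]; simp
    rw [e4]
    refine (mul_le_mul_right ((enorm_add_le _ _).trans (add_le_add (hconv hh0 0 G0 x) (hconv hh0 1 G1 x))) _).trans (le_of_eq ?_)
    rw [← lintegral_add_left, ← lintegral_const_mul' _ _ (by finiteness)]
    · apply lintegral_congr; intro y; ring
    · refine Measurable.mul (by fun_prop) G0.continuous.measurable.enorm
  refine (enorm_integral_le_lintegral_enorm _).trans ((setLIntegral_mono' measurableSet_Ioi e2).trans ?_)
  rw [lintegral_lintegral_swap]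
  · rw [← lintegral_const_mul' _ _ hC]
    have hne' : ∀ᵐ y : V2, y ≠ x := by simp [ae_iff]
    refine lintegral_mono_ae ?_
    filter_upwards [hne'] with y hy
    rw [lintegral_mul_const' _ _ (by finiteness), mul_left_comm, mul_comm]
    exact mul_le_mul_right (hk _ (norm_pos_iff.2 (sub_ne_zero.2 hy.symm))) _
  · have m1 : Measurable fun z : ℝ × V2 => ofReal (z.1 ^ (-(α/2))) * ofReal (π / 2 * (z.1 ^ (-2:ℝ) * ‖x - z.2‖ * Real.exp (-(‖x - z.2‖ ^ 2) / (4 * z.1)))) := by fun_prop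
    refine Measurable.aemeasurable (m1.mul ?_)
    exact ((G0.continuous.measurable.comp measurable_snd).enorm.add (G1.continuous.measurable.comp measurable_snd).enorm)

section
open scoped LineDeriv
def slc (u : SST) (t : ℝ) : SchwartzMap V2 ℂ :=
  SchwartzMap.compCLM ℂ (g := fun y : V2 => (t, y)) (by
    have h1 : Function.HasTemperateGrowth fun y : V2 => ((t, (0:V2)) : ℝ × V2) := by fun_prop
    have h2 : Function.HasTemperateGrowth fun y : V2 => ((0, y) : ℝ × V2) := (ContinuousLinearMap.inr ℝ ℝ V2).hasTemperateGrowth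
    have e : (fun y : V2 => ((t, y) : ℝ × V2)) = (fun y : V2 => ((t, (0:V2)) : ℝ × V2)) + fun y : V2 => ((0, y) : ℝ × V2) := by
      funext y
      simp
    rw [e]
    exact h1.add h2) ⟨1, 1, fun x => by
      have : ‖x‖ ≤ ‖(t, x)‖ := le_max_right _ _
      rw [pow_one]; linarith⟩ u

lemma slc_apply (u : SST) (t : ℝ) (y : V2) : slc u t y = u (t, y) := rfl

def pS (j : Fin 2) (u : SST) : SST := ∂_{(((0:ℝ), EuclideanSpace.single j 1) : ℝ × V2)} u

lemma pS_coe (j : Fin 2) (u : SST) : ⇑(pS j u) = pdx j u := rfl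

lemma pS_add (j : Fin 2) (u v : SST) : pS j (u + v) = pS j u + pS j v := LineDeriv.lineDerivOp_add _ _ _

lemma pS_neg (j : Fin 2) (u : SST) : pS j (-u) = -pS j u := LineDeriv.lineDerivOp_neg _ _

lemma dS_slc (j : Fin 2) (u : SST) (t : ℝ) : dS j (slc u t) = slc (pS j u) t := by
  ext y
  rw [dS_apply, slc_apply, pS_coe, pdx]
  have h1 : HasFDerivAt (fun y : V2 => ((t, y) : ℝ × V2)) (ContinuousLinearMap.inr ℝ ℝ V2) y := hasFDerivAt_prodMk_right t y
  have h2 := (u.hasFDerivAt (t, y)).comp y h1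
  have h3 : HasFDerivAt (slc u t) ((fderiv ℝ (⇑u) (t, y)).comp (ContinuousLinearMap.inr ℝ ℝ V2)) y := h2
  rw [h3.fderiv]; simp

def mS (u v : SST) : SST := SchwartzMap.pairing (ContinuousLinearMap.mul ℂ ℂ) u v

lemma mS_apply (u v : SST) (p : ℝ × V2) : mS u v p = u p * v p := rfl

def cS {n : ℕ} (U V : Fin n → Fin n → SST) (i k : Fin n) : SST :=
  (∑ l, mS (U i l) (V l k)) - ∑ l, mS (V i l) (U l k)

lemma cS_coe {n : ℕ} (U V : Fin n → Fin n → SST) (i k : Fin n) : ⇑(cS U V i k) = mcomm (cF U) (cF V) i k := by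
  ext p
  simp [cS, mcomm, cF, SchwartzMap.sum_apply, mS_apply]

lemma ell_S {n : ℕ} {A f φ : Fin n → Fin n → SST} (h : EllipticEq A f φ) (i k : Fin n) :
    pS 0 (pS 0 (A i k)) + pS 1 (pS 1 (A i k)) =
      pS 0 (-cS A (fun i k => pS 1 (f i k)) i k + cS (fun i k => pS 0 (f i k)) φ i k) +
      pS 1 (cS A (fun i k => pS 0 (f i k)) i k + cS (fun i k => pS 1 (f i k)) φ i k) := by
  ext p
  have := h i k p
  rw [pS_add, pS_add, pS_neg]
  simp only [SchwartzMap.add_apply, SchwartzMap.neg_apply, pS_coe, cS_coe]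
  have e : ∀ j, cF (fun i k => pS j (f i k)) = pdf j f := fun j => rfl
  rw [e, e, this]; ring

lemma mcomm_sum {n : ℕ} (U V : Fin n → Fin n → (ℝ × V2 → ℂ)) (p : ℝ × V2) :
    ∑ i, ∑ k, ‖mcomm U V i k p‖ₑ ≤ 2 * (mE U p * mE V p) := by
  have key : ∀ u v : Fin n → Fin n → ℝ≥0∞, ∑ i, ∑ k, ∑ l, u i l * v l k ≤ (∑ i, ∑ k, u i k) * ∑ i, ∑ k, v i k := by
    intro u v
    rw [Finset.sum_mul]
    refine Finset.sum_le_sum fun i _ => ?_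
    rw [Finset.sum_comm, Finset.sum_mul]
    refine Finset.sum_le_sum fun l _ => ?_
    rw [← Finset.mul_sum]
    refine mul_le_mul_right ?_ _
    exact Finset.single_le_sum (f := fun l => ∑ k, v l k) (fun _ _ => zero_le) (Finset.mem_univ l)
  have h1 : ∀ i k, ‖mcomm U V i k p‖ₑ ≤ (∑ l, ‖U i l p‖ₑ * ‖V l k p‖ₑ) + ∑ l, ‖V i l p‖ₑ * ‖U l k p‖ₑ := by
    intro i k
    refine (enorm_sub_le).trans (add_le_add ?_ ?_)
    all_goals
      refine (enorm_sum_le _ _).trans (le_of_eq ?_)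
      exact Finset.sum_congr rfl fun l _ => enorm_mul _ _
  refine (Finset.sum_le_sum fun i _ => Finset.sum_le_sum fun k _ => h1 i k).trans ?_
  simp only [Finset.sum_add_distrib]
  rw [two_mul]
  refine add_le_add (key (fun i k => ‖U i k p‖ₑ) (fun i k => ‖V i k p‖ₑ)) ?_
  rw [mul_comm]
  exact key (fun i k => ‖V i k p‖ₑ) (fun i k => ‖U i k p‖ₑ)

def gE {n : ℕ} (f : Fin n → Fin n → SST) (p : ℝ × V2) : ℝ≥0∞ := mE (pdf 0 f) p + mE (pdf 1 f) p

lemma mE_meas {n : ℕ} (U : Fin n → Fin n → SST) : Measurable (mE (cF U)) := by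
  unfold mE
  refine Finset.measurable_sum _ fun i _ => Finset.measurable_sum _ fun k _ => ?_
  exact (U i k).continuous.measurable.enorm

lemma gE_meas {n : ℕ} (f : Fin n → Fin n → SST) : Measurable (gE f) :=
  (mE_meas fun i k => pS 0 (f i k)).add (mE_meas fun i k => pS 1 (f i k))

lemma ell_pt {α : ℝ} (hα0 : 0 ≤ α) (hα1 : α < 1) : ∃ C : ℝ≥0∞, C ≠ ∞ ∧ ∀ (n : ℕ) (A f φ : Fin n → Fin n → SST),
    EllipticEq A f φ → ∀ t x, mE (DxU α (cF A)) (t, x) ≤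
      C * (KK α (fun y => mE (cF A) (t, y)) (fun y => gE f (t, y)) x + KK α (fun y => gE f (t, y)) (fun y => mE (cF φ) (t, y)) x) := by
  obtain ⟨C, hC, h⟩ := repr_est hα0 hα1
  refine ⟨C * 2, by finiteness, fun n A f φ hE t x => ?_⟩
  have h1 : ∀ i k, ‖DxU α (cF A) i k (t, x)‖ₑ ≤ C * ∫⁻ y,
      (‖mcomm (cF A) (pdf 1 f) i k (t, y)‖ₑ + ‖mcomm (pdf 0 f) (cF φ) i k (t, y)‖ₑ + (‖mcomm (cF A) (pdf 0 f) i k (t, y)‖ₑ + ‖mcomm (pdf 1 f) (cF φ) i k (t, y)‖ₑ)) * ofReal (‖x - y‖ ^ (-(1 + α))) := by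
    intro i k
    have h2 := congrArg (fun F => slc F t) (ell_S hE i k)
    have sadd : ∀ u v, slc (u + v) t = slc u t + slc v t := fun u v => rfl
    simp only [sadd] at h2
    rw [← dS_slc, ← dS_slc, ← dS_slc, ← dS_slc, ← dS_slc, ← dS_slc] at h2
    refine (h _ _ _ h2 x).trans (mul_le_mul_right (lintegral_mono fun y => mul_le_mul_left ?_ _) _)
    simp only [SchwartzMap.add_apply, slc_apply, SchwartzMap.neg_apply, cS_coe]
    refine add_le_add ((enorm_add_le _ _).trans ?_) (enorm_add_le _ _)
    rw [enorm_neg]; exact le_rfl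
  have hms : ∀ (u : SST), Measurable fun y => ‖u (t, y)‖ₑ := fun u => (slc u t).continuous.measurable.enorm
  refine (Finset.sum_le_sum fun i _ => Finset.sum_le_sum fun k _ => h1 i k).trans ?_
  have hm : ∀ (i k : Fin n), Measurable fun y => (‖mcomm (cF A) (pdf 1 f) i k (t, y)‖ₑ + ‖mcomm (pdf 0 f) (cF φ) i k (t, y)‖ₑ + (‖mcomm (cF A) (pdf 0 f) i k (t, y)‖ₑ + ‖mcomm (pdf 1 f) (cF φ) i k (t, y)‖ₑ)) * ofReal (‖x - y‖ ^ (-(1 + α))) := by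
    intro i k
    have e1 := hms (cS A (fun i k => pS 1 (f i k)) i k)
    have e2 := hms (cS (fun i k => pS 0 (f i k)) φ i k)
    have e3 := hms (cS A (fun i k => pS 0 (f i k)) i k)
    have e4 := hms (cS (fun i k => pS 1 (f i k)) φ i k)
    simp only [cS_coe] at e1 e2 e3 e4
    exact ((e1.add e2).add (e3.add e4)).mul (by fun_prop)
  have hs : ∀ {f : ℝ × V2 → ℝ≥0∞}, Measurable f → ∀ t, Measurable fun x => f (t, x) := fun hf t => hf.comp (by fun_prop)
  simp only [← Finset.mul_sum]
  rw [mul_assoc]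
  refine mul_le_mul_right ?_ _
  have e5 : ∀ i : Fin n, ∑ k, ∫⁻ y, (‖mcomm (cF A) (pdf 1 f) i k (t, y)‖ₑ + ‖mcomm (pdf 0 f) (cF φ) i k (t, y)‖ₑ + (‖mcomm (cF A) (pdf 0 f) i k (t, y)‖ₑ + ‖mcomm (pdf 1 f) (cF φ) i k (t, y)‖ₑ)) * ofReal (‖x - y‖ ^ (-(1 + α))) =
    ∫⁻ y, ∑ k, (‖mcomm (cF A) (pdf 1 f) i k (t, y)‖ₑ + ‖mcomm (pdf 0 f) (cF φ) i k (t, y)‖ₑ + (‖mcomm (cF A) (pdf 0 f) i k (t, y)‖ₑ + ‖mcomm (pdf 1 f) (cF φ) i k (t, y)‖ₑ)) * ofReal (‖x - y‖ ^ (-(1 + α))) := fun i =>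
    (lintegral_finsetSum _ fun k _ => hm i k).symm
  simp only [e5]
  rw [← lintegral_finsetSum _ fun i _ => Finset.measurable_sum _ fun k _ => hm i k]
  unfold KK
  rw [← lintegral_add_left ?_, ← lintegral_const_mul' _ _ (by finiteness)]
  swap
  · exact ((hs (mE_meas A) t).mul (hs (gE_meas f) t)).mul (by fun_prop)
  refine lintegral_mono fun y => ?_
  simp only [← Finset.sum_mul]
  rw [← add_mul, ← mul_assoc]
  refine mul_le_mul_left ?_ _
  simp only [Finset.sum_add_distrib]
  refine (add_le_add (add_le_add (mcomm_sum _ _ _) (mcomm_sum _ _ _)) (add_le_add (mcomm_sum _ _ _) (mcomm_sum _ _ _))).trans (le_of_eq ?_)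
  unfold gE; ring

lemma DxU_zero {n : ℕ} (A : Fin n → Fin n → SST) : DxU 0 (cF A) = cF A := by
  funext i k p
  have := ft2_inv (slc (A i k) p.1) p.2
  rw [slc_apply] at this
  simp only [DxU, DxA, Real.rpow_zero, Complex.ofReal_one, one_mul]
  exact this.symm
end


lemma mE_count {n : ℕ} (U : Fin n → Fin n → (ℝ × V2 → ℂ)) (z : ℝ × V2) :
    mE U z = ∫⁻ r : Fin n × Fin n, ‖U r.1 r.2 z‖ₑ ∂Measure.count := by
  rw [lintegral_count, tsum_fintype, Fintype.sum_prod_type]; rfl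

lemma HNM_count {n : ℕ} (s θ : ℝ) (U : Fin n → Fin n → (ℝ × V2 → ℂ)) :
    HNM s θ U = ∫⁻ r : Fin n × Fin n, HN s θ (U r.1 r.2) ∂Measure.count := by
  rw [lintegral_count, tsum_fintype, Fintype.sum_prod_type]; rfl

lemma XX_mE {s θ α p Q : ℝ} (hθ : 1 / 2 < θ) (hp : 1 ≤ p) (hQ : 1 < Q) (hpQ : 2 / p + 2 / Q < 1) (hα0 : 0 ≤ α) (hα1 : α < 1)
    (he0 : 0 ≤ 1 + α - 2 / Q - 1 / p) (he : 1 + α - 2 / Q - 1 / p ≤ 2 * s) : ∃ C : ℝ≥0∞, C ≠ ∞ ∧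
    ∀ (n : ℕ) (U : Fin n → Fin n → SST), XX α p Q (fun t x => mE (cF U) (t, x)) ≤ C * HNM s θ (cF U) := by
  obtain ⟨C, hC, h⟩ := XX_bound hθ hp hQ hpQ hα0 hα1 he0 he
  refine ⟨C, hC, fun n U => ?_⟩
  simp only [mE_count, HNM_count]
  refine (XX_mink Measure.count hp hQ.le (w := fun (r : Fin n × Fin n) t x => ‖cF U r.1 r.2 (t, x)‖ₑ)
    (measurable_from_prod_countable_left fun r => ?_)).trans ?_
  · exact (U r.1 r.2).continuous.measurable.enorm
  · rw [← lintegral_const_mul' _ _ hC]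
    exact lintegral_mono fun r => h (U r.1 r.2)

lemma L2_mE {s θ : ℝ} (hθ : 1 / 2 < θ) (hs : 0 < s) : ∃ C : ℝ≥0∞, C ≠ ∞ ∧
    ∀ (n : ℕ) (U : Fin n → Fin n → SST) (t : ℝ), (∫⁻ x, mE (cF U) (t, x) ^ (2:ℝ)) ^ (1/2:ℝ) ≤ C * HNM s θ (cF U) := by
  obtain ⟨C, hC, h⟩ := L2_bound hθ hs
  refine ⟨C, hC, fun n U t => ?_⟩
  simp only [mE_count, HNM_count]
  refine (mink volume Measure.count (p := 2) (by norm_num) (F := fun x (r : Fin n × Fin n) => ‖cF U r.1 r.2 (t, x)‖ₑ)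
    (measurable_from_prod_countable_left fun r => ?_)).trans ?_
  · have : Continuous fun x : V2 => U r.1 r.2 (t, x) := (U r.1 r.2).continuous.comp (by fun_prop)
    exact this.measurable.enorm
  · rw [← lintegral_const_mul' _ _ hC]
    exact lintegral_mono fun r => h (U r.1 r.2) t

lemma grad_le {n : ℕ} (s θ : ℝ) (f : Fin n → Fin n → SST) :
    HNM s θ (pdf 0 f) + HNM s θ (pdf 1 f) ≤ 2 * gradN s θ f := by
  have e : ∀ z : ℝ≥0∞, z = (z ^ (2:ℕ)) ^ ((1:ℝ)/2) := fun z => by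
    rw [← ENNReal.rpow_natCast, ← erm]; norm_num
  rw [two_mul]
  refine add_le_add ?_ ?_
  · rw [e (HNM s θ (pdf 0 f))]
    exact erl le_self_add (by norm_num)
  · rw [e (HNM s θ (pdf 1 f))]
    exact erl le_add_self (by norm_num)

lemma XX_gE {s θ α p Q : ℝ} (hθ : 1 / 2 < θ) (hp : 1 ≤ p) (hQ : 1 < Q) (hpQ : 2 / p + 2 / Q < 1) (hα0 : 0 ≤ α) (hα1 : α < 1)
    (he0 : 0 ≤ 1 + α - 2 / Q - 1 / p) (he : 1 + α - 2 / Q - 1 / p ≤ 2 * s) : ∃ C : ℝ≥0∞, C ≠ ∞ ∧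
    ∀ (n : ℕ) (f : Fin n → Fin n → SST), XX α p Q (fun t x => gE f (t, x)) ≤ C * gradN s θ f := by
  obtain ⟨C, hC, h⟩ := XX_mE hθ hp hQ hpQ hα0 hα1 he0 he
  refine ⟨C * 2, by finiteness, fun n f => ?_⟩
  have h0 := h n fun i k => pS 0 (f i k)
  have h1 := h n fun i k => pS 1 (f i k)
  refine (XX_add hp hQ.le (mE_meas fun i k => pS 0 (f i k)) (mE_meas fun i k => pS 1 (f i k))).trans ?_
  refine (add_le_add h0 h1).trans ?_
  rw [← mul_add, mul_assoc]
  exact mul_le_mul_right (grad_le s θ f) _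

lemma L2_gE {s θ : ℝ} (hθ : 1 / 2 < θ) (hs : 0 < s) : ∃ C : ℝ≥0∞, C ≠ ∞ ∧
    ∀ (n : ℕ) (f : Fin n → Fin n → SST) (t : ℝ), (∫⁻ x, gE f (t, x) ^ (2:ℝ)) ^ (1/2:ℝ) ≤ C * gradN s θ f := by
  obtain ⟨C, hC, h⟩ := L2_mE hθ hs
  refine ⟨C * 2, by finiteness, fun n f t => ?_⟩
  have hs : ∀ {f : ℝ × V2 → ℝ≥0∞}, Measurable f → ∀ t, Measurable fun x => f (t, x) := fun hf t => hf.comp (by fun_prop)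
  have h0 := h n (fun i k => pS 0 (f i k)) t
  have h1 := h n (fun i k => pS 1 (f i k)) t
  refine (ENNReal.lintegral_Lp_add_le (p := 2) (f := fun x => mE (pdf 0 f) (t, x)) (g := fun x => mE (pdf 1 f) (t, x))
    (hs (mE_meas fun i k => pS 0 (f i k)) t).aemeasurable (hs (mE_meas fun i k => pS 1 (f i k)) t).aemeasurable (by norm_num)).trans ?_
  refine (add_le_add h0 h1).trans ?_
  rw [← mul_add, mul_assoc]
  exact mul_le_mul_right (grad_le s θ f) _

lemma MX_KK {s θ α p Q : ℝ} (hθ : 1 / 2 < θ) (hp : 1 ≤ p) (hQ : 1 < Q) (hpQ : 2 / p + 2 / Q < 1) (hα0 : 0 ≤ α) (hα1 : α < 1)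
    (he0 : 0 ≤ 1 + α - 2 / Q - 1 / p) (he : 1 + α - 2 / Q - 1 / p ≤ 2 * s) : ∃ C : ℝ≥0∞, C ≠ ∞ ∧
    ∀ (n : ℕ) (f φ : Fin n → Fin n → SST),
      MX p Q (fun t x => KK α (fun y => gE f (t, y)) (fun y => mE (cF φ) (t, y)) x) ≤ C * (HNM s θ (cF φ) * gradN s θ f) := by
  obtain ⟨C, hC, h⟩ := XX_mE hθ hp hQ hpQ hα0 hα1 he0 he
  obtain ⟨D, hD, h'⟩ := XX_gE hθ hp hQ hpQ hα0 hα1 he0 he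
  refine ⟨C * D, by finiteness, fun n f φ => ?_⟩
  refine (MX_bilin (by linarith) (by linarith) (u := fun t y => gE f (t, y)) (v := fun t y => mE (cF φ) (t, y)) (gE_meas f) (mE_meas φ)).trans ?_
  refine (mul_le_mul' (h' n f) (h n φ)).trans (le_of_eq ?_)
  ring

lemma KK_meas {α : ℝ} {u v : ℝ × V2 → ℝ≥0∞} (hu : Measurable u) (hv : Measurable v) :
    Measurable fun z : ℝ × V2 => KK α (fun y => u (z.1, y)) (fun y => v (z.1, y)) z.2 := by
  refine Measurable.lintegral_prod_right' (f := fun z : (ℝ × V2) × V2 => u (z.1.1, z.2) * v (z.1.1, z.2) * ofReal (‖z.1.2 - z.2‖ ^ (-(1 + α)))) ?_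
  refine Measurable.mul (Measurable.mul ?_ ?_) (by fun_prop)
  · exact Measurable.comp (g := u) (f := fun z : (ℝ × V2) × V2 => (z.1.1, z.2)) hu (by fun_prop)
  · exact Measurable.comp (g := v) (f := fun z : (ℝ × V2) × V2 => (z.1.1, z.2)) hv (by fun_prop)

lemma mE_Lp_fin {n : ℕ} (U : Fin n → Fin n → SST) (t : ℝ) {Q : ℝ} (hQ : 1 ≤ Q) :
    (∫⁻ x, mE (cF U) (t, x) ^ Q) ^ (1 / Q) ≠ ∞ := by
  have hQ0 : 0 < Q := by linarith
  simp only [mE_count]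
  refine ne_top_of_le_ne_top ?_ (mink volume Measure.count hQ (F := fun x (r : Fin n × Fin n) => ‖cF U r.1 r.2 (t, x)‖ₑ)
    (measurable_from_prod_countable_left fun r => ?_))
  · rw [lintegral_count, tsum_fintype]
    refine ENNReal.sum_ne_top.2 fun r _ => ?_
    have h := ((slc (U r.1 r.2) t).memLp (ofReal Q) volume).2
    rw [eLpNorm_eq_lintegral_rpow_enorm_toReal (by simpa using hQ0) (by finiteness), ENNReal.toReal_ofReal hQ0.le] at h
    exact h.ne
  · have : Continuous fun x : V2 => U r.1 r.2 (t, x) := (U r.1 r.2).continuous.comp (by fun_prop)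
    exact this.measurable.enorm

lemma fixed {s θ α Q M : ℝ} (hθ : 1 / 2 < θ) (hs : 0 < s) (hα0 : 0 ≤ α) (hα1 : α < 1) (hQ : 2 < Q) (hM : 2 < M)
    (h : 1 / Q = 1 / M + α / 2) : ∃ C : ℝ≥0∞, C ≠ ∞ ∧ ∀ (n : ℕ) (A f φ : Fin n → Fin n → SST),
    EllipticEq A f φ → ∀ t, (∫⁻ x, mE (DxU α (cF A)) (t, x) ^ Q) ^ (1 / Q) ≤
      C * (gradN s θ f * (∫⁻ x, mE (cF A) (t, x) ^ M) ^ (1 / M) +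
        (∫⁻ x, KK α (fun y => gE f (t, y)) (fun y => mE (cF φ) (t, y)) x ^ Q) ^ (1 / Q)) := by
  obtain ⟨C1, hC1, h1⟩ := ell_pt hα0 hα1
  obtain ⟨C2, hC2, h2⟩ := frac hα0 hα1 hQ hM h
  obtain ⟨C3, hC3, h3⟩ := L2_gE hθ hs
  refine ⟨C1 * (C2 * C3 + 1), by finiteness, fun n A f φ hE t => ?_⟩
  have hsl : ∀ {f : ℝ × V2 → ℝ≥0∞}, Measurable f → ∀ t, Measurable fun x => f (t, x) := fun hf t => hf.comp (by fun_prop)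
  have hQ0 : 0 < Q := by linarith
  have mA := hsl (mE_meas A) t
  have mg := hsl (gE_meas f) t
  refine (erl (lintegral_mono fun x => erl (h1 n A f φ hE t x) hQ0.le) (by positivity)).trans ?_
  simp only [mul_rpow_of_nonneg _ _ hQ0.le]
  rw [lintegral_const_mul' _ _ (rpow_ne_top_of_nonneg hQ0.le hC1), mul_rpow_of_nonneg _ _ (by positivity),
    ← erm, mul_one_div_cancel hQ0.ne', ENNReal.rpow_one, mul_assoc]
  refine mul_le_mul_right ?_ _
  refine (ENNReal.lintegral_Lp_add_le (p := Q) (f := fun x => KK α (fun y => mE (cF A) (t, y)) (fun y => gE f (t, y)) x)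
    (g := fun x => KK α (fun y => gE f (t, y)) (fun y => mE (cF φ) (t, y)) x)
    (hsl (KK_meas (mE_meas A) (gE_meas f)) t).aemeasurable (hsl (KK_meas (gE_meas f) (mE_meas φ)) t).aemeasurable (by linarith)).trans ?_
  rw [mul_add]
  refine add_le_add ?_ ?_
  · refine (h2 _ _ mA mg).trans ?_
    refine (mul_le_mul_right (mul_le_mul_right (h3 n f t) _) _).trans ?_
    refine le_trans (le_of_eq ?_) (mul_le_mul_left (le_self_add (a := C2 * C3) (b := 1)) _)
    ring
  · refine le_trans (le_of_eq (one_mul _).symm) (mul_le_mul_left le_add_self _)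

lemma absorb {C : ℝ≥0∞} (hC : C ≠ ∞) : ∃ ε : ℝ, 0 < ε ∧ ∀ g x y : ℝ≥0∞, g ≤ ofReal ε → x ≠ ∞ → x ≤ C * (g * x + y) → x ≤ 2 * C * y := by
  refine ⟨1 / (2 * (C.toReal + 1)), by positivity, fun g x y hg hx h => ?_⟩
  have h1 : C * g ≤ 1 / 2 := by
    refine (mul_le_mul_right hg _).trans ?_
    rw [← ENNReal.ofReal_toReal hC, ← ofReal_mul (by positivity), show (1/2:ℝ≥0∞) = ofReal (1/2) by
      rw [ENNReal.ofReal_div_of_pos (by norm_num)]; simp]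
    refine ofReal_le_ofReal ?_
    rw [ENNReal.toReal_ofReal (by positivity)]
    have := @ENNReal.toReal_nonneg C
    rw [mul_one_div, div_le_div_iff₀ (by positivity) (by norm_num)]; linarith
  have h2 : x ≤ x / 2 + C * y := by
    refine h.trans ?_
    rw [mul_add, ← mul_assoc]
    refine add_le_add ((mul_le_mul_left h1 x).trans (le_of_eq ?_)) le_rfl
    rw [ENNReal.div_eq_inv_mul, ENNReal.div_eq_inv_mul, mul_one]
  have h3 : x / 2 ≤ C * y := by
    have : x / 2 + x / 2 ≤ x / 2 + C * y := by rwa [ENNReal.add_halves]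
    exact (ENNReal.add_le_add_iff_left (ENNReal.div_ne_top hx (by norm_num))).1 this
  calc x = x / 2 + x / 2 := (ENNReal.add_halves x).symm
    _ ≤ C * y + C * y := add_le_add h3 h3
    _ = 2 * C * y := by ring

lemma fixed0 {s θ Q : ℝ} (hθ : 1 / 2 < θ) (hs : 0 < s) (hQ : 2 < Q) : ∃ C : ℝ≥0∞, C ≠ ∞ ∧ ∃ ε : ℝ, 0 < ε ∧
    ∀ (n : ℕ) (A f φ : Fin n → Fin n → SST),
    EllipticEq A f φ → gradN s θ f ≤ ofReal ε → ∀ t, (∫⁻ x, mE (cF A) (t, x) ^ Q) ^ (1 / Q) ≤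
      C * (∫⁻ x, KK 0 (fun y => gE f (t, y)) (fun y => mE (cF φ) (t, y)) x ^ Q) ^ (1 / Q) := by
  obtain ⟨C, hC, h⟩ := fixed (s := s) (α := 0) hθ hs le_rfl (by norm_num) hQ hQ (by ring)
  obtain ⟨ε, hε, h'⟩ := absorb hC
  refine ⟨2 * C, by finiteness, ε, hε, fun n A f φ hE hg t => ?_⟩
  have := h n A f φ hE t
  rw [DxU_zero] at this
  exact h' _ _ _ hg (mE_Lp_fin A t (by linarith)) this

lemma MX_eq {p Q : ℝ} (hQ : 0 < Q) (F : ℝ → V2 → ℝ≥0∞) :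
    MX p Q F = (∫⁻ t, ((∫⁻ x, F t x ^ Q) ^ (1 / Q)) ^ p) ^ (1 / p) := by
  unfold MX
  simp only [← erm]
  rw [show 1 / Q * p = p / Q by ring]

/-- Non-homogeneous elliptic estimate for `A₀` (Theorem 5.2, part i, `aq < 2`):
for `s > 0`, `θ > 1/2`, `0 < a < min(2s,1)`, `aq < 2`,
`max(1/2 + a - 2s, a/2) < 1/q < 1/2` and `1 - 2/q + a - 2s ≤ 1/p < 1/2 - 1/q`,
there exist `ε₀ > 0` and `C` such that any Schwartz matrix-valued solution of
`△A₀ = -∂₁[A₀,∂₂f] + ∂₂[A₀,∂₁f] + ∂₁[∂₁f,φ] + ∂₂[∂₂f,φ]` with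
`‖∇f‖_{H^{s,θ}} ≤ ε₀` satisfies `‖A₀‖_{L^p_t W^{a,q}_x} ≤ C ‖φ‖_{H^{s,θ}} ‖∇f‖_{H^{s,θ}}`. -/
theorem elliptic_nonhomogeneous_estimate_aq_lt_two (n : ℕ) (hn : 1 ≤ n)
    (s θ a p q : ℝ) (hs : 0 < s) (hθ : 1 / 2 < θ)
    (ha0 : 0 < a) (ha1 : a < min (2 * s) 1)
    (hp0 : 1 ≤ p) (haq : a * q < 2)
    (hq1 : max (1 / 2 + a - 2 * s) (a / 2) < 1 / q) (hq2 : 1 / q < 1 / 2)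
    (hp1 : 1 - 2 / q + a - 2 * s ≤ 1 / p) (hp2 : 1 / p < 1 / 2 - 1 / q) :
    ∃ ε₀ C : ℝ, 0 < ε₀ ∧ 0 < C ∧
      ∀ A0 f φ : Fin n → Fin n → SchwartzMap (ℝ × V2) ℂ,
        EllipticEq A0 f φ →
        gradN s θ f ≤ ENNReal.ofReal ε₀ →
        Ltp p (fun t => LqAt q (cF A0) t + LqAt q (DxU a (cF A0)) t) ≤
          ENNReal.ofReal C * (HNM s θ (cF φ) * gradN s θ f) := by
  obtain ⟨ha1', ha1⟩ := lt_min_iff.1 ha1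
  obtain ⟨hq3, hq4⟩ := max_lt_iff.1 hq1
  have hq0 : 0 < q := by
    rcases le_or_gt q 0 with h | h
    · have : 1 / q ≤ 0 := one_div_nonpos.2 h
      linarith
    · exact h
  have hp00 : 0 < p := by linarith
  have hq : 2 < q := by
    rw [one_div_lt_one_div hq0 (by norm_num)] at hq2; exact hq2
  have hd : 0 < 2 - a * q := by linarith
  obtain ⟨m, hm, hm0⟩ : ∃ m : ℝ, 1 / q = 1 / m + a / 2 ∧ 0 < m := by
    refine ⟨2 * q / (2 - a * q), ?_, by positivity⟩
    field_simp
    ring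
  have hm2 : 2 < m := by
    rw [← one_div_lt_one_div hm0 (by norm_num)]; linarith
  have e1 : 2 / q = 2 * (1 / q) := by ring
  have e2 : 2 / m = 2 * (1 / m) := by ring
  have e3 : 2 / p = 2 * (1 / p) := by ring
  obtain ⟨K1, hK1, M1⟩ := MX_KK (s := s) (θ := θ) (α := 0) (p := p) (Q := q) hθ hp0 (by linarith) (by linarith) le_rfl (by norm_num) (by linarith) (by linarith)
  obtain ⟨K2, hK2, M2⟩ := MX_KK (s := s) (θ := θ) (α := 0) (p := p) (Q := m) hθ hp0 (by linarith) (by linarith) le_rfl (by norm_num) (by linarith) (by linarith)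
  obtain ⟨K3, hK3, M3⟩ := MX_KK (s := s) (θ := θ) (α := a) (p := p) (Q := q) hθ hp0 (by linarith) (by linarith) ha0.le ha1 (by linarith) (by linarith)
  obtain ⟨C1, hC1, ε1, hε1, B1⟩ := fixed0 (s := s) hθ hs hq
  obtain ⟨C2, hC2, ε2, hε2, B2⟩ := fixed0 (s := s) hθ hs hm2
  obtain ⟨C3, hC3, B3⟩ := fixed (s := s) hθ hs ha0.le ha1 hq hm2 hm
  set K : ℝ≥0∞ := C1 * K1 + C3 * (C2 * K2 + K3) with hK
  have hKf : K ≠ ∞ := by rw [hK]; finiteness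
  refine ⟨min 1 (min ε1 ε2), K.toReal + 1, by positivity, by positivity, fun A f φ hE hg => ?_⟩
  have g0 : gradN s θ f ≤ 1 := hg.trans (by simp)
  have g1 : gradN s θ f ≤ ofReal ε1 := hg.trans (ofReal_le_ofReal (by simp))
  have g2 : gradN s θ f ≤ ofReal ε2 := hg.trans (ofReal_le_ofReal (by simp))
  set N1 : ℝ → ℝ≥0∞ := fun t => (∫⁻ x, KK 0 (fun y => gE f (t, y)) (fun y => mE (cF φ) (t, y)) x ^ q) ^ (1 / q) with hN1
  set N2 : ℝ → ℝ≥0∞ := fun t => (∫⁻ x, KK 0 (fun y => gE f (t, y)) (fun y => mE (cF φ) (t, y)) x ^ m) ^ (1 / m) with hN2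
  set N3 : ℝ → ℝ≥0∞ := fun t => (∫⁻ x, KK a (fun y => gE f (t, y)) (fun y => mE (cF φ) (t, y)) x ^ q) ^ (1 / q) with hN3
  have mN : ∀ α Q : ℝ, Measurable fun t : ℝ => (∫⁻ x, KK α (fun y => gE f (t, y)) (fun y => mE (cF φ) (t, y)) x ^ Q) ^ (1 / Q) := by
    intro α Q
    refine Measurable.pow_const ?_ _
    exact Measurable.lintegral_prod_right' (f := fun z : ℝ × V2 => KK α (fun y => gE f (z.1, y)) (fun y => mE (cF φ) (z.1, y)) z.2 ^ Q)
      ((KK_meas (gE_meas f) (mE_meas φ)).pow_const _)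
  have mN1 : Measurable N1 := mN 0 q
  have mN2 : Measurable N2 := mN 0 m
  have mN3 : Measurable N3 := mN a q
  have X1 := M1 n f φ
  have X2 := M2 n f φ
  have X3 := M3 n f φ
  rw [MX_eq hq0] at X1 X3
  rw [MX_eq hm0] at X2
  have hpt : ∀ t, LqAt q (cF A) t + LqAt q (DxU a (cF A)) t ≤ C1 * N1 t + (C3 * C2 * N2 t + C3 * N3 t) := by
    intro t
    unfold LqAt
    rw [← one_div]
    refine add_le_add (B1 n A f φ hE g1 t) ((B3 n A f φ hE t).trans ?_)
    rw [mul_assoc, ← mul_add]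
    refine mul_le_mul_right (add_le_add ?_ le_rfl) _
    exact (mul_le_mul' g0 (B2 n A f φ hE g2 t)).trans (le_of_eq (one_mul _))
  have sc : ∀ (c : ℝ≥0∞) (N : ℝ → ℝ≥0∞), c ≠ ∞ → (∫⁻ t, (c * N t) ^ p) ^ (1 / p) = c * (∫⁻ t, N t ^ p) ^ (1 / p) := by
    intro c N hc
    simp only [mul_rpow_of_nonneg _ _ hp00.le]
    rw [lintegral_const_mul' _ _ (rpow_ne_top_of_nonneg hp00.le hc), mul_rpow_of_nonneg _ _ (by positivity),
      ← erm, mul_one_div_cancel hp00.ne', ENNReal.rpow_one]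
  unfold Ltp
  rw [← one_div]
  have hfin : ofReal (K.toReal + 1) ≥ K := by
    rw [ge_iff_le, ENNReal.le_ofReal_iff_toReal_le hKf (by positivity)]; linarith
  refine le_trans ?_ (mul_le_mul_left hfin _)
  refine (erl (lintegral_mono fun t => erl (hpt t) hp00.le) (by positivity)).trans ?_
  refine (ENNReal.lintegral_Lp_add_le (p := p) (f := fun t => C1 * N1 t) (g := fun t => C3 * C2 * N2 t + C3 * N3 t)
    (by fun_prop) (by fun_prop) hp0).trans ?_
  refine (add_le_add le_rfl (ENNReal.lintegral_Lp_add_le (p := p) (f := fun t => C3 * C2 * N2 t) (g := fun t => C3 * N3 t)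
    (by fun_prop) (by fun_prop) hp0)).trans ?_
  rw [sc _ _ hC1, sc _ _ (by finiteness), sc _ _ hC3]
  refine (add_le_add (mul_le_mul_right X1 _) (add_le_add (mul_le_mul_right X2 _) (mul_le_mul_right X3 _))).trans (le_of_eq ?_)
  rw [hK]; ring
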